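/- arXiv:2604.26728 — 5 statements merged into one kernel-verified Lean document; each statement's English description precedes it below -/
import Mathlib

section
/- Let α > -1, 1 ≤ p < ∞ and 0 < R < 1. There exists a constant C = C(n,α,p,R) such that for all f ∈ C¹(𝔹), ∫_𝔹 |f(x)|^p (1-|x|²)^α dν(x) ≤ C ( ∫_𝔹 |∇f(x)|^p (1-|x|²)^{α+p} dν(x) + ∫_{B_R} |f(x)|^p dν(x) ), where B_R is the ball of radius R centered at 0. -/
open MeasureTheory Metric

theorem young_rpow_split {p c x b : ℝ} (hp : 1 ≤ p) (hc : 0 < c) (hx : 0 < x) (hb : 0 ≤ b) :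
    p * x ^ (p - 1) * b ≤ c * x ^ p + p * (p / c) ^ (p - 1) * b ^ p := by
  have hp0 : 0 < p := by linarith
  have key : ∀ y : ℝ, 0 < y → y ^ p = y ^ (p - 1) * y := fun y hy => by
    rw [← Real.rpow_add_one hy.ne', sub_add_cancel]
  rcases le_or_gt (p * b) (c * x) with h | h
  · calc p * x ^ (p - 1) * b = x ^ (p - 1) * (p * b) := by ring
      _ ≤ x ^ (p - 1) * (c * x) := by gcongr
      _ = c * x ^ p := by rw [key x hx]; ring
      _ ≤ _ := le_add_of_nonneg_right (by positivity)
  · have hb' : 0 < b := by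
      have : 0 < p * b := (by positivity : 0 < c * x).trans h
      exact pos_of_mul_pos_right this hp0.le
    have hxb : x ≤ p / c * b := by
      rw [div_mul_eq_mul_div, le_div_iff₀ hc]; linarith
    calc p * x ^ (p - 1) * b ≤ p * (p / c * b) ^ (p - 1) * b := by
          gcongr
      _ = p * (p / c) ^ (p - 1) * b ^ p := by
          rw [Real.mul_rpow (by positivity) hb, key b hb']; ring
      _ ≤ _ := le_add_of_nonneg_left (by positivity)

theorem hardy_interval_of_pos {α p a s ρ : ℝ} (hα : -1 < α) (hp : 1 ≤ p) (ha : 0 < a)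
    (has : a ≤ s) (hsρ : s ≤ ρ) (hρ : ρ < 1) {u u' : ℝ → ℝ}
    (hu : ∀ r ∈ Set.Icc s ρ, HasDerivAt u (u' r) r) (hu' : ContinuousOn u' (Set.Icc s ρ))
    (hpos : ∀ r ∈ Set.Icc s ρ, 0 < u r) :
    a * (α + 1) * ∫ r in s..ρ, u r ^ p * (1 - r ^ 2) ^ α ≤
      u s ^ p + p * (p / (a * (α + 1))) ^ (p - 1) *
        ∫ r in s..ρ, |u' r| ^ p * (1 - r ^ 2) ^ (α + p) := by
  set c := a * (α + 1) with hc_def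
  have hc : 0 < c := mul_pos ha (by linarith)
  set K := p * (p / c) ^ (p - 1) with hK_def
  have hw : ∀ r ∈ Set.Icc s ρ, 0 < 1 - r ^ 2 := fun r hr => by nlinarith [hr.1, hr.2]
  have hucont : ContinuousOn u (Set.Icc s ρ) := fun r hr => (hu r hr).continuousAt.continuousWithinAt
  have hwcont : ∀ β : ℝ, ContinuousOn (fun r : ℝ => (1 - r ^ 2) ^ β) (Set.Icc s ρ) := fun β =>
    ContinuousOn.rpow_const (by fun_prop) fun r hr => Or.inl (hw r hr).ne'
  have hupcont : ContinuousOn (fun r => u r ^ p) (Set.Icc s ρ) :=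
    hucont.rpow_const fun r hr => Or.inr (by linarith)
  have h1 : ContinuousOn (fun r => u r ^ p * (1 - r ^ 2) ^ α) (Set.Icc s ρ) :=
    hupcont.mul (hwcont α)
  have h2 : ContinuousOn (fun r => |u' r| ^ p * (1 - r ^ 2) ^ (α + p)) (Set.Icc s ρ) :=
    (hu'.abs.rpow_const fun r hr => Or.inr (by linarith)).mul (hwcont _)
  have hint : ∀ {h : ℝ → ℝ}, ContinuousOn h (Set.Icc s ρ) → IntervalIntegrable h volume s ρ :=
    fun hh => ContinuousOn.intervalIntegrable (by rwa [Set.uIcc_of_le hsρ])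
  have hderiv : ∀ r ∈ Set.Icc s ρ, HasDerivAt (fun r => u r ^ p * (1 - r ^ 2) ^ (α + 1))
      (u' r * p * u r ^ (p - 1) * (1 - r ^ 2) ^ (α + 1) +
        u r ^ p * (-(2 * r) * (α + 1) * (1 - r ^ 2) ^ α)) r := fun r hr => by
    have hd : HasDerivAt (fun r : ℝ => 1 - r ^ 2) (-(2 * r)) r := by
      simpa using (hasDerivAt_pow 2 r).const_sub 1
    have := ((hu r hr).rpow_const (p := p) (Or.inl (hpos r hr).ne')).mul
      (hd.rpow_const (p := α + 1) (Or.inl (hw r hr).ne'))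
    rw [add_sub_cancel_right] at this
    exact this
  have main := intervalIntegral.sub_le_integral_of_hasDeriv_right_of_le hsρ
    (hupcont.mul (hwcont (α + 1)))
    (fun r hr => (hderiv r (Set.Ioo_subset_Icc_self hr)).hasDerivWithinAt)
    (φ := fun r => -(c * (u r ^ p * (1 - r ^ 2) ^ α)) + K * (|u' r| ^ p * (1 - r ^ 2) ^ (α + p)))
    (((h1.const_smul c).neg.add (h2.const_smul K)).integrableOn_Icc)
    (fun r hr => by
      have hr' := Set.Ioo_subset_Icc_self hr
      have hwr := hw r hr'
      have hur := hpos r hr'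
      have hy := young_rpow_split hp hc hur (b := |u' r| * (1 - r ^ 2)) (by positivity)
      rw [Real.mul_rpow (abs_nonneg _) hwr.le] at hy
      have hwα : 0 < (1 - r ^ 2) ^ α := by positivity
      have hup : 0 < u r ^ p := by positivity
      have e1 : (1 - r ^ 2) ^ (α + 1) = (1 - r ^ 2) ^ α * (1 - r ^ 2) :=
        Real.rpow_add_one hwr.ne' _
      have e2 : (1 - r ^ 2) ^ (α + p) = (1 - r ^ 2) ^ α * (1 - r ^ 2) ^ p := Real.rpow_add hwr _ _
      have hA : u' r * p * u r ^ (p - 1) * (1 - r ^ 2) ^ (α + 1) ≤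
          (p * u r ^ (p - 1) * (|u' r| * (1 - r ^ 2))) * (1 - r ^ 2) ^ α := by
        rw [e1]
        calc _ = u' r * (p * u r ^ (p - 1) * (1 - r ^ 2) ^ α * (1 - r ^ 2)) := by ring
          _ ≤ |u' r| * (p * u r ^ (p - 1) * (1 - r ^ 2) ^ α * (1 - r ^ 2)) := by
            gcongr
            exact le_abs_self _
          _ = _ := by ring
      have hB := mul_le_mul_of_nonneg_right hy hwα.le
      have hC : 2 * c ≤ 2 * r * (α + 1) := by
        rw [hc_def]
        have : a ≤ r := has.trans hr.1.le
        nlinarith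
      have hD := mul_le_mul_of_nonneg_right hC (mul_pos hup hwα).le
      show _ ≤ -(c * (u r ^ p * (1 - r ^ 2) ^ α)) + K * (|u' r| ^ p * (1 - r ^ 2) ^ (α + p))
      rw [e2]
      nlinarith)
  rw [intervalIntegral.integral_add (f := fun r => -(c * (u r ^ p * (1 - r ^ 2) ^ α)))
    (g := fun r => K * (|u' r| ^ p * (1 - r ^ 2) ^ (α + p)))
    (hint (h1.const_smul c).neg) (hint (h2.const_smul K)),
    intervalIntegral.integral_neg, intervalIntegral.integral_const_mul,
    intervalIntegral.integral_const_mul] at main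
  simp only [Pi.mul_apply] at main
  have hend : 0 ≤ u ρ ^ p * (1 - ρ ^ 2) ^ (α + 1) :=
    mul_nonneg (Real.rpow_nonneg (hpos ρ ⟨hsρ, le_rfl⟩).le _)
      (Real.rpow_nonneg (hw ρ ⟨hsρ, le_rfl⟩).le _)
  have hstart : u s ^ p * (1 - s ^ 2) ^ (α + 1) ≤ u s ^ p :=
    mul_le_of_le_one_right (Real.rpow_nonneg (hpos s ⟨le_rfl, hsρ⟩).le _)
      (Real.rpow_le_one (hw s ⟨le_rfl, hsρ⟩).le (by nlinarith [sq_nonneg s]) (by linarith))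
  linarith

theorem hardy_interval {α p a s ρ : ℝ} (hα : -1 < α) (hp : 1 ≤ p) (ha : 0 < a)
    (has : a ≤ s) (hsρ : s ≤ ρ) (hρ : ρ < 1) {g g' : ℝ → ℝ}
    (hg : ∀ r ∈ Set.Icc s ρ, HasDerivAt g (g' r) r) (hg' : ContinuousOn g' (Set.Icc s ρ)) :
    a * (α + 1) * ∫ r in s..ρ, |g r| ^ p * (1 - r ^ 2) ^ α ≤
      |g s| ^ p + p * (p / (a * (α + 1))) ^ (p - 1) *
        ∫ r in s..ρ, |g' r| ^ p * (1 - r ^ 2) ^ (α + p) := by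
  have hc : 0 < a * (α + 1) := mul_pos ha (by linarith)
  have hw : ∀ r ∈ Set.Icc s ρ, 0 < 1 - r ^ 2 := fun r hr => by nlinarith [hr.1, hr.2]
  have hgcont : ContinuousOn g (Set.Icc s ρ) := fun r hr => (hg r hr).continuousAt.continuousWithinAt
  have hwcont : ∀ β : ℝ, ContinuousOn (fun r : ℝ => (1 - r ^ 2) ^ β) (Set.Icc s ρ) := fun β =>
    ContinuousOn.rpow_const (by fun_prop) fun r hr => Or.inl (hw r hr).ne'
  have hint : ∀ {h : ℝ → ℝ} (β : ℝ), ContinuousOn h (Set.Icc s ρ) →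
      IntervalIntegrable (fun r => |h r| ^ p * (1 - r ^ 2) ^ β) volume s ρ := fun β hh =>
    ContinuousOn.intervalIntegrable (by
      rw [Set.uIcc_of_le hsρ]
      exact (hh.abs.rpow_const fun r hr => Or.inr (by linarith)).mul (hwcont β))
  have hsq : ∀ δ > 0, ∀ r, 0 < g r ^ 2 + δ := fun δ hδ r => by positivity
  have hle : ∀ δ > 0, ∀ r, |g r| ≤ √(g r ^ 2 + δ) := fun δ hδ r =>
    Real.abs_le_sqrt (by linarith)
  have key : ∀ δ : ℝ, 0 < δ → a * (α + 1) * ∫ r in s..ρ, |g r| ^ p * (1 - r ^ 2) ^ α ≤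
      √(g s ^ 2 + δ) ^ p + p * (p / (a * (α + 1))) ^ (p - 1) *
        ∫ r in s..ρ, |g' r| ^ p * (1 - r ^ 2) ^ (α + p) := fun δ hδ => by
    have hucont : ContinuousOn (fun r => √(g r ^ 2 + δ)) (Set.Icc s ρ) := by fun_prop
    have hu'cont : ContinuousOn (fun r => 2 * g r * g' r / (2 * √(g r ^ 2 + δ)))
        (Set.Icc s ρ) := by
      refine ContinuousOn.div (by fun_prop) (by fun_prop) fun r _ => ?_
      have := Real.sqrt_pos.2 (hsq δ hδ r)
      positivity
    have h := hardy_interval_of_pos hα hp ha has hsρ hρ (u := fun r => √(g r ^ 2 + δ))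
      (u' := fun r => 2 * g r * g' r / (2 * √(g r ^ 2 + δ)))
      (fun r hr => by
        have := (((hg r hr).pow 2).add_const δ).sqrt (hsq δ hδ r).ne'
        simpa using this)
      hu'cont (fun r _ => Real.sqrt_pos.2 (hsq δ hδ r))
    refine le_trans ?_ (h.trans ?_)
    · refine mul_le_mul_of_nonneg_left ?_ hc.le
      refine intervalIntegral.integral_mono_on hsρ (hint α hgcont) ?_ fun r hr => ?_
      · simpa only [abs_of_nonneg (Real.sqrt_nonneg _)] using hint α hucont
      · have := hw r hr
        gcongr
        exact hle δ hδ r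
    · gcongr
      refine intervalIntegral.integral_mono_on hsρ (hint _ hu'cont) (hint _ hg') fun r hr => ?_
      have := hw r hr
      have hpos := Real.sqrt_pos.2 (hsq δ hδ r)
      refine mul_le_mul_of_nonneg_right (Real.rpow_le_rpow (abs_nonneg _) ?_ (by linarith))
        (Real.rpow_nonneg this.le _)
      rw [abs_div, abs_of_pos (mul_pos two_pos hpos), div_le_iff₀ (by positivity), abs_mul, abs_mul,
        abs_two]
      nlinarith [mul_le_mul_of_nonneg_right (hle δ hδ r) (abs_nonneg (g' r))]
  have hlim : Filter.Tendsto (fun δ : ℝ => √(g s ^ 2 + δ) ^ p +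
      p * (p / (a * (α + 1))) ^ (p - 1) * ∫ r in s..ρ, |g' r| ^ p * (1 - r ^ 2) ^ (α + p))
      (nhdsWithin 0 (Set.Ioi 0)) (nhds (|g s| ^ p + p * (p / (a * (α + 1))) ^ (p - 1) *
        ∫ r in s..ρ, |g' r| ^ p * (1 - r ^ 2) ^ (α + p))) := by
    have hcont : Continuous fun δ : ℝ => √(g s ^ 2 + δ) ^ p :=
      Continuous.rpow_const (by fun_prop) fun _ => Or.inr (by linarith)
    have := (hcont.tendsto 0).mono_left (nhdsWithin_le_nhds (s := Set.Ioi (0 : ℝ)))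
    rw [add_zero, Real.sqrt_sq_eq_abs] at this
    exact this.add_const _
  exact ge_of_tendsto hlim (by filter_upwards [self_mem_nhdsWithin] with δ hδ using key δ hδ)

theorem lintegral_hardy {α p a s : ℝ} (hα : -1 < α) (hp : 1 ≤ p) (ha : 0 < a) {g g' : ℝ → ℝ}
    (hg : ∀ r ∈ Set.Ioo a 1, HasDerivAt g (g' r) r) (hg' : ContinuousOn g' (Set.Ioo a 1))
    (hs : s ∈ Set.Ioo a 1) :
    ENNReal.ofReal (a * (α + 1)) *
        ∫⁻ r in Set.Ioo s 1, ENNReal.ofReal (|g r| ^ p * (1 - r ^ 2) ^ α) ≤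
      ENNReal.ofReal (|g s| ^ p) + ENNReal.ofReal (p * (p / (a * (α + 1))) ^ (p - 1)) *
        ∫⁻ r in Set.Ioo a 1, ENNReal.ofReal (|g' r| ^ p * (1 - r ^ 2) ^ (α + p)) := by
  have hc : 0 < a * (α + 1) := mul_pos ha (by linarith)
  have hsub : ∀ {ρ : ℝ}, ρ < 1 → Set.Icc s ρ ⊆ Set.Ioo a 1 := fun hρ r hr =>
    ⟨hs.1.trans_le hr.1, hr.2.trans_lt hρ⟩
  have hw : ∀ r ∈ Set.Ioo a 1, 0 < 1 - r ^ 2 := fun r hr => by nlinarith [hr.1, hr.2]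
  have hofReal : ∀ {h : ℝ → ℝ} {ρ : ℝ} (β : ℝ), s ≤ ρ → ρ < 1 → ContinuousOn h (Set.Ioo a 1) →
      ENNReal.ofReal (∫ r in s..ρ, |h r| ^ p * (1 - r ^ 2) ^ β) =
        ∫⁻ r in Set.Ioc s ρ, ENNReal.ofReal (|h r| ^ p * (1 - r ^ 2) ^ β) :=
    fun {h ρ} β hsρ hρ hh => by
      rw [intervalIntegral.integral_of_le hsρ]
      refine ofReal_integral_eq_lintegral_ofReal ?_ ?_
      · have : ContinuousOn (fun r => |h r| ^ p * (1 - r ^ 2) ^ β) (Set.Icc s ρ) :=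
          ((hh.mono (hsub hρ)).abs.rpow_const fun r hr => Or.inr (by linarith)).mul
            (ContinuousOn.rpow_const (by fun_prop) fun r hr => Or.inl (hw r (hsub hρ hr)).ne')
        exact this.integrableOn_Icc.mono_set Set.Ioc_subset_Icc_self
      · filter_upwards [ae_restrict_mem measurableSet_Ioc] with r hr
        have := hw r (hsub hρ (Set.Ioc_subset_Icc_self hr))
        show 0 ≤ _
        positivity
  have hgcont : ContinuousOn g (Set.Ioo a 1) := fun r hr =>
    (hg r hr).continuousAt.continuousWithinAt
  obtain ⟨ρ, hρmono, hρmem, hρlim⟩ := exists_seq_strictMono_tendsto' hs.2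
  have hcover : Set.Ioo s 1 ⊆ ⋃ k, Set.Ioc s (ρ k) := fun r hr => by
    obtain ⟨k, hk⟩ := (hρlim.eventually (lt_mem_nhds hr.2)).exists
    exact Set.mem_iUnion.2 ⟨k, hr.1, hk.le⟩
  refine (mul_le_mul_right (lintegral_mono_set hcover) _).trans ?_
  rw [setLIntegral_iUnion_of_directed, ENNReal.mul_iSup]
  · refine iSup_le fun k => ?_
    have hsρ : s ≤ ρ k := (hρmem k).1.le
    have hρ : ρ k < 1 := (hρmem k).2
    have h := hardy_interval hα hp ha hs.1.le hsρ hρ (fun r hr => hg r (hsub hρ hr))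
      (hg'.mono (hsub hρ))
    rw [← hofReal α hsρ hρ hgcont, ← ENNReal.ofReal_mul hc.le]
    refine (ENNReal.ofReal_le_ofReal h).trans (ENNReal.ofReal_add_le.trans ?_)
    rw [ENNReal.ofReal_mul (by positivity), hofReal _ hsρ hρ hg']
    gcongr
    exact Set.Ioc_subset_Icc_self.trans (hsub hρ)
  · exact Monotone.directed_le fun i j hij => Set.Ioc_subset_Ioc_right (hρmono.monotone hij)

theorem lintegral_hardy_average {α p a R : ℝ} (hα : -1 < α) (hp : 1 ≤ p) (ha : 0 < a)
    (hR : R < 1) {g g' : ℝ → ℝ}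
    (hg : ∀ r ∈ Set.Ioo a 1, HasDerivAt g (g' r) r) (hg' : ContinuousOn g' (Set.Ioo a 1)) :
    ENNReal.ofReal (R - a) * (ENNReal.ofReal (a * (α + 1)) *
        ∫⁻ r in Set.Ico R 1, ENNReal.ofReal (|g r| ^ p * (1 - r ^ 2) ^ α)) ≤
      (∫⁻ r in Set.Ioo a R, ENNReal.ofReal (|g r| ^ p)) +
        ENNReal.ofReal (R - a) * (ENNReal.ofReal (p * (p / (a * (α + 1))) ^ (p - 1)) *
          ∫⁻ r in Set.Ioo a 1, ENNReal.ofReal (|g' r| ^ p * (1 - r ^ 2) ^ (α + p))) := by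
  have hconst : ∀ c, ∫⁻ _ in Set.Ioo a R, c = ENNReal.ofReal (R - a) * c := fun c => by
    rw [setLIntegral_const, Real.volume_Ioo, mul_comm]
  rw [← hconst, ← hconst, ← lintegral_add_right _ measurable_const]
  refine setLIntegral_mono' measurableSet_Ioo fun s hs => ?_
  refine le_trans ?_ (lintegral_hardy hα hp ha hg hg' ⟨hs.1, hs.2.trans hR⟩)
  have hsub : Set.Ico R 1 ⊆ Set.Ioo s 1 := fun r hr => ⟨hs.2.trans_le hr.1, hr.2⟩
  exact mul_le_mul_right (lintegral_mono_set hsub) _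

theorem lintegral_eq_lintegral_toSphere {E : Type*} [NormedAddCommGroup E] [NormedSpace ℝ E]
    [FiniteDimensional ℝ E] [Nontrivial E] [MeasurableSpace E] [BorelSpace E] (μ : Measure E)
    [μ.IsAddHaarMeasure] {F : E → ENNReal} (hF : Measurable F) :
    ∫⁻ x, F x ∂μ = ∫⁻ ζ, (∫⁻ r in Set.Ioi (0 : ℝ),
      ENNReal.ofReal (r ^ (Module.finrank ℝ E - 1)) * F (r • (ζ : E))) ∂μ.toSphere := by
  have hmeas : Measurable fun z : sphere (0 : E) 1 × Set.Ioi (0 : ℝ) => F (z.2.1 • z.1.1) :=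
    hF.comp (by fun_prop)
  have hpolar := μ.measurePreserving_homeomorphUnitSphereProd.lintegral_comp hmeas
  have hid : ∀ x : ({0}ᶜ : Set E), F ((homeomorphUnitSphereProd E x).2.1 •
      (homeomorphUnitSphereProd E x).1.1) = F x := fun x => by
    rw [← homeomorphUnitSphereProd_symm_apply_coe, Homeomorph.symm_apply_apply]
  simp only [hid] at hpolar
  rw [lintegral_subtype_comap (measurableSet_singleton _).compl, restrict_compl_singleton] at hpolar
  rw [hpolar, lintegral_prod _ hmeas.aemeasurable]
  refine lintegral_congr fun ζ => ?_
  rw [← lintegral_subtype_comap measurableSet_Ioi]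
  exact lintegral_withDensity_eq_lintegral_mul _ (by fun_prop) (hmeas.comp measurable_prodMk_left)

theorem ContinuousOn.measurable_indicator {X Y : Type*} [TopologicalSpace X] [MeasurableSpace X]
    [BorelSpace X] [TopologicalSpace Y] [Zero Y] [MeasurableSpace Y] [BorelSpace Y] {h : X → Y}
    {s : Set X} (hh : ContinuousOn h s) (hs : MeasurableSet s) : Measurable (s.indicator h) := by
  classical
  rw [← Set.piecewise_eq_indicator]
  exact hh.measurable_piecewise continuousOn_const hs

theorem setLIntegral_Ioo_le_weighted {a b : ℝ} (ha : 0 < a) (d : ℕ) {H F : ℝ → ENNReal}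
    (hHF : ∀ r ∈ Set.Ioo a b, H r ≤ F r) :
    ∫⁻ r in Set.Ioo a b, H r ≤
      ENNReal.ofReal (a ^ d)⁻¹ * ∫⁻ r in Set.Ioi (0 : ℝ), ENNReal.ofReal (r ^ d) * F r := by
  rw [← lintegral_const_mul' _ _ ENNReal.ofReal_ne_top]
  refine le_trans (setLIntegral_mono' measurableSet_Ioo fun r hr => ?_)
    (lintegral_mono_set fun r hr => ha.trans hr.1)
  have h1 : 1 ≤ ENNReal.ofReal (a ^ d)⁻¹ * ENNReal.ofReal (r ^ d) := by
    rw [← ENNReal.ofReal_mul (by positivity), ENNReal.one_le_ofReal,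
      inv_mul_eq_div, one_le_div (by positivity)]
    gcongr
    exact hr.1.le
  calc H r ≤ 1 * F r := by rw [one_mul]; exact hHF r hr
    _ ≤ _ := by rw [← mul_assoc]; gcongr

theorem weighted_lintegral_le_setLIntegral_Ico {R : ℝ} (d : ℕ) {G F : ℝ → ENNReal}
    (hF : ∀ r > 0, F r ≤ (Set.Ico R 1).indicator G r) :
    ∫⁻ r in Set.Ioi (0 : ℝ), ENNReal.ofReal (r ^ d) * F r ≤ ∫⁻ r in Set.Ico R 1, G r := by
  rw [← lintegral_indicator measurableSet_Ico]
  refine le_trans (setLIntegral_mono' measurableSet_Ioi fun r hr => ?_)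
    (setLIntegral_le_lintegral _ _)
  refine (mul_le_mul_right (hF r hr) _).trans ?_
  by_cases h : r ∈ Set.Ico R 1
  · rw [Set.indicator_of_mem h]
    refine mul_le_of_le_one_left' ?_
    rw [ENNReal.ofReal_le_one]
    exact pow_le_one₀ (le_of_lt hr) h.2.le
  · simp [h]

theorem lintegral_annulus_le {E : Type*} [NormedAddCommGroup E] [NormedSpace ℝ E]
    [FiniteDimensional ℝ E] [Nontrivial E] [MeasurableSpace E] [BorelSpace E] (μ : Measure E)
    [μ.IsAddHaarMeasure] {α p R : ℝ} (hα : -1 < α) (hp : 1 ≤ p) (hR0 : 0 < R) (hR1 : R < 1) :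
    ∃ C : ENNReal, C ≠ ⊤ ∧ ∀ f : E → ℝ, ContDiffOn ℝ 1 f (ball 0 1) →
      (∫⁻ x in ball (0 : E) 1 \ ball 0 R, ENNReal.ofReal (|f x| ^ p * (1 - ‖x‖ ^ 2) ^ α) ∂μ) ≤
        C * ((∫⁻ x in ball (0 : E) 1,
          ENNReal.ofReal (‖fderiv ℝ f x‖ ^ p * (1 - ‖x‖ ^ 2) ^ (α + p)) ∂μ) +
            ∫⁻ x in ball (0 : E) R, ENNReal.ofReal (|f x| ^ p) ∂μ) := by
  obtain ⟨a, ha, haR⟩ := exists_between hR0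
  have hp0 : 0 ≤ p := by linarith
  set d := Module.finrank ℝ E - 1
  set κ := ENNReal.ofReal (a ^ d)⁻¹
  set δ := ENNReal.ofReal (R - a)
  set c := ENNReal.ofReal (a * (α + 1))
  set K := ENNReal.ofReal (p * (p / (a * (α + 1))) ^ (p - 1))
  have hδ : δ * c ≠ 0 := mul_ne_zero (ENNReal.ofReal_pos.2 (by linarith)).ne'
    (ENNReal.ofReal_pos.2 (mul_pos ha (by linarith))).ne'
  have hδ' : δ * c ≠ ⊤ := ENNReal.mul_ne_top ENNReal.ofReal_ne_top ENNReal.ofReal_ne_top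
  have hC : κ + δ * (K * κ) ≠ ⊤ := by finiteness
  refine ⟨(δ * c)⁻¹ * (κ + δ * (K * κ)), ENNReal.mul_ne_top (ENNReal.inv_ne_top.2 hδ) hC,
    fun f hf => ?_⟩
  have hw : ∀ x ∈ ball (0 : E) 1, 0 < 1 - ‖x‖ ^ 2 := fun x hx => by
    rw [mem_ball_zero_iff] at hx
    nlinarith [norm_nonneg x]
  have hwcont : ∀ β : ℝ, ContinuousOn (fun x : E => (1 - ‖x‖ ^ 2) ^ β) (ball 0 1) := fun β =>
    ContinuousOn.rpow_const (by fun_prop) fun x hx => Or.inl (hw x hx).ne'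
  have hfp : ContinuousOn (fun x => |f x| ^ p) (ball 0 1) :=
    hf.continuousOn.abs.rpow_const fun _ _ => Or.inr hp0
  have hf' : ContinuousOn (fderiv ℝ f) (ball 0 1) :=
    hf.continuousOn_fderiv_of_isOpen isOpen_ball le_rfl
  set F₁ : E → ENNReal := (ball 0 1 \ ball 0 R).indicator
    fun x => ENNReal.ofReal (|f x| ^ p * (1 - ‖x‖ ^ 2) ^ α)
  set F₂ : E → ENNReal := (ball 0 1).indicator
    fun x => ENNReal.ofReal (‖fderiv ℝ f x‖ ^ p * (1 - ‖x‖ ^ 2) ^ (α + p))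
  set F₃ : E → ENNReal := (ball 0 R).indicator fun x => ENNReal.ofReal (|f x| ^ p)
  have hF₁ : Measurable F₁ :=
    (ENNReal.continuous_ofReal.comp_continuousOn
      ((hfp.mul (hwcont α)).mono Set.sdiff_subset)).measurable_indicator
      (measurableSet_ball.diff measurableSet_ball)
  have hF₂ : Measurable F₂ :=
    (ENNReal.continuous_ofReal.comp_continuousOn
      ((hf'.norm.rpow_const fun _ _ => Or.inr hp0).mul (hwcont _))).measurable_indicator
      measurableSet_ball
  have hF₃ : Measurable F₃ :=
    (ENNReal.continuous_ofReal.comp_continuousOn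
      (hfp.mono (ball_subset_ball hR1.le))).measurable_indicator measurableSet_ball
  rw [← lintegral_indicator (measurableSet_ball.diff measurableSet_ball),
    ← lintegral_indicator measurableSet_ball, ← lintegral_indicator measurableSet_ball]
  change ∫⁻ x, F₁ x ∂μ ≤ _ * (∫⁻ x, F₂ x ∂μ + ∫⁻ x, F₃ x ∂μ)
  rw [← lintegral_add_left hF₂, mul_assoc, ← ENNReal.mul_le_iff_le_inv hδ hδ',
    lintegral_eq_lintegral_toSphere μ hF₁, lintegral_eq_lintegral_toSphere μ (hF₂.fun_add hF₃),
    ← lintegral_const_mul' _ _ hδ', ← lintegral_const_mul' _ _ hC]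
  refine lintegral_mono fun ζ => ?_
  have hζ : ‖(ζ : E)‖ = 1 := norm_eq_of_mem_sphere ζ
  have hnorm : ∀ r : ℝ, 0 < r → ‖r • (ζ : E)‖ = r := fun r hr => by
    rw [norm_smul, hζ, mul_one, Real.norm_of_nonneg hr.le]
  have hmem : ∀ r ∈ Set.Ioo a 1, r • (ζ : E) ∈ ball (0 : E) 1 := fun r hr => by
    rw [mem_ball_zero_iff, hnorm r (ha.trans hr.1)]
    exact hr.2
  have hg : ∀ r ∈ Set.Ioo a 1,
      HasDerivAt (fun r : ℝ => f (r • (ζ : E))) (fderiv ℝ f (r • (ζ : E)) ζ) r := fun r hr => by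
    have h1 := ((hf.differentiableOn one_ne_zero).differentiableAt
      (isOpen_ball.mem_nhds (hmem r hr))).hasFDerivAt
    have h2 : HasDerivAt (fun r : ℝ => r • (ζ : E)) ((1 : ℝ) • (ζ : E)) r :=
      (hasDerivAt_id r).smul_const _
    rw [one_smul] at h2
    exact h1.comp_hasDerivAt r h2
  have hg' : ContinuousOn (fun r : ℝ => fderiv ℝ f (r • (ζ : E)) ζ) (Set.Ioo a 1) :=
    (hf'.comp (by fun_prop) hmem).clm_apply continuousOn_const
  have hradial := lintegral_hardy_average hα hp ha hR1 hg hg'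
  have hF₁ζ : ∫⁻ r in Set.Ioi (0 : ℝ), ENNReal.ofReal (r ^ d) * F₁ (r • (ζ : E)) ≤
      ∫⁻ r in Set.Ico R 1, ENNReal.ofReal (|f (r • (ζ : E))| ^ p * (1 - r ^ 2) ^ α) := by
    classical
    refine weighted_lintegral_le_setLIntegral_Ico d fun r hr => le_of_eq ?_
    simp only [F₁, Set.indicator_apply, Set.mem_sdiff, mem_ball_zero_iff, hnorm r hr, Set.mem_Ico,
      not_lt, and_comm]
  have hF₂ζ := setLIntegral_Ioo_le_weighted (b := 1) ha d
    (H := fun r => ENNReal.ofReal (|fderiv ℝ f (r • (ζ : E)) ζ| ^ p * (1 - r ^ 2) ^ (α + p)))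
    (F := fun r => F₂ (r • (ζ : E)) + F₃ (r • (ζ : E))) fun r hr => by
      refine le_trans ?_ (le_self_add (a := F₂ (r • (ζ : E))))
      have hwr := hw _ (hmem r hr)
      simp only [F₂, Set.indicator_of_mem (hmem r hr)]
      rw [hnorm r (ha.trans hr.1)] at hwr ⊢
      gcongr
      simpa [hζ] using (fderiv ℝ f (r • (ζ : E))).le_opNorm ζ
  have hF₃ζ := setLIntegral_Ioo_le_weighted (b := R) ha d
    (H := fun r => ENNReal.ofReal (|f (r • (ζ : E))| ^ p))
    (F := fun r => F₂ (r • (ζ : E)) + F₃ (r • (ζ : E))) fun r hr => by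
      refine le_trans (le_of_eq ?_) (le_add_self (a := F₃ (r • (ζ : E))))
      have : r • (ζ : E) ∈ ball (0 : E) R := by
        rw [mem_ball_zero_iff, hnorm r (ha.trans hr.1)]
        exact hr.2
      simp only [F₃, Set.indicator_of_mem this]
  rw [mul_assoc]
  calc _ ≤ _ := by gcongr
    _ ≤ _ := hradial
    _ ≤ _ := add_le_add hF₃ζ (mul_le_mul_right (mul_le_mul_right hF₂ζ _) _)
    _ = _ := by ring

theorem lintegral_ball_weight_le {E : Type*} [NormedAddCommGroup E] [MeasurableSpace E]
    [BorelSpace E] (μ : Measure E) {α p R : ℝ} (hR1 : R < 1) (f : E → ℝ) :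
    ∫⁻ x in ball (0 : E) R, ENNReal.ofReal (|f x| ^ p * (1 - ‖x‖ ^ 2) ^ α) ∂μ ≤
      ENNReal.ofReal (1 + (1 - R ^ 2) ^ α) *
        ∫⁻ x in ball (0 : E) R, ENNReal.ofReal (|f x| ^ p) ∂μ := by
  rw [← lintegral_const_mul' _ _ ENNReal.ofReal_ne_top]
  refine setLIntegral_mono' measurableSet_ball fun x hx => ?_
  rw [mem_ball_zero_iff] at hx
  have hx0 := norm_nonneg x
  have hR : 0 < 1 - R ^ 2 := by nlinarith
  have hle : 1 - R ^ 2 ≤ 1 - ‖x‖ ^ 2 := by nlinarith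
  have hRα : 0 ≤ (1 - R ^ 2) ^ α := Real.rpow_nonneg hR.le _
  rw [← ENNReal.ofReal_mul (by positivity), mul_comm]
  gcongr
  rcases le_or_gt 0 α with h | h
  · exact (Real.rpow_le_one (by linarith) (by nlinarith) h).trans (by linarith)
  · exact (Real.rpow_le_rpow_of_nonpos hR hle h.le).trans (by linarith)

theorem stmt_6 {n : ℕ} (hn : 2 ≤ n) (α p R : ℝ) (hα : -1 < α) (hp : 1 ≤ p)
    (hR0 : 0 < R) (hR1 : R < 1) :
    ∃ C > 0, ∀ f : EuclideanSpace ℝ (Fin n) → ℝ,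
      ContDiffOn ℝ 1 f (ball 0 1) →
      (∫⁻ x in ball (0 : EuclideanSpace ℝ (Fin n)) 1,
          ENNReal.ofReal (|f x| ^ p * (1 - ‖x‖ ^ 2) ^ α))
        ≤ ENNReal.ofReal C *
          ((∫⁻ x in ball (0 : EuclideanSpace ℝ (Fin n)) 1,
              ENNReal.ofReal (‖fderiv ℝ f x‖ ^ p * (1 - ‖x‖ ^ 2) ^ (α + p)))
           + ∫⁻ x in ball (0 : EuclideanSpace ℝ (Fin n)) R,
              ENNReal.ofReal (|f x| ^ p)) := by
  have : Nonempty (Fin n) := ⟨⟨0, by omega⟩⟩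
  obtain ⟨C, hC, h⟩ := lintegral_annulus_le (E := EuclideanSpace ℝ (Fin n)) volume hα hp hR0 hR1
  have hM : 0 < 1 + (1 - R ^ 2) ^ α := by
    have : 0 < 1 - R ^ 2 := by nlinarith
    positivity
  refine ⟨1 + (1 - R ^ 2) ^ α + C.toReal, by positivity, fun f hf => ?_⟩
  rw [← lintegral_inter_add_sdiff _ _ (measurableSet_ball (x := 0) (ε := R)),
    Set.inter_eq_right.2 (ball_subset_ball hR1.le), ENNReal.ofReal_add hM.le ENNReal.toReal_nonneg,
    ENNReal.ofReal_toReal hC, add_mul]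
  exact add_le_add ((lintegral_ball_weight_le _ hR1 f).trans (mul_le_mul_right le_add_self _))
    (h f hf)
end

section
/- Weighted Poincaré-type inequality: let α > -1, 1 ≤ p < ∞, 0 < R < 1. There is a constant C = C(n,α,p,R) such that for every f ∈ C¹(𝔹) whose average over the ball B_R is zero, ∫_𝔹 |f(x)|^p (1-|x|²)^α dν(x) ≤ C ∫_𝔹 |∇f(x)|^p (1-|x|²)^{α+p} dν(x). -/
open MeasureTheory Metric

open Set Module
open scoped ENNReal

theorem lintegral_rpow_le_measure_univ_rpow_mul {X : Type*} [MeasurableSpace X] {μ : Measure X}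
    {p : ℝ} (hp : 1 ≤ p) {k : X → ℝ≥0∞} (hk : AEMeasurable k μ) :
    (∫⁻ x, k x ∂μ) ^ p ≤ μ univ ^ (p - 1) * ∫⁻ x, k x ^ p ∂μ := by
  have hp0 : 0 < p := by linarith
  have h := eLpNorm'_le_eLpNorm'_mul_rpow_measure_univ (μ := μ) (f := k) one_pos hp
    hk.aestronglyMeasurable
  simp only [eLpNorm', enorm_eq_self, ENNReal.rpow_one, div_one] at h
  calc (∫⁻ x, k x ∂μ) ^ p
      ≤ ((∫⁻ x, k x ^ p ∂μ) ^ (1 / p) * μ univ ^ (1 - 1 / p)) ^ p := by gcongr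
    _ = μ univ ^ (p - 1) * ∫⁻ x, k x ^ p ∂μ := by
      rw [ENNReal.mul_rpow_of_nonneg _ _ hp0.le, ← ENNReal.rpow_mul, ← ENNReal.rpow_mul,
        one_div_mul_cancel hp0.ne', ENNReal.rpow_one, mul_comm]
      congr 2
      field_simp

theorem lintegral_mul_rpow_le_weighted {X : Type*} [MeasurableSpace X] {μ : Measure X}
    {p : ℝ} (hp : 1 ≤ p) {k w : X → ℝ≥0∞} (hk : Measurable k) (hw : Measurable w) :
    (∫⁻ x, w x * k x ∂μ) ^ p ≤ (∫⁻ x, w x ∂μ) ^ (p - 1) * ∫⁻ x, w x * k x ^ p ∂μ := by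
  have h := lintegral_rpow_le_measure_univ_rpow_mul (μ := μ.withDensity w) hp hk.aemeasurable
  rwa [lintegral_withDensity_eq_lintegral_mul _ hw hk,
    lintegral_withDensity_eq_lintegral_mul _ hw (hk.pow_const p), withDensity_apply _ .univ,
    setLIntegral_univ] at h

theorem lintegral_rpow_Ioc_zero {β c : ℝ} (hβ : -1 < β) (hc : 0 ≤ c) :
    ∫⁻ s in Ioc 0 c, ENNReal.ofReal (s ^ β) = ENNReal.ofReal (c ^ (β + 1) / (β + 1)) := by
  have hi := intervalIntegral.intervalIntegrable_rpow' (a := 0) (b := c) hβ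
  rw [intervalIntegrable_iff_integrableOn_Ioc_of_le hc] at hi
  rw [← ofReal_integral_eq_lintegral_ofReal hi, ← intervalIntegral.integral_of_le hc,
    integral_rpow (Or.inl hβ), Real.zero_rpow (by linarith), sub_zero]
  filter_upwards [self_mem_ae_restrict measurableSet_Ioc] with s hs
  exact Real.rpow_nonneg hs.1.le _

theorem lintegral_sub_rpow_Ioc {β a b : ℝ} (hβ : -1 < β) (hab : a ≤ b) :
    ∫⁻ u in Ioc a b, ENNReal.ofReal ((u - a) ^ β)
      = ENNReal.ofReal ((b - a) ^ (β + 1) / (β + 1)) := by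
  rw [← lintegral_rpow_Ioc_zero hβ (sub_nonneg.2 hab), ← lintegral_indicator measurableSet_Ioc,
    ← lintegral_indicator measurableSet_Ioc,
    ← lintegral_sub_right_eq_self ((Ioc 0 (b - a)).indicator _) a]
  refine lintegral_congr fun u => ?_
  simp only [indicator, mem_Ioc, sub_pos, sub_le_sub_iff_right]

theorem lintegral_rpow_neg_Iic {γ d : ℝ} (hγ : 1 < γ) (hd : 0 < d) :
    ∫⁻ v in Iic 1, ENNReal.ofReal ((1 + d - v) ^ (-γ))
      = ENNReal.ofReal (d ^ (1 - γ) / (γ - 1)) := by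
  have hval := integral_Ioi_rpow_of_lt (a := -γ) (by linarith) hd
  rw [show d ^ (1 - γ) / (γ - 1) = ∫ t in Ioi d, t ^ (-γ) by
      rw [hval, neg_div, ← div_neg]; congr 2 <;> ring,
    ofReal_integral_eq_lintegral_ofReal (integrableOn_Ioi_rpow_of_lt (by linarith) hd)]
  · rw [setLIntegral_congr Ioi_ae_eq_Ici, ← lintegral_indicator measurableSet_Ici,
      ← lintegral_indicator measurableSet_Iic,
      ← lintegral_sub_left_eq_self ((Ici d).indicator _) (1 + d)]
    refine lintegral_congr fun u => ?_
    have : u ≤ 1 ↔ d ≤ 1 + d - u := by constructor <;> intro <;> linarith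
    simp only [indicator, mem_Iic, mem_Ici, this]
  · filter_upwards [self_mem_ae_restrict measurableSet_Ioi] with s hs
    exact Real.rpow_nonneg (hd.trans hs).le _

theorem enorm_sub_le_lintegral_fderiv_line {E : Type*} [NormedAddCommGroup E]
    [NormedSpace ℝ E] {f : E → ℝ} {U : Set E} (hU : IsOpen U)
    (hf : ContDiffOn ℝ 1 f U) {a b : ℝ} (hab : a ≤ b) {y w : E}
    (hmem : ∀ t ∈ Icc a b, y + t • w ∈ U) :
    ‖f (y + b • w) - f (y + a • w)‖ₑ
      ≤ ‖w‖ₑ * ∫⁻ t in Icc a b, ‖fderiv ℝ f (y + t • w)‖ₑ := by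
  have hline : ContDiff ℝ 1 fun t : ℝ => y + t • w := by fun_prop
  refine (enorm_sub_le_lintegral_deriv_of_contDiffOn_Icc
    (f := fun t : ℝ => f (y + t • w)) (hf.comp hline.contDiffOn hmem) hab).trans ?_
  rw [← lintegral_const_mul' _ _ (by finiteness)]
  refine setLIntegral_mono' measurableSet_Icc fun t ht => ?_
  have hd : HasFDerivAt f (fderiv ℝ f (y + t • w)) (y + t • w) :=
    ((hf.contDiffAt (hU.mem_nhds (hmem t ht))).differentiableAt (by norm_num)).hasFDerivAt
  have hl : HasDerivAt (fun t : ℝ => y + t • w) w t := by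
    simpa using ((hasDerivAt_id t).smul_const w).const_add y
  rw [show deriv (fun t : ℝ => f (y + t • w)) t = fderiv ℝ f (y + t • w) w from
    (hd.comp_hasDerivAt t hl).deriv, mul_comm]
  exact ContinuousLinearMap.le_opENorm _ _

section Haar

variable {E : Type*} [NormedAddCommGroup E] [NormedSpace ℝ E] [FiniteDimensional ℝ E]
  [MeasurableSpace E] [BorelSpace E] (μ : Measure E) [μ.IsAddHaarMeasure]

theorem lintegral_comp_smul_addHaar {r : ℝ} (hr : r ≠ 0) {g : E → ℝ≥0∞} (hg : Measurable g) :
    ∫⁻ x, g (r • x) ∂μ = ENNReal.ofReal |(r ^ finrank ℝ E)⁻¹| * ∫⁻ x, g x ∂μ := by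
  rw [← lintegral_map hg (measurable_const_smul r), Measure.map_addHaar_smul μ hr,
    lintegral_smul_measure, smul_eq_mul]

theorem lintegral_comp_smul_addHaar_le {r u : ℝ} (hr : 0 < r) (hu : r ≤ u) {g : E → ℝ≥0∞}
    (hg : Measurable g) :
    ∫⁻ x, g (u • x) ∂μ ≤ ENNReal.ofReal (r ^ finrank ℝ E)⁻¹ * ∫⁻ x, g x ∂μ := by
  have hu0 : 0 < u := hr.trans_le hu
  rw [lintegral_comp_smul_addHaar μ hu0.ne' hg, abs_of_pos (by positivity)]
  gcongr

theorem lintegral_segment_le {B : Set E} {h : E → ℝ≥0∞} (hh : Measurable h) :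
    ∫⁻ x in B, ∫⁻ y in B, (∫⁻ t in Icc (0 : ℝ) 1, h (x + t • (y - x))) ∂μ ∂μ
      ≤ ENNReal.ofReal ((1 / 2) ^ finrank ℝ E)⁻¹ * μ B * ∫⁻ z, h z ∂μ := by
  have key : ∀ s : ℝ, 1 / 2 ≤ s → ∀ c : E, ∫⁻ x in B, h (s • x + c) ∂μ
      ≤ ENNReal.ofReal ((1 / 2) ^ finrank ℝ E)⁻¹ * ∫⁻ z, h z ∂μ := fun s hs c => by
    refine (setLIntegral_le_lintegral _ _).trans ?_
    refine (lintegral_comp_smul_addHaar_le μ (by norm_num) hs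
      (g := fun x => h (x + c)) (by fun_prop)).trans_eq ?_
    rw [lintegral_add_right_eq_self]
  have hswap : ∫⁻ x in B, ∫⁻ y in B, (∫⁻ t in Icc (0 : ℝ) 1, h (x + t • (y - x))) ∂μ ∂μ
      = ∫⁻ t in Icc (0 : ℝ) 1, ∫⁻ x in B, ∫⁻ y in B, h (x + t • (y - x)) ∂μ ∂μ := by
    rw [lintegral_lintegral_swap (μ := volume.restrict (Icc (0 : ℝ) 1))]
    · refine lintegral_congr fun x => ?_
      rw [lintegral_lintegral_swap]
      exact Measurable.aemeasurable (by fun_prop)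
    · refine Measurable.aemeasurable ?_
      refine Measurable.lintegral_prod_right' (ν := μ.restrict B)
        (f := fun q : (ℝ × E) × E => h (q.1.2 + q.1.1 • (q.2 - q.1.2))) ?_
      fun_prop
  rw [hswap]
  have hle : ∀ t ∈ Icc (0 : ℝ) 1, ∫⁻ x in B, ∫⁻ y in B, h (x + t • (y - x)) ∂μ ∂μ
      ≤ ENNReal.ofReal ((1 / 2) ^ finrank ℝ E)⁻¹ * μ B * ∫⁻ z, h z ∂μ := fun t _ => by
    rcases le_total (1 / 2) t with ht | ht
    · calc ∫⁻ x in B, ∫⁻ y in B, h (x + t • (y - x)) ∂μ ∂μ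
          = ∫⁻ x in B, ∫⁻ y in B, h (t • y + (x - t • x)) ∂μ ∂μ := by
            congr! 5; module
        _ ≤ ∫⁻ x in B, ENNReal.ofReal ((1 / 2) ^ finrank ℝ E)⁻¹ * ∫⁻ z, h z ∂μ ∂μ :=
            lintegral_mono fun x => key t ht _
        _ = _ := by rw [setLIntegral_const]; ring
    · rw [lintegral_lintegral_swap (Measurable.aemeasurable (by fun_prop))]
      calc ∫⁻ y in B, ∫⁻ x in B, h (x + t • (y - x)) ∂μ ∂μ
          = ∫⁻ y in B, ∫⁻ x in B, h ((1 - t) • x + t • y) ∂μ ∂μ := by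
            congr! 5; module
        _ ≤ ∫⁻ y in B, ENNReal.ofReal ((1 / 2) ^ finrank ℝ E)⁻¹ * ∫⁻ z, h z ∂μ ∂μ :=
            lintegral_mono fun y => key (1 - t) (by linarith) _
        _ = _ := by rw [setLIntegral_const]; ring
  refine (setLIntegral_mono measurable_const hle).trans_eq ?_
  simp

theorem lintegral_dilation_average_le {β r : ℝ} (hβ : -1 < β) (hr : 0 < r) :
    ∃ C : ℝ≥0∞, C ≠ ∞ ∧ ∀ g : E → ℝ≥0∞, Measurable g →
      ∫⁻ x in ball 0 1, ENNReal.ofReal ((1 - ‖x‖) ^ β) * (∫⁻ u in Ioc r 1, g (u • x)) ∂μ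
        ≤ C * ∫⁻ z in ball 0 1, g z * ENNReal.ofReal ((1 - ‖z‖) ^ (β + 1)) ∂μ := by
  refine ⟨ENNReal.ofReal (r ^ finrank ℝ E)⁻¹ *
    (ENNReal.ofReal (r ^ (-|β|)) * ENNReal.ofReal (β + 1)⁻¹),
    ENNReal.mul_ne_top ENNReal.ofReal_ne_top
      (ENNReal.mul_ne_top ENNReal.ofReal_ne_top ENNReal.ofReal_ne_top), fun g hg => ?_⟩
  set φ : E → ℝ≥0∞ := (ball 0 1).indicator fun x => ENNReal.ofReal ((1 - ‖x‖) ^ β) with hφ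
  have hφm : Measurable φ := Measurable.indicator (by fun_prop) measurableSet_ball
  have hφle : ∀ z : E, ∫⁻ u in Ioc r 1, φ (u⁻¹ • z) ≤ (ball 0 1).indicator (fun z : E =>
      ENNReal.ofReal (r ^ (-|β|)) * ENNReal.ofReal (β + 1)⁻¹ *
        ENNReal.ofReal ((1 - ‖z‖) ^ (β + 1))) z := fun z => by
    have hpt : ∀ u ∈ Ioc r 1, φ (u⁻¹ • z) ≤ (Ioc ‖z‖ 1).indicator (fun u =>
        ENNReal.ofReal (r ^ (-|β|)) * ENNReal.ofReal ((u - ‖z‖) ^ β)) u := fun u hu => by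
      have hu0 : 0 < u := hr.trans hu.1
      have hn : ‖u⁻¹ • z‖ = ‖z‖ / u := by
        rw [norm_smul, norm_inv, Real.norm_of_nonneg hu0.le, inv_mul_eq_div]
      refine indicator_apply_le' (fun hm => ?_) (fun _ => zero_le)
      rw [mem_ball_zero_iff, hn, div_lt_one hu0] at hm
      rw [indicator_of_mem (show u ∈ Ioc ‖z‖ 1 from ⟨hm, hu.2⟩), hn,
        ← ENNReal.ofReal_mul (by positivity)]
      refine ENNReal.ofReal_le_ofReal ?_
      have hub : u ^ (-β) ≤ r ^ (-|β|) := by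
        rcases le_total 0 β with h | h
        · rw [abs_of_nonneg h]
          exact Real.rpow_le_rpow_of_nonpos hr hu.1.le (by linarith)
        · rw [abs_of_nonpos h, neg_neg]
          exact (Real.rpow_le_one hu0.le hu.2 (by linarith)).trans
            (Real.one_le_rpow_of_pos_of_le_one_of_nonpos hr (hu.1.le.trans hu.2) h)
      have : 1 - ‖z‖ / u = (u - ‖z‖) * u⁻¹ := by field_simp
      rw [this, Real.mul_rpow (by linarith) (by positivity), Real.inv_rpow hu0.le,
        ← Real.rpow_neg hu0.le, mul_comm]
      have : 0 ≤ u - ‖z‖ := by linarith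
      gcongr
    refine (setLIntegral_mono (Measurable.indicator (by fun_prop) measurableSet_Ioc) hpt).trans ?_
    refine (setLIntegral_le_lintegral _ _).trans ?_
    rw [lintegral_indicator measurableSet_Ioc]
    by_cases hz : ‖z‖ < 1
    · rw [indicator_of_mem (by simpa using hz), lintegral_const_mul _ (by fun_prop),
        lintegral_sub_rpow_Ioc hβ hz.le, mul_assoc, ← ENNReal.ofReal_mul
          (inv_nonneg.2 (by linarith)), inv_mul_eq_div]
    · simp [Ioc_eq_empty hz]
  calc ∫⁻ x in ball 0 1, ENNReal.ofReal ((1 - ‖x‖) ^ β) * (∫⁻ u in Ioc r 1, g (u • x)) ∂μ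
      = ∫⁻ x, (∫⁻ u in Ioc r 1, φ x * g (u • x)) ∂μ := by
        rw [← lintegral_indicator measurableSet_ball]
        refine lintegral_congr fun x => ?_
        rw [lintegral_const_mul _ (by fun_prop), hφ, indicator_mul_left]
    _ = ∫⁻ u in Ioc r 1, ∫⁻ x, φ x * g (u • x) ∂μ :=
        lintegral_lintegral_swap (Measurable.aemeasurable (by fun_prop))
    _ ≤ ∫⁻ u in Ioc r 1, ENNReal.ofReal (r ^ finrank ℝ E)⁻¹ *
          ∫⁻ z, φ (u⁻¹ • z) * g z ∂μ := by
        refine setLIntegral_mono' measurableSet_Ioc fun u hu => ?_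
        have hu0 : u ≠ 0 := (hr.trans hu.1).ne'
        refine le_trans (le_of_eq ?_) (lintegral_comp_smul_addHaar_le μ hr hu.1.le
          (g := fun z => φ (u⁻¹ • z) * g z) (by fun_prop))
        simp only [inv_smul_smul₀ hu0]
    _ = ENNReal.ofReal (r ^ finrank ℝ E)⁻¹ *
          ∫⁻ z, (∫⁻ u in Ioc r 1, φ (u⁻¹ • z) * g z) ∂μ := by
        rw [lintegral_const_mul' _ _ ENNReal.ofReal_ne_top, lintegral_lintegral_swap]
        exact Measurable.aemeasurable (by fun_prop)
    _ ≤ ENNReal.ofReal (r ^ finrank ℝ E)⁻¹ * ∫⁻ z in ball 0 1,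
          ENNReal.ofReal (r ^ (-|β|)) * ENNReal.ofReal (β + 1)⁻¹ *
            (g z * ENNReal.ofReal ((1 - ‖z‖) ^ (β + 1))) ∂μ := by
        refine mul_le_mul_right ?_ _
        rw [← lintegral_indicator measurableSet_ball]
        refine lintegral_mono fun z => ?_
        simp only
        rw [lintegral_mul_const _ (by fun_prop)]
        refine (mul_le_mul_left (hφle z) _).trans_eq ?_
        by_cases hz : z ∈ ball (0 : E) 1
        · simp only [indicator_of_mem hz]; ring
        · simp only [indicator_of_notMem hz, zero_mul]
    _ = _ := by
        rw [lintegral_const_mul' _ _ (ENNReal.mul_ne_top ENNReal.ofReal_ne_top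
          ENNReal.ofReal_ne_top), ← mul_assoc]

omit [FiniteDimensional ℝ E] in
theorem lintegral_ray_rpow_le {γ p r : ℝ} (hγ : 1 < γ) (hp : 1 ≤ p) (hr : 0 ≤ r)
    {k : E → ℝ≥0∞} (hk : Measurable k) {x : E} (hx : ‖x‖ < 1) :
    (∫⁻ v in Ioc r 1, k (v • x)) ^ p
      ≤ ENNReal.ofReal ((γ - 1)⁻¹ ^ (p - 1) * 2 ^ (γ * (p - 1))) *
        (ENNReal.ofReal ((1 - ‖x‖) ^ (-((γ - 1) * (p - 1)))) *
          ∫⁻ v in Ioc r 1, k (v • x) ^ p * ENNReal.ofReal ((1 - ‖v • x‖) ^ (γ * (p - 1)))) := by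
  have hd : 0 < 1 - ‖x‖ := by linarith
  set d := 1 - ‖x‖ with hd'
  have hbase : ∀ v ∈ Ioc r 1, 0 < 1 + d - v := fun v hv => by linarith [hv.2]
  have hw : Measurable fun v : ℝ => ENNReal.ofReal ((1 + d - v) ^ (-γ)) := by fun_prop
  have hm : Measurable fun v : ℝ => k (v • x) := by fun_prop
  have hw' : Measurable fun v : ℝ => ENNReal.ofReal ((1 + d - v) ^ γ) := by fun_prop
  have h := lintegral_mul_rpow_le_weighted (μ := volume.restrict (Ioc r 1)) hp
    (hw'.mul hm) hw
  have hL : ∫⁻ v in Ioc r 1, ENNReal.ofReal ((1 + d - v) ^ (-γ)) *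
      (ENNReal.ofReal ((1 + d - v) ^ γ) * k (v • x)) = ∫⁻ v in Ioc r 1, k (v • x) := by
    refine setLIntegral_congr_fun measurableSet_Ioc fun v hv => ?_
    have hb := hbase v hv
    rw [← mul_assoc, ← ENNReal.ofReal_mul (by positivity), ← Real.rpow_add hb, neg_add_cancel,
      Real.rpow_zero, ENNReal.ofReal_one, one_mul]
  have hW : ∫⁻ v in Ioc r 1, ENNReal.ofReal ((1 + d - v) ^ (-γ))
      ≤ ENNReal.ofReal (d ^ (1 - γ) / (γ - 1)) :=
    (lintegral_mono_set fun v hv => hv.2).trans_eq (lintegral_rpow_neg_Iic hγ hd)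
  have hR : ∫⁻ v in Ioc r 1, ENNReal.ofReal ((1 + d - v) ^ (-γ)) *
      (ENNReal.ofReal ((1 + d - v) ^ γ) * k (v • x)) ^ p
      ≤ ENNReal.ofReal (2 ^ (γ * (p - 1))) * ∫⁻ v in Ioc r 1,
        k (v • x) ^ p * ENNReal.ofReal ((1 - ‖v • x‖) ^ (γ * (p - 1))) := by
    rw [← lintegral_const_mul' _ _ ENNReal.ofReal_ne_top]
    refine setLIntegral_mono' measurableSet_Ioc fun v hv => ?_
    have hb := hbase v hv
    have hv0 : 0 ≤ v := hr.trans hv.1.le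
    have hn : ‖v • x‖ = v * ‖x‖ := by rw [norm_smul, Real.norm_of_nonneg hv0]
    have h1 : v * ‖x‖ ≤ v := mul_le_of_le_one_right hv0 hx.le
    have h2 : v * ‖x‖ ≤ ‖x‖ := mul_le_of_le_one_left (norm_nonneg x) hv.2
    rw [ENNReal.mul_rpow_of_nonneg _ _ (by linarith), ENNReal.ofReal_rpow_of_nonneg (by positivity)
      (by linarith), ← Real.rpow_mul hb.le, ← mul_assoc, ← ENNReal.ofReal_mul (by positivity),
      ← Real.rpow_add hb, mul_comm, mul_left_comm, ← ENNReal.ofReal_mul (by positivity),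
      ← Real.mul_rpow (by norm_num) (by linarith [hv.2]), show -γ + γ * p = γ * (p - 1) by ring, hn]
    gcongr
    linarith
  calc (∫⁻ v in Ioc r 1, k (v • x)) ^ p
      ≤ ENNReal.ofReal (d ^ (1 - γ) / (γ - 1)) ^ (p - 1) *
        (ENNReal.ofReal (2 ^ (γ * (p - 1))) * ∫⁻ v in Ioc r 1,
          k (v • x) ^ p * ENNReal.ofReal ((1 - ‖v • x‖) ^ (γ * (p - 1)))) := by
        rw [← hL]
        refine h.trans (mul_le_mul' (ENNReal.rpow_le_rpow hW (by linarith)) hR)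
    _ = _ := by
        have hγ' : 0 < γ - 1 := by linarith
        rw [ENNReal.ofReal_rpow_of_nonneg (by positivity) (by linarith), div_eq_inv_mul,
          Real.mul_rpow (by positivity) (by positivity), ← Real.rpow_mul hd.le,
          ENNReal.ofReal_mul (by positivity), ENNReal.ofReal_mul (by positivity),
          show (1 - γ) * (p - 1) = -((γ - 1) * (p - 1)) by ring]
        ring

theorem lintegral_ball_rpow_le_inner_add_fderiv {α p R : ℝ} (hα : -1 < α) (hp : 1 ≤ p)
    (hR0 : 0 < R) (hR1 : R ≤ 1) :
    ∃ C : ℝ≥0∞, C ≠ ∞ ∧ ∀ f : E → ℝ, ContDiffOn ℝ 1 f (ball 0 1) →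
      ∫⁻ x in ball 0 1, ‖f x‖ₑ ^ p * ENNReal.ofReal ((1 - ‖x‖) ^ α) ∂μ
        ≤ C * (∫⁻ x in ball 0 R, ‖f x‖ₑ ^ p ∂μ +
          ∫⁻ x in ball 0 1, ‖fderiv ℝ f x‖ₑ ^ p * ENNReal.ofReal ((1 - ‖x‖) ^ (α + p)) ∂μ) := by
  obtain ⟨γ, β, hγ, hβ, hβγ⟩ : ∃ γ β : ℝ, 1 < γ ∧ -1 < β ∧ β = α - (γ - 1) * (p - 1) := by
    refine ⟨1 + (α + 1) / (2 * p), _, ?_, ?_, rfl⟩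
    · have : 0 < (α + 1) / (2 * p) := div_pos (by linarith) (by linarith)
      linarith
    · have h1 : (1 + (α + 1) / (2 * p) - 1) * (p - 1) = (α + 1) / 2 * ((p - 1) / p) := by
        field_simp; ring
      have h2 : (p - 1) / p ≤ 1 := (div_le_one (by linarith)).2 (by linarith)
      rw [h1]
      nlinarith
  have hr : 0 < R / 2 := by linarith
  obtain ⟨C₁, hC₁, H₁⟩ := lintegral_dilation_average_le μ hα hr
  obtain ⟨C₂, hC₂, H₂⟩ := lintegral_dilation_average_le μ hβ hr
  set c : ℝ := (γ - 1)⁻¹ ^ (p - 1) * 2 ^ (γ * (p - 1))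
  set a : ℝ≥0∞ := 2 ^ (p - 1)
  have ha : a ≠ ∞ := by finiteness
  set b : ℝ≥0∞ := ENNReal.ofReal (R / 2)
  have hb0 : b ≠ 0 := (ENNReal.ofReal_pos.2 hr).ne'
  have hb : b ≠ ∞ := ENNReal.ofReal_ne_top
  refine ⟨a * b⁻¹ * C₁ + a * ENNReal.ofReal c * C₂, by finiteness, fun f hf => ?_⟩
  have hDm : Measurable fun x => ‖fderiv ℝ f x‖ₑ := (measurable_fderiv ℝ f).enorm
  set g₁ : E → ℝ≥0∞ := (ball 0 R).indicator fun x => ‖f x‖ₑ ^ p with hg₁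
  have hg₁m : Measurable g₁ := by
    classical
    rw [hg₁, ← piecewise_eq_indicator]
    refine ContinuousOn.measurable_piecewise ?_ continuousOn_const measurableSet_ball
    exact (ENNReal.continuous_rpow_const.comp continuous_enorm).comp_continuousOn
      (hf.continuousOn.mono (ball_subset_ball hR1))
  set g₂ : E → ℝ≥0∞ := fun x =>
    ‖fderiv ℝ f x‖ₑ ^ p * ENNReal.ofReal ((1 - ‖x‖) ^ (γ * (p - 1))) with hg₂
  have hg₂m : Measurable g₂ := by fun_prop
  have hpt : ∀ x ∈ ball (0 : E) 1, ‖f x‖ₑ ^ p ≤ a * b⁻¹ * (∫⁻ u in Ioc (R / 2) 1, g₁ (u • x)) +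
      a * ENNReal.ofReal c * (ENNReal.ofReal ((1 - ‖x‖) ^ (-((γ - 1) * (p - 1)))) *
        ∫⁻ v in Ioc (R / 2) 1, g₂ (v • x)) := fun x hx => by
    rw [mem_ball_zero_iff] at hx
    have hA := lintegral_ray_rpow_le hγ hp hr.le hDm hx
    set A : ℝ≥0∞ := ∫⁻ v in Ioc (R / 2) 1, ‖fderiv ℝ f (v • x)‖ₑ with hAdef
    have hin : ∀ u ∈ Ioc (R / 2) R, ‖f x‖ₑ ^ p ≤ a * (g₁ (u • x) + A ^ p) := fun u hu => by
      have hu0 : 0 < u := hr.trans hu.1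
      have hux : u • x ∈ ball (0 : E) R := by
        rw [mem_ball_zero_iff, norm_smul, Real.norm_of_nonneg hu0.le]
        nlinarith [hu.2, norm_nonneg x]
      have hlin := enorm_sub_le_lintegral_fderiv_line isOpen_ball hf (hu.2.trans hR1)
        (y := 0) (w := x) fun t ht => by
          rw [mem_ball_zero_iff, zero_add, norm_smul, Real.norm_of_nonneg (hu0.le.trans ht.1)]
          nlinarith [ht.2, norm_nonneg x]
      simp only [zero_add, one_smul] at hlin
      have hle : ‖f x - f (u • x)‖ₑ ≤ A := by
        refine hlin.trans ?_
        have hx1 : ‖x‖ₑ ≤ 1 := by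
          rw [← ofReal_norm]; exact ENNReal.ofReal_le_one.2 hx.le
        refine (mul_le_of_le_one_left zero_le hx1).trans ?_
        exact lintegral_mono_set fun t ht => ⟨hu.1.trans_le ht.1, ht.2⟩
      rw [hg₁, indicator_of_mem hux]
      calc ‖f x‖ₑ ^ p = ‖f (u • x) + (f x - f (u • x))‖ₑ ^ p := by rw [add_sub_cancel]
        _ ≤ (‖f (u • x)‖ₑ + A) ^ p := by
          gcongr
          exact (enorm_add_le _ _).trans (by gcongr)
        _ ≤ a * (‖f (u • x)‖ₑ ^ p + A ^ p) := by
          exact (ENNReal.rpow_add_le_mul_rpow_add_rpow _ _ hp).trans_eq rfl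
    have hvol : volume (Ioc (R / 2) R) = b := by
      rw [Real.volume_Ioc]; congr 1; ring
    have havg : ‖f x‖ₑ ^ p * b ≤ a * ((∫⁻ u in Ioc (R / 2) 1, g₁ (u • x)) + A ^ p * b) := by
      calc ‖f x‖ₑ ^ p * b = ∫⁻ _ in Ioc (R / 2) R, ‖f x‖ₑ ^ p := by
            rw [setLIntegral_const, hvol]
        _ ≤ ∫⁻ u in Ioc (R / 2) R, a * (g₁ (u • x) + A ^ p) :=
            setLIntegral_mono' measurableSet_Ioc hin
        _ = a * ((∫⁻ u in Ioc (R / 2) R, g₁ (u • x)) + A ^ p * b) := by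
            rw [lintegral_const_mul' _ _ ha, lintegral_add_right _ measurable_const,
              setLIntegral_const, hvol]
        _ ≤ _ := by
            gcongr
    calc ‖f x‖ₑ ^ p = ‖f x‖ₑ ^ p * b * b⁻¹ := by
          rw [mul_assoc, ENNReal.mul_inv_cancel hb0 hb, mul_one]
      _ ≤ a * ((∫⁻ u in Ioc (R / 2) 1, g₁ (u • x)) + A ^ p * b) * b⁻¹ := by gcongr
      _ = a * b⁻¹ * (∫⁻ u in Ioc (R / 2) 1, g₁ (u • x)) + a * A ^ p * (b * b⁻¹) := by ring
      _ ≤ _ := by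
          rw [ENNReal.mul_inv_cancel hb0 hb, mul_one, mul_assoc a (ENNReal.ofReal c)]
          gcongr
  have hX : ∫⁻ z in ball 0 1, g₁ z * ENNReal.ofReal ((1 - ‖z‖) ^ (α + 1)) ∂μ
      ≤ ∫⁻ x in ball 0 R, ‖f x‖ₑ ^ p ∂μ := by
    rw [← lintegral_indicator measurableSet_ball (μ := μ) (fun x => ‖f x‖ₑ ^ p)]
    refine (setLIntegral_mono' measurableSet_ball fun z hz => ?_).trans
      (setLIntegral_le_lintegral (ball 0 1) _)
    rw [mem_ball_zero_iff] at hz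
    refine mul_le_of_le_one_right zero_le (ENNReal.ofReal_le_one.2 ?_)
    exact Real.rpow_le_one (by linarith) (by linarith [norm_nonneg z]) (by linarith)
  have hY : ∫⁻ z in ball 0 1, g₂ z * ENNReal.ofReal ((1 - ‖z‖) ^ (β + 1)) ∂μ
      = ∫⁻ x in ball 0 1, ‖fderiv ℝ f x‖ₑ ^ p * ENNReal.ofReal ((1 - ‖x‖) ^ (α + p)) ∂μ := by
    refine setLIntegral_congr_fun measurableSet_ball fun z hz => ?_
    have hz' : 0 < 1 - ‖z‖ := by simpa using hz
    simp only [hg₂]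
    rw [mul_assoc, ← ENNReal.ofReal_mul (by positivity), ← Real.rpow_add hz', hβγ]
    congr 3; ring
  calc ∫⁻ x in ball 0 1, ‖f x‖ₑ ^ p * ENNReal.ofReal ((1 - ‖x‖) ^ α) ∂μ
      ≤ ∫⁻ x in ball 0 1, (a * b⁻¹ * (ENNReal.ofReal ((1 - ‖x‖) ^ α) *
          ∫⁻ u in Ioc (R / 2) 1, g₁ (u • x)) +
        a * ENNReal.ofReal c * (ENNReal.ofReal ((1 - ‖x‖) ^ β) *
          ∫⁻ v in Ioc (R / 2) 1, g₂ (v • x))) ∂μ := by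
        refine setLIntegral_mono' measurableSet_ball fun x hx => ?_
        have hx' : 0 < 1 - ‖x‖ := by simpa using hx
        refine (mul_le_mul_left (hpt x hx) _).trans_eq ?_
        rw [hβγ, sub_eq_add_neg α, Real.rpow_add hx',
          ENNReal.ofReal_mul (p := (1 - ‖x‖) ^ α) (by positivity)]
        ring
    _ = a * b⁻¹ * (∫⁻ x in ball 0 1, ENNReal.ofReal ((1 - ‖x‖) ^ α) *
          (∫⁻ u in Ioc (R / 2) 1, g₁ (u • x)) ∂μ) +
        a * ENNReal.ofReal c * ∫⁻ x in ball 0 1, ENNReal.ofReal ((1 - ‖x‖) ^ β) *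
          (∫⁻ v in Ioc (R / 2) 1, g₂ (v • x)) ∂μ := by
        have hmeas : ∀ g : E → ℝ≥0∞, Measurable g →
            Measurable fun x : E => ∫⁻ u in Ioc (R / 2) 1, g (u • x) := fun g hg =>
          Measurable.lintegral_prod_right' (ν := volume.restrict (Ioc (R / 2) 1))
            (f := fun q : E × ℝ => g (q.2 • q.1)) (by fun_prop)
        have hm₁ := hmeas g₁ hg₁m
        rw [lintegral_add_left (by fun_prop), lintegral_const_mul' _ _ (by finiteness),
          lintegral_const_mul' _ _ (by finiteness)]
    _ ≤ a * b⁻¹ * (C₁ * ∫⁻ x in ball 0 R, ‖f x‖ₑ ^ p ∂μ) +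
        a * ENNReal.ofReal c * (C₂ * ∫⁻ x in ball 0 1,
          ‖fderiv ℝ f x‖ₑ ^ p * ENNReal.ofReal ((1 - ‖x‖) ^ (α + p)) ∂μ) := by
        gcongr
        · exact (H₁ g₁ hg₁m).trans (mul_le_mul_right hX _)
        · exact (H₂ g₂ hg₂m).trans_eq (by rw [hY])
    _ ≤ _ := by
        rw [add_mul, ← mul_assoc, ← mul_assoc]
        gcongr
        · exact le_self_add
        · exact le_add_self

theorem lintegral_ball_rpow_le_fderiv_of_setIntegral_eq_zero {p R : ℝ} (hp : 1 ≤ p)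
    (hR0 : 0 < R) (hR1 : R < 1) :
    ∃ C : ℝ≥0∞, C ≠ ∞ ∧ ∀ f : E → ℝ, ContDiffOn ℝ 1 f (ball 0 1) →
      ∫ x in ball 0 R, f x ∂μ = 0 →
      ∫⁻ x in ball 0 R, ‖f x‖ₑ ^ p ∂μ ≤ C * ∫⁻ x in ball 0 R, ‖fderiv ℝ f x‖ₑ ^ p ∂μ := by
  set B : Set E := ball 0 R with hB
  have hBm : MeasurableSet B := measurableSet_ball
  have hB0 : μ B ≠ 0 := (measure_ball_pos μ 0 hR0).ne'
  have hBt : μ B ≠ ∞ := measure_ball_lt_top.ne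
  have hp0 : 0 < p := by linarith
  set D : ℝ≥0∞ := ENNReal.ofReal (2 * R) ^ p
  have hD : D ≠ ∞ := ENNReal.rpow_ne_top_of_nonneg hp0.le ENNReal.ofReal_ne_top
  set N : ℝ≥0∞ := ENNReal.ofReal ((1 / 2) ^ finrank ℝ E)⁻¹ * μ B
  have hN : N ≠ ∞ := ENNReal.mul_ne_top ENNReal.ofReal_ne_top hBt
  refine ⟨(μ B)⁻¹ * D * N, ENNReal.mul_ne_top (ENNReal.mul_ne_top (by finiteness) hD) hN,
    fun f hf h0 => ?_⟩
  have hBsub : B ⊆ ball 0 1 := ball_subset_ball hR1.le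
  have hfc : ContinuousOn f B := hf.continuousOn.mono hBsub
  have hfi : IntegrableOn f B μ :=
    ((hf.continuousOn.mono (closedBall_subset_ball hR1)).integrableOn_compact
      (isCompact_closedBall 0 R)).mono_set ball_subset_closedBall
  set h : E → ℝ≥0∞ := B.indicator fun x => ‖fderiv ℝ f x‖ₑ ^ p with hh
  have hDm : Measurable fun x => ‖fderiv ℝ f x‖ₑ := (measurable_fderiv ℝ f).enorm
  have hhm : Measurable h := Measurable.indicator (by fun_prop) hBm
  have hseg : ∀ x ∈ B, ∀ y ∈ B, ‖f y - f x‖ₑ ^ p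
      ≤ D * ∫⁻ t in Icc (0 : ℝ) 1, h (x + t • (y - x)) := fun x hx y hy => by
    have hmem : ∀ t ∈ Icc (0 : ℝ) 1, x + t • (y - x) ∈ B := fun t ht =>
      (convex_ball 0 R).add_smul_sub_mem hx hy ht
    have hl := enorm_sub_le_lintegral_fderiv_line isOpen_ball hf zero_le_one
      (fun t ht => hBsub (hmem t ht))
    simp only [zero_smul, add_zero, one_smul, add_sub_cancel] at hl
    have hyx : ‖y - x‖ₑ ≤ ENNReal.ofReal (2 * R) := by
      rw [← ofReal_norm]
      refine ENNReal.ofReal_le_ofReal ((norm_sub_le _ _).trans ?_)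
      rw [hB, mem_ball_zero_iff] at hx hy
      linarith
    calc ‖f y - f x‖ₑ ^ p
        ≤ (ENNReal.ofReal (2 * R) * ∫⁻ t in Icc (0 : ℝ) 1, ‖fderiv ℝ f (x + t • (y - x))‖ₑ) ^ p := by
          gcongr
          exact hl.trans (by gcongr)
      _ ≤ D * ∫⁻ t in Icc (0 : ℝ) 1, ‖fderiv ℝ f (x + t • (y - x))‖ₑ ^ p := by
          rw [ENNReal.mul_rpow_of_nonneg _ _ hp0.le]
          gcongr
          refine (lintegral_rpow_le_measure_univ_rpow_mul hp
            (Measurable.aemeasurable (by fun_prop))).trans_eq ?_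
          simp
      _ = _ := by
          congr 1
          refine setLIntegral_congr_fun measurableSet_Icc fun t ht => ?_
          simp only [hh, indicator_of_mem (hmem t ht)]
  have hpt : ∀ x ∈ B, ‖f x‖ₑ ^ p ≤ (μ B)⁻¹ *
      ∫⁻ y in B, D * (∫⁻ t in Icc (0 : ℝ) 1, h (x + t • (y - x))) ∂μ := fun x hx => by
    have hmean : ‖f x‖ₑ * μ B ≤ ∫⁻ y in B, ‖f y - f x‖ₑ ∂μ := by
      refine le_trans (le_of_eq ?_) (enorm_integral_le_lintegral_enorm _)
      rw [integral_sub hfi (integrableOn_const hBt), h0, setIntegral_const, zero_sub, enorm_neg,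
        enorm_smul, mul_comm, Measure.real, Real.enorm_eq_ofReal ENNReal.toReal_nonneg,
        ENNReal.ofReal_toReal hBt]
    have hpow : ‖f x‖ₑ ^ p * μ B ^ p ≤ μ B ^ (p - 1) * ∫⁻ y in B, ‖f y - f x‖ₑ ^ p ∂μ := by
      rw [← ENNReal.mul_rpow_of_nonneg _ _ hp0.le]
      refine (ENNReal.rpow_le_rpow hmean hp0.le).trans ?_
      refine (lintegral_rpow_le_measure_univ_rpow_mul hp
        ((hfc.sub continuousOn_const).aemeasurable hBm).enorm).trans_eq ?_
      simp only [Measure.restrict_apply_univ, Pi.sub_apply]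
    rw [ENNReal.rpow_sub _ _ hB0 hBt, ENNReal.rpow_one, div_eq_mul_inv, mul_assoc,
      mul_comm (‖f x‖ₑ ^ p), ENNReal.mul_le_mul_iff_right
        (ENNReal.rpow_pos (pos_iff_ne_zero.2 hB0) hBt).ne'
        (ENNReal.rpow_ne_top_of_nonneg hp0.le hBt)] at hpow
    refine hpow.trans (mul_le_mul_right ?_ _)
    exact setLIntegral_mono' hBm fun y hy => hseg x hx y hy
  calc ∫⁻ x in B, ‖f x‖ₑ ^ p ∂μ
      ≤ ∫⁻ x in B, (μ B)⁻¹ *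
          ∫⁻ y in B, D * (∫⁻ t in Icc (0 : ℝ) 1, h (x + t • (y - x))) ∂μ ∂μ :=
        setLIntegral_mono' hBm hpt
    _ = (μ B)⁻¹ * (D * ∫⁻ x in B, ∫⁻ y in B,
          (∫⁻ t in Icc (0 : ℝ) 1, h (x + t • (y - x))) ∂μ ∂μ) := by
        rw [lintegral_const_mul' _ _ (by finiteness)]
        simp only [lintegral_const_mul' _ _ hD]
    _ ≤ (μ B)⁻¹ * (D * (N * ∫⁻ z, h z ∂μ)) := by
        gcongr
        exact lintegral_segment_le μ hhm
    _ = _ := by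
        rw [hh, lintegral_indicator hBm]
        ring

end Haar

theorem one_sub_sq_rpow_le {t α : ℝ} (ht0 : 0 ≤ t) (ht1 : t < 1) :
    (1 - t ^ 2) ^ α ≤ 2 ^ |α| * (1 - t) ^ α := by
  have h1 : 0 < 1 - t := by linarith
  rw [show 1 - t ^ 2 = (1 + t) * (1 - t) by ring, Real.mul_rpow (by linarith) h1.le]
  gcongr
  calc (1 + t) ^ α ≤ (1 + t) ^ |α| := Real.rpow_le_rpow_of_exponent_le (by linarith) (le_abs_self α)
    _ ≤ 2 ^ |α| := by gcongr; linarith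

theorem stmt_7 {n : ℕ} (hn : 2 ≤ n) (α p R : ℝ) (hα : -1 < α) (hp : 1 ≤ p)
    (hR0 : 0 < R) (hR1 : R < 1) :
    ∃ C > 0, ∀ f : EuclideanSpace ℝ (Fin n) → ℝ,
      ContDiffOn ℝ 1 f (ball 0 1) →
      (∫ x in ball (0 : EuclideanSpace ℝ (Fin n)) R, f x) = 0 →
      (∫⁻ x in ball (0 : EuclideanSpace ℝ (Fin n)) 1,
          ENNReal.ofReal (|f x| ^ p * (1 - ‖x‖ ^ 2) ^ α))
        ≤ ENNReal.ofReal C *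
          ∫⁻ x in ball (0 : EuclideanSpace ℝ (Fin n)) 1,
            ENNReal.ofReal (‖fderiv ℝ f x‖ ^ p * (1 - ‖x‖ ^ 2) ^ (α + p)) := by
  have hp0 : 0 ≤ p := by linarith
  obtain ⟨C₁, hC₁, H₁⟩ := lintegral_ball_rpow_le_inner_add_fderiv
    (volume : Measure (EuclideanSpace ℝ (Fin n))) hα hp hR0 hR1.le
  obtain ⟨C₂, hC₂, H₂⟩ := lintegral_ball_rpow_le_fderiv_of_setIntegral_eq_zero
    (volume : Measure (EuclideanSpace ℝ (Fin n))) hp hR0 hR1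
  set K : ℝ≥0∞ := ENNReal.ofReal ((1 - R) ^ (-(α + p)))
  set C : ℝ≥0∞ := ENNReal.ofReal (2 ^ |α|) * (C₁ * (C₂ * K + 1))
  have hC : C ≠ ∞ := ENNReal.mul_ne_top ENNReal.ofReal_ne_top (by finiteness)
  refine ⟨C.toReal + 1, by positivity, fun f hf h0 => ?_⟩
  set J := ∫⁻ x in ball (0 : EuclideanSpace ℝ (Fin n)) 1,
    ‖fderiv ℝ f x‖ₑ ^ p * ENNReal.ofReal ((1 - ‖x‖) ^ (α + p)) with hJ
  have hleft : ∫⁻ x in ball (0 : EuclideanSpace ℝ (Fin n)) 1,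
      ENNReal.ofReal (|f x| ^ p * (1 - ‖x‖ ^ 2) ^ α)
      ≤ ENNReal.ofReal (2 ^ |α|) * ∫⁻ x in ball (0 : EuclideanSpace ℝ (Fin n)) 1,
        ‖f x‖ₑ ^ p * ENNReal.ofReal ((1 - ‖x‖) ^ α) := by
    rw [← lintegral_const_mul' _ _ ENNReal.ofReal_ne_top]
    refine setLIntegral_mono' measurableSet_ball fun x hx => ?_
    rw [mem_ball_zero_iff] at hx
    rw [ENNReal.ofReal_mul (by positivity), ← ENNReal.ofReal_rpow_of_nonneg (abs_nonneg _) hp0,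
      ← Real.enorm_eq_ofReal_abs, mul_left_comm, ← ENNReal.ofReal_mul (by positivity)]
    gcongr
    exact one_sub_sq_rpow_le (norm_nonneg x) hx
  have hright : J ≤ ∫⁻ x in ball (0 : EuclideanSpace ℝ (Fin n)) 1,
      ENNReal.ofReal (‖fderiv ℝ f x‖ ^ p * (1 - ‖x‖ ^ 2) ^ (α + p)) := by
    refine setLIntegral_mono' measurableSet_ball fun x hx => ?_
    rw [mem_ball_zero_iff] at hx
    rw [ENNReal.ofReal_mul (by positivity), ← ENNReal.ofReal_rpow_of_nonneg (norm_nonneg _) hp0,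
      ofReal_norm]
    have : 0 ≤ α + p := by linarith
    gcongr
    nlinarith [norm_nonneg x]
  have hinner : ∫⁻ x in ball (0 : EuclideanSpace ℝ (Fin n)) R, ‖fderiv ℝ f x‖ₑ ^ p ≤ K * J := by
    rw [hJ, ← lintegral_const_mul' _ _ ENNReal.ofReal_ne_top]
    refine (setLIntegral_mono' measurableSet_ball fun x hx => ?_).trans
      (lintegral_mono_set (ball_subset_ball hR1.le))
    rw [mem_ball_zero_iff] at hx
    have hR : 0 < 1 - R := by linarith
    have hx' : 0 < 1 - ‖x‖ := by linarith
    rw [mul_left_comm, ← ENNReal.ofReal_mul (by positivity), Real.rpow_neg hR.le]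
    refine le_mul_of_one_le_right zero_le (ENNReal.one_le_ofReal.2 ?_)
    rw [inv_mul_eq_div, one_le_div (by positivity)]
    gcongr
    linarith
  calc _ ≤ ENNReal.ofReal (2 ^ |α|) * (C₁ * (C₂ * (K * J) + J)) := by
        refine hleft.trans (mul_le_mul_right ((H₁ f hf).trans ?_) _)
        gcongr
        exact (H₂ f hf h0).trans (by gcongr)
    _ = C * J := by ring
    _ ≤ ENNReal.ofReal (C.toReal + 1) * J := by
        gcongr
        rw [ENNReal.le_ofReal_iff_toReal_le hC (by positivity)]
        linarith
    _ ≤ _ := by gcongr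
end

section
/- Let α > -1 and 1 ≤ p < ∞. There exists C = C(n,α,p) such that for all g ∈ C²(𝔹), the weighted L^p norm ‖g - g(0)‖_{L^p_α} ≤ C( ‖Ng‖_{L^p_{α+p}} + sup_{|x|≤1/2} |∇(Ng)(x)| ), where Ng(x) = ⟨x, ∇g(x)⟩ is the radial derivative and ‖h‖_{L^p_β}^p = ∫_𝔹 |h(x)|^p (1-|x|²)^β dν(x) (up to a normalizing constant). -/
open MeasureTheory Metric

/-- The normal (radial) derivative `Ng(x) = ⟨x, ∇g(x)⟩ = g'(x)[x]`. -/
noncomputable def normalDeriv {n : ℕ} (g : EuclideanSpace ℝ (Fin n) → ℝ) :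
    EuclideanSpace ℝ (Fin n) → ℝ :=
  fun x => fderiv ℝ g x x

lemma mul_rpow_sub_one_mul_le {K x y p : ℝ} (hK : 0 ≤ K) (hx : 0 ≤ x) (hy : 0 ≤ y) (hp : 1 ≤ p) :
    K * (x ^ (p - 1) * y) ≤ x ^ p / 2 + (2 * K * y) ^ p := by
  have split (z : ℝ) (hz : 0 ≤ z) : z ^ p = z ^ (p - 1) * z := by
    rcases hz.eq_or_lt with rfl | hz
    · simp [Real.zero_rpow (by linarith : p ≠ 0)]
    · rw [← Real.rpow_add_one hz.ne', sub_add_cancel]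
  have hKy : 0 ≤ 2 * K * y := by positivity
  rcases le_total (2 * K * y) x with h | h
  · have h1 : x ^ (p - 1) * (2 * K * y) ≤ x ^ (p - 1) * x :=
      mul_le_mul_of_nonneg_left h (by positivity)
    have h2 : 0 ≤ (2 * K * y) ^ p := by positivity
    rw [split x hx]
    linarith
  · have h1 : x ^ (p - 1) * (2 * K * y) ≤ (2 * K * y) ^ (p - 1) * (2 * K * y) := by
      gcongr
    have h2 : 0 ≤ x ^ p := by positivity
    have h3 : 0 ≤ x ^ (p - 1) * (2 * K * y) := by positivity
    rw [split _ hKy]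
    linarith

/-- Hardy's inequality on `[0, R]` with a weight that is a power of the distance to `1`. -/
lemma integral_rpow_primitive_mul_le {α p R : ℝ} (hα : -1 < α) (hp : 1 ≤ p) (hR0 : 0 ≤ R)
    (hR1 : R < 1) {h : ℝ → ℝ} (hh : ContinuousOn h (Set.Icc 0 R))
    (hpos : ∀ t ∈ Set.Icc 0 R, 0 ≤ h t) :
    ∫ r in 0..R, (∫ t in 0..r, h t) ^ p * (1 - r) ^ α ≤
      2 * (2 * (p / (α + 1))) ^ p * ∫ r in 0..R, h r ^ p * (1 - r) ^ (α + p) := by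
  set K := p / (α + 1) with hKdef
  have hα' : 0 < α + 1 := by linarith
  have hK : 0 ≤ K := by positivity
  set G : ℝ → ℝ := fun r ↦ ∫ t in 0..r, h t with hG
  have hsub : ∀ r ∈ Set.Icc 0 R, Set.Icc 0 r ⊆ Set.Icc 0 R :=
    fun r hr ↦ Set.Icc_subset_Icc_right hr.2
  have hG0 : ∀ r ∈ Set.Icc 0 R, 0 ≤ G r := fun r hr ↦
    intervalIntegral.integral_nonneg hr.1 fun t ht ↦ hpos t (hsub r hr ht)
  have hGc : ContinuousOn G (Set.Icc 0 R) := by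
    have := intervalIntegral.continuousOn_primitive_interval (μ := volume) (a := 0) (b := R)
      (f := h) (by rw [Set.uIcc_of_le hR0]; exact hh.integrableOn_Icc)
    rwa [Set.uIcc_of_le hR0] at this
  have hGd : ∀ r ∈ Set.Ioo 0 R, HasDerivAt G (h r) r := by
    intro r hr
    have hr' : r ∈ Set.Icc 0 R := Set.Ioo_subset_Icc_self hr
    refine intervalIntegral.integral_hasDerivAt_right ?_ ?_ ?_
    · exact (hh.mono (by rw [Set.uIcc_of_le hr'.1]; exact hsub r hr')).intervalIntegrable
    · exact (hh.mono Set.Ioo_subset_Icc_self).stronglyMeasurableAtFilter isOpen_Ioo r hr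
    · exact hh.continuousAt (Icc_mem_nhds hr.1 hr.2)
  have hw : ∀ β : ℝ, ContinuousOn (fun r : ℝ ↦ (1 - r) ^ β) (Set.Icc 0 R) := fun β ↦
    (continuousOn_const.sub continuousOn_id).rpow_const fun r hr ↦
      Or.inl (sub_pos.2 (hr.2.trans_lt hR1)).ne'
  have hA : ContinuousOn (fun r ↦ G r ^ p * (1 - r) ^ α) (Set.Icc 0 R) :=
    (hGc.rpow_const fun _ _ ↦ Or.inr (by linarith)).mul (hw α)
  have hB : ContinuousOn (fun r ↦ h r ^ p * (1 - r) ^ (α + p)) (Set.Icc 0 R) :=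
    (hh.rpow_const fun _ _ ↦ Or.inr (by linarith)).mul (hw _)
  have hint : ∀ {u : ℝ → ℝ}, ContinuousOn u (Set.Icc 0 R) → IntervalIntegrable u volume 0 R :=
    fun hu ↦ ContinuousOn.intervalIntegrable (by rwa [Set.uIcc_of_le hR0])
  set Φ : ℝ → ℝ := fun r ↦ -(G r ^ p * (1 - r) ^ (α + 1)) / (α + 1) with hΦ
  have key := intervalIntegral.integral_le_sub_of_hasDeriv_right_of_le (g := Φ)
    (g' := fun r ↦ -(h r * p * G r ^ (p - 1) * (1 - r) ^ (α + 1) +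
      G r ^ p * (-1 * (α + 1) * (1 - r) ^ (α + 1 - 1))) / (α + 1))
    (φ := fun r ↦ 1 / 2 * (G r ^ p * (1 - r) ^ α) -
      (2 * K) ^ p * (h r ^ p * (1 - r) ^ (α + p))) hR0
    ?_ ?_ ?_ ?_
  · rw [intervalIntegral.integral_sub ((hint hA).const_mul _) ((hint hB).const_mul _),
      intervalIntegral.integral_const_mul, intervalIntegral.integral_const_mul] at key
    have h0 : Φ 0 = 0 := by
      simp [hΦ, hG, Real.zero_rpow (by linarith : p ≠ 0)]
    have h1 : Φ R ≤ 0 := by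
      have : 0 ≤ G R ^ p * (1 - R) ^ (α + 1) / (α + 1) := by
        have := hG0 R ⟨hR0, le_rfl⟩
        have : 0 ≤ 1 - R := by linarith
        positivity
      simp only [hΦ, neg_div]
      linarith
    linarith
  · exact (((hGc.rpow_const fun _ _ ↦ Or.inr (by linarith)).mul (hw _)).neg).div_const _
  · intro r hr
    have h1 : HasDerivAt (fun r : ℝ ↦ 1 - r) (-1) r := by
      simpa using (hasDerivAt_id r).const_sub 1
    exact (((((hGd r hr).rpow_const (Or.inr hp)).mul (h1.rpow_const (p := α + 1)
      (Or.inl (by have := hr.2; linarith)))).neg).div_const _).hasDerivWithinAt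
  · exact ((hA.const_mul _).sub (hB.const_mul _)).integrableOn_Icc
  · intro r hr
    have hr' : r ∈ Set.Icc 0 R := Set.Ioo_subset_Icc_self hr
    have h1r : 0 < 1 - r := by have := hr.2; linarith
    have hy := mul_rpow_sub_one_mul_le hK (hG0 r hr') (mul_nonneg (hpos r hr') h1r.le) hp
    rw [← mul_assoc (2 * K), Real.mul_rpow (mul_nonneg (by positivity) (hpos r hr')) h1r.le,
      Real.mul_rpow (by positivity) (hpos r hr')] at hy
    have hy' := mul_le_mul_of_nonneg_right hy (Real.rpow_nonneg h1r.le α)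
    rw [add_sub_cancel_right, Real.rpow_add h1r, Real.rpow_add_one h1r.ne']
    have e : -(h r * p * G r ^ (p - 1) * ((1 - r) ^ α * (1 - r)) +
        G r ^ p * (-1 * (α + 1) * (1 - r) ^ α)) / (α + 1) =
        G r ^ p * (1 - r) ^ α - K * (G r ^ (p - 1) * (h r * (1 - r))) * (1 - r) ^ α := by
      rw [hKdef]
      field_simp
      ring
    rw [e]
    linarith

lemma iUnion_Ioc_zero_one : ⋃ n : ℕ, Set.Ioc (0 : ℝ) (1 - 1 / (n + 1)) = Set.Ioo 0 1 := by
  ext x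
  simp only [Set.mem_iUnion, Set.mem_Ioc, Set.mem_Ioo]
  constructor
  · rintro ⟨n, h0, h1⟩
    have : (0 : ℝ) < 1 / (n + 1) := by positivity
    exact ⟨h0, by linarith⟩
  · rintro ⟨h0, h1⟩
    obtain ⟨n, hn⟩ := exists_nat_one_div_lt (sub_pos.2 h1)
    exact ⟨n, h0, by linarith⟩

/-- Hardy's inequality on `(0, 1)` with a weight that is a power of the distance to `1`. -/
lemma lintegral_rpow_abs_mul_le {α p : ℝ} (hα : -1 < α) (hp : 1 ≤ p) {F f : ℝ → ℝ}
    (hF0 : F 0 = 0) (hF : ∀ t ∈ Set.Ico (0 : ℝ) 1, HasDerivAt F (f t) t)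
    (hf : ContinuousOn f (Set.Ico 0 1)) :
    ∫⁻ r in Set.Ioo (0 : ℝ) 1, ENNReal.ofReal (|F r| ^ p * (1 - r) ^ α) ≤
      ENNReal.ofReal (2 * (2 * (p / (α + 1))) ^ p) *
        ∫⁻ r in Set.Ioo (0 : ℝ) 1, ENNReal.ofReal (|f r| ^ p * (1 - r) ^ (α + p)) := by
  have hα' : 0 < α + 1 := by linarith
  conv_lhs => rw [← iUnion_Ioc_zero_one]
  rw [setLIntegral_iUnion_of_directed]
  · refine iSup_le fun n ↦ ?_
    set R : ℝ := 1 - 1 / (n + 1) with hR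
    have hn : (0 : ℝ) < 1 / (n + 1) := by positivity
    have hR1 : R < 1 := by linarith
    have hR0 : 0 ≤ R := by
      rw [hR, sub_nonneg, div_le_one (by positivity)]
      linarith [(Nat.cast_nonneg n : (0 : ℝ) ≤ n)]
    have hfR : ContinuousOn f (Set.Icc 0 R) :=
      hf.mono fun x hx ↦ ⟨hx.1, hx.2.trans_lt hR1⟩
    have hw : ∀ β : ℝ, ContinuousOn (fun r : ℝ ↦ (1 - r) ^ β) (Set.Icc 0 R) := fun β ↦
      (continuousOn_const.sub continuousOn_id).rpow_const fun r hr ↦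
        Or.inl (sub_pos.2 (hr.2.trans_lt hR1)).ne'
    have hGc : ContinuousOn (fun r ↦ ∫ t in 0..r, |f t|) (Set.Icc 0 R) := by
      have := intervalIntegral.continuousOn_primitive_interval (μ := volume) (a := 0) (b := R)
        (f := fun t ↦ |f t|) (by rw [Set.uIcc_of_le hR0]; exact hfR.abs.integrableOn_Icc)
      rwa [Set.uIcc_of_le hR0] at this
    have hA : IntegrableOn (fun r ↦ (∫ t in 0..r, |f t|) ^ p * (1 - r) ^ α) (Set.Ioc 0 R) :=
      ((hGc.rpow_const fun _ _ ↦ Or.inr (by linarith)).mul (hw α)).integrableOn_Icc.mono_set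
        Set.Ioc_subset_Icc_self
    have hB : IntegrableOn (fun r ↦ |f r| ^ p * (1 - r) ^ (α + p)) (Set.Ioc 0 R) :=
      ((hfR.abs.rpow_const fun _ _ ↦ Or.inr (by linarith)).mul (hw _)).integrableOn_Icc.mono_set
        Set.Ioc_subset_Icc_self
    have hFG : ∀ r ∈ Set.Ioc 0 R, |F r| ≤ ∫ t in 0..r, |f t| := by
      intro r hr
      have hsub : Set.uIcc 0 r ⊆ Set.Icc 0 R := by
        rw [Set.uIcc_of_le hr.1.le]
        exact Set.Icc_subset_Icc_right hr.2
      have := intervalIntegral.integral_eq_sub_of_hasDerivAt (f := F) (f' := f) (a := 0) (b := r)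
        (fun x hx ↦ hF x ⟨(hsub hx).1, (hsub hx).2.trans_lt hR1⟩)
        (hfR.mono hsub).intervalIntegrable
      rw [hF0, sub_zero] at this
      rw [← this]
      exact intervalIntegral.abs_integral_le_integral_abs hr.1.le
    calc ∫⁻ r in Set.Ioc 0 R, ENNReal.ofReal (|F r| ^ p * (1 - r) ^ α)
        ≤ ∫⁻ r in Set.Ioc 0 R, ENNReal.ofReal ((∫ t in 0..r, |f t|) ^ p * (1 - r) ^ α) := by
          refine setLIntegral_mono' measurableSet_Ioc fun r hr ↦ ENNReal.ofReal_le_ofReal ?_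
          have h1r : 0 ≤ 1 - r := by linarith [hr.2]
          have := hFG r hr
          gcongr
      _ = ENNReal.ofReal (∫ r in 0..R, (∫ t in 0..r, |f t|) ^ p * (1 - r) ^ α) := by
          rw [intervalIntegral.integral_of_le hR0, ofReal_integral_eq_lintegral_ofReal hA]
          filter_upwards [ae_restrict_mem measurableSet_Ioc] with r hr
          have h1r : 0 ≤ 1 - r := by linarith [hr.2]
          have := (abs_nonneg _).trans (hFG r hr)
          simp only [Pi.zero_apply]
          positivity
      _ ≤ ENNReal.ofReal (2 * (2 * (p / (α + 1))) ^ p *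
            ∫ r in 0..R, |f r| ^ p * (1 - r) ^ (α + p)) :=
          ENNReal.ofReal_le_ofReal (integral_rpow_primitive_mul_le hα hp hR0 hR1 hfR.abs
            fun _ _ ↦ abs_nonneg _)
      _ = ENNReal.ofReal (2 * (2 * (p / (α + 1))) ^ p) *
            ∫⁻ r in Set.Ioc 0 R, ENNReal.ofReal (|f r| ^ p * (1 - r) ^ (α + p)) := by
          rw [ENNReal.ofReal_mul (by positivity), intervalIntegral.integral_of_le hR0,
            ofReal_integral_eq_lintegral_ofReal hB]
          filter_upwards [ae_restrict_mem measurableSet_Ioc] with r hr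
          have h1r : 0 ≤ 1 - r := by linarith [hr.2]
          simp only [Pi.zero_apply]
          positivity
      _ ≤ _ := by
          refine mul_le_mul_right (lintegral_mono_set fun x hx ↦ ?_) _
          exact ⟨hx.1, hx.2.trans_lt hR1⟩
  · refine directed_of_isDirected_le fun m n hmn ↦ Set.Ioc_subset_Ioc_right ?_
    gcongr

/-- Integration in polar coordinates over the unit ball. -/
lemma setLIntegral_ball_eq_lintegral_sphere {E : Type*} [NormedAddCommGroup E] [NormedSpace ℝ E]
    [FiniteDimensional ℝ E] [Nontrivial E] [MeasurableSpace E] [BorelSpace E] (μ : Measure E)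
    [μ.IsAddHaarMeasure] {f : E → ENNReal} (hf : ContinuousOn f (ball 0 1)) :
    ∫⁻ x in ball (0 : E) 1, f x ∂μ =
      ∫⁻ ζ : sphere (0 : E) 1, (∫⁻ r in Set.Ioo (0 : ℝ) 1,
        ENNReal.ofReal (r ^ (Module.finrank ℝ E - 1)) * f (r • (ζ : E))) ∂μ.toSphere := by
  classical
  have hmeas : Measurable ((ball (0 : E) 1).indicator f) := by
    rw [← Set.piecewise_eq_indicator]
    exact hf.measurable_piecewise continuousOn_const measurableSet_ball
  set g := (ball (0 : E) 1).indicator f with hg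
  have hu : Measurable fun z : sphere (0 : E) 1 × Set.Ioi (0 : ℝ) ↦ g (z.2.1 • z.1.1) := by
    fun_prop
  calc ∫⁻ x in ball (0 : E) 1, f x ∂μ = ∫⁻ x, g x ∂μ :=
        (lintegral_indicator measurableSet_ball f).symm
    _ = ∫⁻ x : ({0}ᶜ : Set E), g x ∂(μ.comap (↑)) := by
        rw [lintegral_subtype_comap (measurableSet_singleton _).compl,
          restrict_compl_singleton]
    _ = ∫⁻ x : ({0}ᶜ : Set E), (fun z : sphere (0 : E) 1 × Set.Ioi (0 : ℝ) ↦ g (z.2.1 • z.1.1))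
          (homeomorphUnitSphereProd E x) ∂(μ.comap (↑)) := by
        refine lintegral_congr fun x ↦ ?_
        have hx : ‖(x : E)‖ ≠ 0 := norm_ne_zero_iff.2 x.2
        simp [smul_smul, hx]
    _ = ∫⁻ z, g (z.2.1 • z.1.1) ∂(μ.toSphere.prod (.volumeIoiPow (Module.finrank ℝ E - 1))) :=
        μ.measurePreserving_homeomorphUnitSphereProd.lintegral_comp hu
    _ = ∫⁻ ζ : sphere (0 : E) 1, ∫⁻ r : Set.Ioi (0 : ℝ), g (r.1 • ζ.1)
          ∂(.volumeIoiPow (Module.finrank ℝ E - 1)) ∂μ.toSphere := lintegral_prod _ hu.aemeasurable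
    _ = _ := by
        refine lintegral_congr fun ζ ↦ ?_
        rw [Measure.volumeIoiPow, lintegral_withDensity_eq_lintegral_mul _ (by fun_prop)
          (by fun_prop)]
        simp only [Pi.mul_apply]
        rw [lintegral_subtype_comap measurableSet_Ioi
          (fun r : ℝ ↦ ENNReal.ofReal (r ^ (Module.finrank ℝ E - 1)) * g (r • ζ.1)),
          ← lintegral_indicator measurableSet_Ioi, ← lintegral_indicator measurableSet_Ioo]
        refine lintegral_congr fun r ↦ ?_
        have hζ : ‖ζ.1‖ = 1 := by simp
        by_cases h0 : 0 < r
        · by_cases h1 : r < 1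
          · rw [Set.indicator_of_mem (Set.mem_Ioi.2 h0), Set.indicator_of_mem (Set.mem_Ioo.2 ⟨h0, h1⟩), hg,
              Set.indicator_of_mem]
            simpa [norm_smul, abs_of_pos h0] using h1
          · rw [Set.indicator_of_mem (Set.mem_Ioi.2 h0), Set.indicator_of_notMem (by simp [h1]), hg,
              Set.indicator_of_notMem, mul_zero]
            simpa [norm_smul, abs_of_pos h0] using h1
        · rw [Set.indicator_of_notMem (by simpa using h0), Set.indicator_of_notMem (by simp [h0])]

/-- A weighted Hardy inequality along a ray, in which the vanishing of the radial density `r ^ m`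
at the origin is compensated by a bound for the derivative on `(0, 1 / 2]`. -/
lemma lintegral_ray_le {α p M : ℝ} (m : ℕ) (hα : -1 < α) (hp : 1 ≤ p) {F f : ℝ → ℝ}
    (hF0 : F 0 = 0) (hF : ∀ t ∈ Set.Ico (0 : ℝ) 1, HasDerivAt F (f t) t)
    (hf : ContinuousOn f (Set.Ico 0 1)) (hM : 0 ≤ M)
    (hfM : ∀ t ∈ Set.Ioc (0 : ℝ) (1 / 2), |f t| ≤ M) :
    ∫⁻ r in Set.Ioo (0 : ℝ) 1,
        ENNReal.ofReal (r ^ m) * ENNReal.ofReal (|F r| ^ p * (1 - r ^ 2) ^ α) ≤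
      ENNReal.ofReal (2 ^ |α| * (2 * (2 * (p / (α + 1))) ^ p)) * (ENNReal.ofReal M ^ p +
        ENNReal.ofReal (2 ^ p * 2 ^ m) * ∫⁻ r in Set.Ioo (0 : ℝ) 1,
          ENNReal.ofReal (r ^ m) * ENNReal.ofReal (|r * f r| ^ p * (1 - r ^ 2) ^ (α + p))) := by
  have hα' : 0 < α + 1 := by linarith
  have hfactor : ∀ r : ℝ, 1 - r ^ 2 = (1 - r) * (1 + r) := fun r ↦ by ring
  calc ∫⁻ r in Set.Ioo (0 : ℝ) 1,
        ENNReal.ofReal (r ^ m) * ENNReal.ofReal (|F r| ^ p * (1 - r ^ 2) ^ α)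
      ≤ ∫⁻ r in Set.Ioo (0 : ℝ) 1,
          ENNReal.ofReal (2 ^ |α|) * ENNReal.ofReal (|F r| ^ p * (1 - r) ^ α) := by
        refine setLIntegral_mono' measurableSet_Ioo fun r hr ↦ ?_
        have h1r : 0 < 1 - r := sub_pos.2 hr.2
        have hr0 : 0 < r := hr.1
        rw [← ENNReal.ofReal_mul (by positivity), ← ENNReal.ofReal_mul (by positivity)]
        refine ENNReal.ofReal_le_ofReal ?_
        have hplus : (1 + r) ^ α ≤ 2 ^ |α| :=
          (Real.rpow_le_rpow_of_exponent_le (by linarith) (le_abs_self α)).trans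
            (Real.rpow_le_rpow (by linarith) (by linarith [hr.2]) (abs_nonneg α))
        rw [hfactor, Real.mul_rpow h1r.le (by linarith)]
        calc r ^ m * (|F r| ^ p * ((1 - r) ^ α * (1 + r) ^ α))
            ≤ 1 * (|F r| ^ p * ((1 - r) ^ α * 2 ^ |α|)) := by
              gcongr
              exact pow_le_one₀ hr0.le hr.2.le
          _ = _ := by ring
    _ = ENNReal.ofReal (2 ^ |α|) *
          ∫⁻ r in Set.Ioo (0 : ℝ) 1, ENNReal.ofReal (|F r| ^ p * (1 - r) ^ α) :=
        lintegral_const_mul' _ _ ENNReal.ofReal_ne_top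
    _ ≤ ENNReal.ofReal (2 ^ |α|) * (ENNReal.ofReal (2 * (2 * (p / (α + 1))) ^ p) *
          ∫⁻ r in Set.Ioo (0 : ℝ) 1, ENNReal.ofReal (|f r| ^ p * (1 - r) ^ (α + p))) := by
        gcongr
        exact lintegral_rpow_abs_mul_le hα hp hF0 hF hf
    _ = ENNReal.ofReal (2 ^ |α| * (2 * (2 * (p / (α + 1))) ^ p)) *
          ∫⁻ r in Set.Ioo (0 : ℝ) 1, ENNReal.ofReal (|f r| ^ p * (1 - r) ^ (α + p)) := by
        rw [← mul_assoc, ← ENNReal.ofReal_mul (by positivity)]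
    _ ≤ ENNReal.ofReal (2 ^ |α| * (2 * (2 * (p / (α + 1))) ^ p)) *
          ∫⁻ r in Set.Ioo (0 : ℝ) 1, (ENNReal.ofReal M ^ p + ENNReal.ofReal (2 ^ p * 2 ^ m) *
            (ENNReal.ofReal (r ^ m) *
              ENNReal.ofReal (|r * f r| ^ p * (1 - r ^ 2) ^ (α + p)))) := by
        refine mul_le_mul_right (setLIntegral_mono' measurableSet_Ioo fun r hr ↦ ?_) _
        have h1r : 0 < 1 - r := sub_pos.2 hr.2
        have hr0 : 0 < r := hr.1
        have hr2 : 0 ≤ 1 - r ^ 2 := by rw [hfactor]; positivity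
        rw [ENNReal.ofReal_rpow_of_nonneg hM (by linarith), ← ENNReal.ofReal_mul (by positivity),
          ← ENNReal.ofReal_mul (by positivity), ← ENNReal.ofReal_add (by positivity)
          (by positivity)]
        refine ENNReal.ofReal_le_ofReal ?_
        rcases le_or_gt r (1 / 2) with h | h
        · have h1 : |f r| ^ p * (1 - r) ^ (α + p) ≤ M ^ p * 1 := by
            gcongr
            · exact hfM r ⟨hr0, h⟩
            · exact Real.rpow_le_one h1r.le (by linarith) (by linarith)
          have h2 : 0 ≤ 2 ^ p * 2 ^ m * (r ^ m * (|r * f r| ^ p * (1 - r ^ 2) ^ (α + p))) := by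
            positivity
          linarith
        · have h1 : |f r| ^ p ≤ 2 ^ p * |r * f r| ^ p := by
            rw [← Real.mul_rpow (by positivity) (by positivity), abs_mul, abs_of_pos hr0]
            gcongr
            nlinarith [abs_nonneg (f r)]
          have h2 : (1 - r) ^ (α + p) ≤ (1 - r ^ 2) ^ (α + p) :=
            Real.rpow_le_rpow h1r.le (by nlinarith) (by linarith)
          have h3 : 1 ≤ 2 ^ m * r ^ m := by
            rw [← mul_pow]
            exact one_le_pow₀ (by linarith)
          have h4 : 0 ≤ M ^ p := by positivity
          calc |f r| ^ p * (1 - r) ^ (α + p)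
              ≤ 1 * ((2 ^ p * |r * f r| ^ p) * (1 - r ^ 2) ^ (α + p)) := by
                rw [one_mul]
                gcongr
            _ ≤ (2 ^ m * r ^ m) * ((2 ^ p * |r * f r| ^ p) * (1 - r ^ 2) ^ (α + p)) := by
                gcongr
            _ ≤ M ^ p + 2 ^ p * 2 ^ m * (r ^ m * (|r * f r| ^ p * (1 - r ^ 2) ^ (α + p))) := by
                linarith
    _ = _ := by
        rw [lintegral_add_left measurable_const, lintegral_const_mul' _ _ ENNReal.ofReal_ne_top]
        simp

lemma ContDiffOn.normalDeriv {n : ℕ} {g : EuclideanSpace ℝ (Fin n) → ℝ}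
    {s : Set (EuclideanSpace ℝ (Fin n))} (hs : IsOpen s) (hg : ContDiffOn ℝ 2 g s) :
    ContDiffOn ℝ 1 (normalDeriv g) s :=
  (hg.fderiv_of_isOpen hs (by norm_num)).clm_apply contDiffOn_id

lemma normalDeriv_smul {n : ℕ} (g : EuclideanSpace ℝ (Fin n) → ℝ) (t : ℝ)
    (x : EuclideanSpace ℝ (Fin n)) : normalDeriv g (t • x) = t * fderiv ℝ g (t • x) x := by
  simp [normalDeriv]

lemma norm_fderiv_normalDeriv_le_iSup {n : ℕ} {g : EuclideanSpace ℝ (Fin n) → ℝ}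
    (hg : ContDiffOn ℝ 2 g (ball 0 1)) {x : EuclideanSpace ℝ (Fin n)}
    (hx : x ∈ closedBall (0 : EuclideanSpace ℝ (Fin n)) (1 / 2)) :
    ‖fderiv ℝ (normalDeriv g) x‖ ≤
      ⨆ x : closedBall (0 : EuclideanSpace ℝ (Fin n)) (1 / 2), ‖fderiv ℝ (normalDeriv g) x‖ := by
  have hc : ContinuousOn (fun x ↦ ‖fderiv ℝ (normalDeriv g) x‖)
      (closedBall (0 : EuclideanSpace ℝ (Fin n)) (1 / 2)) :=
    (((hg.normalDeriv isOpen_ball).continuousOn_fderiv_of_isOpen isOpen_ball le_rfl).mono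
      (closedBall_subset_ball (by norm_num))).norm
  have hb := (isCompact_closedBall (0 : EuclideanSpace ℝ (Fin n)) (1 / 2)).bddAbove_image hc
  rw [Set.image_eq_range] at hb
  exact le_ciSup hb ⟨x, hx⟩

lemma abs_normalDeriv_le {n : ℕ} {g : EuclideanSpace ℝ (Fin n) → ℝ}
    (hg : ContDiffOn ℝ 2 g (ball 0 1)) {x : EuclideanSpace ℝ (Fin n)}
    (hx : x ∈ closedBall (0 : EuclideanSpace ℝ (Fin n)) (1 / 2)) :
    |normalDeriv g x| ≤ (⨆ x : closedBall (0 : EuclideanSpace ℝ (Fin n)) (1 / 2),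
      ‖fderiv ℝ (normalDeriv g) x‖) * ‖x‖ := by
  have hd : ∀ y ∈ closedBall (0 : EuclideanSpace ℝ (Fin n)) (1 / 2),
      DifferentiableAt ℝ (normalDeriv g) y := fun y hy ↦
    ((hg.normalDeriv isOpen_ball).differentiableOn one_ne_zero).differentiableAt
      (isOpen_ball.mem_nhds (closedBall_subset_ball (by norm_num) hy))
  have := (convex_closedBall (0 : EuclideanSpace ℝ (Fin n)) (1 / 2)).norm_image_sub_le_of_norm_fderiv_le
    hd (fun y hy ↦ norm_fderiv_normalDeriv_le_iSup hg hy) (mem_closedBall_self (by norm_num)) hx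
  simpa [normalDeriv] using this

/-- The integrated form of the estimate, in terms of the `p`-th powers of the norms. -/
lemma lintegral_ball_abs_sub_rpow_le {n : ℕ} (hn : 1 ≤ n) {α p : ℝ} (hα : -1 < α) (hp : 1 ≤ p)
    {g : EuclideanSpace ℝ (Fin n) → ℝ} (hg : ContDiffOn ℝ 2 g (ball 0 1)) :
    ∫⁻ x in ball (0 : EuclideanSpace ℝ (Fin n)) 1,
        ENNReal.ofReal (|g x - g 0| ^ p * (1 - ‖x‖ ^ 2) ^ α) ≤
      ENNReal.ofReal (2 ^ |α| * (2 * (2 * (p / (α + 1))) ^ p)) *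
        (ENNReal.ofReal (⨆ x : closedBall (0 : EuclideanSpace ℝ (Fin n)) (1 / 2),
            ‖fderiv ℝ (normalDeriv g) x‖) ^ p *
          (volume : Measure (EuclideanSpace ℝ (Fin n))).toSphere Set.univ +
        ENNReal.ofReal (2 ^ p * 2 ^ (n - 1)) *
          ∫⁻ x in ball (0 : EuclideanSpace ℝ (Fin n)) 1,
            ENNReal.ofReal (|normalDeriv g x| ^ p * (1 - ‖x‖ ^ 2) ^ (α + p))) := by
  have : NeZero n := ⟨by omega⟩
  set M := ⨆ x : closedBall (0 : EuclideanSpace ℝ (Fin n)) (1 / 2), ‖fderiv ℝ (normalDeriv g) x‖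
  have hM : 0 ≤ M := Real.iSup_nonneg fun _ ↦ norm_nonneg _
  have hw : ∀ β : ℝ, ContinuousOn (fun x : EuclideanSpace ℝ (Fin n) ↦ (1 - ‖x‖ ^ 2) ^ β)
      (ball 0 1) := fun β ↦
    (by fun_prop : Continuous fun x : EuclideanSpace ℝ (Fin n) ↦ 1 - ‖x‖ ^ 2).continuousOn.rpow_const
      fun x hx ↦ Or.inl (by
        rw [mem_ball_zero_iff] at hx
        nlinarith [norm_nonneg x])
  have hcont : ∀ {u : EuclideanSpace ℝ (Fin n) → ℝ} (β : ℝ), ContinuousOn u (ball 0 1) →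
      ContinuousOn (fun x ↦ ENNReal.ofReal (|u x| ^ p * (1 - ‖x‖ ^ 2) ^ β)) (ball 0 1) :=
    fun β hu ↦ ENNReal.continuous_ofReal.comp_continuousOn
      ((hu.abs.rpow_const fun _ _ ↦ Or.inr (by linarith)).mul (hw β))
  rw [setLIntegral_ball_eq_lintegral_sphere _
      (hcont (u := fun x ↦ g x - g 0) α (hg.continuousOn.sub continuousOn_const)),
    setLIntegral_ball_eq_lintegral_sphere _ (hcont (α + p) (hg.normalDeriv isOpen_ball).continuousOn),
    ← lintegral_const_mul' _ _ ENNReal.ofReal_ne_top, ← lintegral_const,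
    ← lintegral_add_left measurable_const, ← lintegral_const_mul' _ _ ENNReal.ofReal_ne_top,
    finrank_euclideanSpace_fin]
  refine lintegral_mono fun ζ ↦ ?_
  have hζ : ‖ζ.1‖ = 1 := by simp
  have hball : ∀ t ∈ Set.Ico (0 : ℝ) 1, t • ζ.1 ∈ ball (0 : EuclideanSpace ℝ (Fin n)) 1 := by
    intro t ht
    rw [mem_ball_zero_iff, norm_smul, hζ, mul_one, Real.norm_of_nonneg ht.1]
    exact ht.2
  have hray := lintegral_ray_le (n - 1) hα hp (M := M) (F := fun t ↦ g (t • ζ.1) - g 0)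
    (f := fun t ↦ fderiv ℝ g (t • ζ.1) ζ.1) (by simp) ?_ ?_ hM ?_
  · have hnorm (u : ℝ → ℝ) (β : ℝ) : ∫⁻ r in Set.Ioo (0 : ℝ) 1, ENNReal.ofReal (r ^ (n - 1)) *
          ENNReal.ofReal (|u r| ^ p * (1 - ‖r • ζ.1‖ ^ 2) ^ β) =
        ∫⁻ r in Set.Ioo (0 : ℝ) 1, ENNReal.ofReal (r ^ (n - 1)) *
          ENNReal.ofReal (|u r| ^ p * (1 - r ^ 2) ^ β) :=
      setLIntegral_congr_fun measurableSet_Ioo fun r hr ↦ by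
        simp only [norm_smul, hζ, mul_one, Real.norm_of_nonneg hr.1.le]
    simp only [normalDeriv_smul]
    rw [← hnorm, ← hnorm] at hray
    exact hray
  · intro t ht
    have h1 : HasDerivAt (fun t : ℝ ↦ t • ζ.1) ζ.1 t := by
      simpa using (hasDerivAt_id t).smul_const ζ.1
    have h2 : HasFDerivAt g (fderiv ℝ g (t • ζ.1)) (t • ζ.1) :=
      ((hg.differentiableOn two_ne_zero).differentiableAt
        (isOpen_ball.mem_nhds (hball t ht))).hasFDerivAt
    exact (h2.comp_hasDerivAt t h1).sub_const _
  · exact ((hg.continuousOn_fderiv_of_isOpen isOpen_ball one_le_two).comp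
      (by fun_prop) hball).clm_apply continuousOn_const
  · intro t ht
    have hnt : ‖t • ζ.1‖ = t := by rw [norm_smul, hζ, mul_one, Real.norm_of_nonneg ht.1.le]
    have h1 := abs_normalDeriv_le hg (x := t • ζ.1) (by rw [mem_closedBall_zero_iff, hnt]; exact ht.2)
    rw [normalDeriv_smul, hnt, abs_mul, abs_of_pos ht.1, mul_comm] at h1
    exact le_of_mul_le_mul_right h1 ht.1

theorem stmt_8 {n : ℕ} (hn : 2 ≤ n) (α p : ℝ) (hα : -1 < α) (hp : 1 ≤ p) :
    ∃ C > 0, ∀ g : EuclideanSpace ℝ (Fin n) → ℝ,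
      ContDiffOn ℝ 2 g (ball 0 1) →
      (∫⁻ x in ball (0 : EuclideanSpace ℝ (Fin n)) 1,
          ENNReal.ofReal (|g x - g 0| ^ p * (1 - ‖x‖ ^ 2) ^ α)) ^ (1 / p)
        ≤ ENNReal.ofReal C *
          ((∫⁻ x in ball (0 : EuclideanSpace ℝ (Fin n)) 1,
              ENNReal.ofReal (|normalDeriv g x| ^ p * (1 - ‖x‖ ^ 2) ^ (α + p))) ^ (1 / p)
           + ENNReal.ofReal (⨆ x : closedBall (0 : EuclideanSpace ℝ (Fin n)) (1 / 2),
               ‖fderiv ℝ (normalDeriv g) x‖)) := by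
  have hα' : 0 < α + 1 := by linarith
  have hp0 : 0 < p := by linarith
  set D : ℝ := 2 ^ |α| * (2 * (2 * (p / (α + 1))) ^ p) with hD
  set σ : ℝ := ((volume : Measure (EuclideanSpace ℝ (Fin n))).toSphere Set.univ).toReal with hσ
  have hσ0 : 0 ≤ σ := ENNReal.toReal_nonneg
  have hD0 : 0 < D := by positivity
  refine ⟨(D * (σ + 2 ^ p * 2 ^ (n - 1))) ^ (1 / p), by positivity, fun g hg ↦ ?_⟩
  have key := lintegral_ball_abs_sub_rpow_le (by omega) hα hp hg
  rw [← hD, ← ENNReal.ofReal_toReal (measure_ne_top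
    (volume : Measure (EuclideanSpace ℝ (Fin n))).toSphere Set.univ), ← hσ] at key
  generalize (∫⁻ x in ball (0 : EuclideanSpace ℝ (Fin n)) 1,
    ENNReal.ofReal (|normalDeriv g x| ^ p * (1 - ‖x‖ ^ 2) ^ (α + p))) = B at key ⊢
  generalize ENNReal.ofReal (⨆ x : closedBall (0 : EuclideanSpace ℝ (Fin n)) (1 / 2),
    ‖fderiv ℝ (normalDeriv g) x‖) = M at key ⊢
  have key' := calc
    _ ≤ ENNReal.ofReal D * (M ^ p * ENNReal.ofReal σ + ENNReal.ofReal (2 ^ p * 2 ^ (n - 1)) * B) :=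
        key
    _ ≤ ENNReal.ofReal D * (M ^ p * ENNReal.ofReal (σ + 2 ^ p * 2 ^ (n - 1)) +
          ENNReal.ofReal (σ + 2 ^ p * 2 ^ (n - 1)) * B) := by
        gcongr
        · exact le_add_of_nonneg_right (by positivity)
        · exact le_add_of_nonneg_left hσ0
    _ = ENNReal.ofReal (D * (σ + 2 ^ p * 2 ^ (n - 1))) * (B + M ^ p) := by
        rw [ENNReal.ofReal_mul hD0.le]
        ring
  calc _ ≤ (ENNReal.ofReal (D * (σ + 2 ^ p * 2 ^ (n - 1))) * (B + M ^ p)) ^ (1 / p) :=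
        ENNReal.rpow_le_rpow key' (by positivity)
    _ = ENNReal.ofReal ((D * (σ + 2 ^ p * 2 ^ (n - 1))) ^ (1 / p)) * (B + M ^ p) ^ (1 / p) := by
        rw [ENNReal.mul_rpow_of_nonneg _ _ (by positivity),
          ENNReal.ofReal_rpow_of_nonneg (by positivity) (by positivity)]
    _ ≤ ENNReal.ofReal ((D * (σ + 2 ^ p * 2 ^ (n - 1))) ^ (1 / p)) *
          (B ^ (1 / p) + (M ^ p) ^ (1 / p)) := by
        gcongr
        exact ENNReal.rpow_add_le_add_rpow _ _ (by positivity) (by rwa [div_le_one hp0])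
    _ = _ := by rw [← ENNReal.rpow_mul, mul_one_div_cancel hp0.ne', ENNReal.rpow_one]
end

section
/- Let k ≥ 1. There is a constant C = C(n,k) such that for every homogeneous harmonic polynomial p of degree m ≥ k on ℝⁿ, every multi-index κ with |κ| = k, and every ζ on the unit sphere, |∂^κ p(ζ)| ≤ C m^{n/2 - 1 + k} ‖p‖_{L²(𝕊)}, where ‖p‖_{L²(𝕊)} is the L² norm of p with respect to the normalized surface measure on the unit sphere. -/
open MeasureTheory MvPolynomial

/-- The polynomial Laplacian `Δp = Σᵢ ∂²p/∂xᵢ²`. -/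
noncomputable def mpLap {n : ℕ} (p : MvPolynomial (Fin n) ℝ) : MvPolynomial (Fin n) ℝ :=
  ∑ i : Fin n, pderiv i (pderiv i p)

/-- Iterated partial derivative `∂^κ p` of a polynomial, multi-index `κ`. -/
noncomputable def mpDeriv {n : ℕ} (κ : Fin n → ℕ) (p : MvPolynomial (Fin n) ℝ) :
    MvPolynomial (Fin n) ℝ :=
  (List.finRange n).foldl (fun q i => (fun r => pderiv i r)^[κ i] q) p

/-- Evaluation of a polynomial at a point of `ℝⁿ`. -/
noncomputable def evP {n : ℕ} (p : MvPolynomial (Fin n) ℝ)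
    (x : EuclideanSpace ℝ (Fin n)) : ℝ :=
  eval (fun i => x i) p

/-- The normalized surface measure on the unit sphere of `ℝⁿ`. -/
noncomputable def sphMeasure (n : ℕ) :
    Measure (Metric.sphere (0 : EuclideanSpace ℝ (Fin n)) 1) :=
  (((volume : Measure (EuclideanSpace ℝ (Fin n))).toSphere Set.univ)⁻¹) •
    (volume : Measure (EuclideanSpace ℝ (Fin n))).toSphere

section Laplacian

variable {n : ℕ}

theorem mpLap_add (p q : MvPolynomial (Fin n) ℝ) : mpLap (p + q) = mpLap p + mpLap q := by
  simp [mpLap, Finset.sum_add_distrib]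

theorem mpLap_smul (c : ℝ) (p : MvPolynomial (Fin n) ℝ) : mpLap (c • p) = c • mpLap p := by
  simp [mpLap, Finset.smul_sum]

/-- The polynomial Laplacian as a linear map. -/
noncomputable def mpLapLinear (n : ℕ) : MvPolynomial (Fin n) ℝ →ₗ[ℝ] MvPolynomial (Fin n) ℝ where
  toFun := mpLap
  map_add' := mpLap_add
  map_smul' := mpLap_smul

@[simp]
theorem mpLapLinear_apply (p : MvPolynomial (Fin n) ℝ) : mpLapLinear n p = mpLap p := rfl

theorem pderiv_comm (i j : Fin n) (p : MvPolynomial (Fin n) ℝ) :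
    pderiv i (pderiv j p) = pderiv j (pderiv i p) := by
  ext a
  simp only [coeff_pderiv, Finsupp.add_apply, Finsupp.single_apply]
  by_cases h : i = j
  · subst h; rfl
  · rw [if_neg h, if_neg (Ne.symm h), add_right_comm]
    simp only [add_zero]
    ring

theorem mpLap_pderiv (i : Fin n) (p : MvPolynomial (Fin n) ℝ) :
    mpLap (pderiv i p) = pderiv i (mpLap p) := by
  simp only [mpLap, map_sum]
  refine Finset.sum_congr rfl fun j _ => ?_
  rw [pderiv_comm j i p, pderiv_comm j i]

theorem mpLap_sq {u : MvPolynomial (Fin n) ℝ} (hu : mpLap u = 0) :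
    mpLap (u ^ 2) = (2 : ℝ) • ∑ i, (pderiv i u) ^ 2 := by
  have h : mpLap (u ^ 2) = 2 * u * mpLap u + 2 * ∑ i, (pderiv i u) ^ 2 := by
    simp only [mpLap, Finset.mul_sum, ← Finset.sum_add_distrib]
    refine Finset.sum_congr rfl fun i _ => ?_
    simp only [pow_two, pderiv_mul, map_add]
    ring
  rw [h, hu, mul_zero, zero_add, ofNat_smul_eq_nsmul, nsmul_eq_mul]
  norm_cast

theorem eval_iterate_mpLapLinear_sq_nonneg (x : Fin n → ℝ) (k : ℕ) :
    ∀ {u : MvPolynomial (Fin n) ℝ}, mpLap u = 0 →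
      0 ≤ eval x ((mpLapLinear n ^ k) (u ^ 2)) := by
  induction k with
  | zero => intro u _; simpa using sq_nonneg (eval x u)
  | succ k ih =>
    intro u hu
    rw [pow_succ, Module.End.mul_apply, mpLapLinear_apply, mpLap_sq hu, map_smul, map_sum,
      smul_eval, map_sum]
    refine mul_nonneg zero_le_two (Finset.sum_nonneg fun i _ => ih ?_)
    rw [mpLap_pderiv, hu, map_zero]

theorem two_pow_mul_sq_eval_foldl_pderiv_le (x : Fin n → ℝ) (l : List (Fin n)) :
    ∀ {u : MvPolynomial (Fin n) ℝ}, mpLap u = 0 →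
      2 ^ l.length * (eval x (l.foldl (fun q i => pderiv i q) u)) ^ 2
        ≤ eval x ((mpLapLinear n ^ l.length) (u ^ 2)) := by
  induction l with
  | nil => intro u _; simp
  | cons j l ih =>
    intro u hu
    have hd : ∀ i, mpLap (pderiv i u) = 0 := fun i => by rw [mpLap_pderiv, hu, map_zero]
    rw [List.length_cons, pow_succ (mpLapLinear n), Module.End.mul_apply, mpLapLinear_apply,
      mpLap_sq hu, map_smul, map_sum, smul_eval, map_sum, List.foldl_cons, pow_succ']
    have h1 := Finset.single_le_sum
      (f := fun i => eval x ((mpLapLinear n ^ l.length) ((pderiv i u) ^ 2)))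
      (fun i _ => eval_iterate_mpLapLinear_sq_nonneg x l.length (hd i)) (Finset.mem_univ j)
    have h2 := ih (hd j)
    linarith

theorem exists_list_mpDeriv (κ : Fin n → ℕ) :
    ∃ l : List (Fin n), l.length = ∑ i, κ i ∧
      ∀ p, mpDeriv κ p = l.foldl (fun q i => pderiv i q) p := by
  refine ⟨(List.finRange n).flatMap fun i => List.replicate (κ i) i, ?_, fun p => ?_⟩
  · simp [List.length_flatMap, ← List.ofFn_eq_map, List.sum_ofFn]
  · rw [List.foldl_flatMap, mpDeriv]
    congr 1
    funext q i
    generalize κ i = c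
    induction c generalizing q with
    | zero => rfl
    | succ c ih => rw [Function.iterate_succ_apply, List.replicate_succ, List.foldl_cons, ih]

/-- The polynomial `|x|² = ∑ xᵢ²`. -/
noncomputable def normSqPoly (n : ℕ) : MvPolynomial (Fin n) ℝ := ∑ i, X i ^ 2

theorem pderiv_normSqPoly (i : Fin n) : pderiv i (normSqPoly n) = 2 * X i := by
  simp only [normSqPoly, map_sum, pderiv_pow, pderiv_X]
  simp [Pi.single_apply]

theorem mpLap_normSqPoly_pow (m : ℕ) :
    mpLap (normSqPoly n ^ (m + 1)) =
      ((2 * (m + 1) * (2 * m + n) : ℝ)) • normSqPoly n ^ m := by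
  have h : ∀ i, pderiv i (pderiv i (normSqPoly n ^ (m + 1))) =
      2 * ((m : MvPolynomial (Fin n) ℝ) + 1) * normSqPoly n ^ m +
        4 * ((m : MvPolynomial (Fin n) ℝ) + 1) * ((m : MvPolynomial (Fin n) ℝ) * normSqPoly n ^ (m - 1)) *
          X i ^ 2 := by
    intro i
    have h0 : pderiv i ((m : MvPolynomial (Fin n) ℝ) + 1) = 0 := by
      simp
    have h2 : pderiv i (2 : MvPolynomial (Fin n) ℝ) = 0 := by
      simpa using (pderiv i).map_natCast (R := ℝ) 2
    simp only [pderiv_pow, pderiv_mul, pderiv_normSqPoly, Nat.add_sub_cancel, Nat.cast_add,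
      Nat.cast_one, h0, h2, pderiv_X_self]
    ring
  have hR : ∑ i, (X i : MvPolynomial (Fin n) ℝ) ^ 2 = normSqPoly n := rfl
  simp only [mpLap, h, Finset.sum_add_distrib, ← Finset.mul_sum, hR, Finset.sum_const,
    Finset.card_univ, Fintype.card_fin, nsmul_eq_mul]
  rw [smul_eq_C_mul]
  rcases m with _ | m
  · have h2 : (C (2 : ℝ) : MvPolynomial (Fin n) ℝ) = 2 := map_ofNat C 2
    simp [h2, mul_comm]
  · simp only [Nat.add_sub_cancel, map_mul, map_add, map_ofNat, map_natCast, map_one,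
      Nat.cast_add, Nat.cast_one]
    ring

theorem eval_iterate_mpLapLinear_normSqPoly_pow_le {x : Fin n → ℝ} (hx : ∑ i, x i ^ 2 = 1)
    {k m : ℕ} (hkm : k ≤ m) :
    eval x ((mpLapLinear n ^ k) (normSqPoly n ^ m)) ≤ (2 * m * (2 * m + n)) ^ k := by
  induction k generalizing m with
  | zero => simp [normSqPoly, hx]
  | succ k ih =>
    obtain ⟨m, rfl⟩ : ∃ j, m = j + 1 := ⟨m - 1, by omega⟩
    have hm := ih (m := m) (by omega)
    rw [pow_succ, Module.End.mul_apply, mpLapLinear_apply, mpLap_normSqPoly_pow, map_smul,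
      smul_eval, pow_succ']
    have h1 : (2 * m * (2 * m + n) : ℝ) ^ k ≤
        (2 * (m + 1 : ℕ) * (2 * (m + 1 : ℕ) + n)) ^ k := by
      gcongr <;> simp
    push_cast at h1 ⊢
    have h2 : (2 * (m + 1) * (2 * m + n) : ℝ) ≤ 2 * (m + 1) * (2 * (m + 1) + n) := by
      gcongr; simp
    exact (mul_le_mul_of_nonneg_left (hm.trans h1) (by positivity)).trans
      (mul_le_mul_of_nonneg_right h2 (by positivity))

end Laplacian

section Rotation

variable {n : ℕ}

/-- Linear substitution of variables by the matrix of `A`. -/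
noncomputable def isomSubst
    (A : EuclideanSpace ℝ (Fin n) ≃ₗᵢ[ℝ] EuclideanSpace ℝ (Fin n)) :
    MvPolynomial (Fin n) ℝ →ₐ[ℝ] MvPolynomial (Fin n) ℝ :=
  aeval fun i => ∑ j, C (A (EuclideanSpace.basisFun (Fin n) ℝ j) i) * X j

variable (A : EuclideanSpace ℝ (Fin n) ≃ₗᵢ[ℝ] EuclideanSpace ℝ (Fin n))

theorem evP_isomSubst (p : MvPolynomial (Fin n) ℝ) (x : EuclideanSpace ℝ (Fin n)) :
    evP (isomSubst A p) x = evP p (A x) := by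
  have hx : ∀ i, A x i = ∑ j, A (EuclideanSpace.basisFun (Fin n) ℝ j) i * x j := by
    intro i
    conv_lhs => rw [← (EuclideanSpace.basisFun (Fin n) ℝ).sum_repr x, map_sum]
    simp [mul_comm]
  have h : (aeval fun i => x i).comp (isomSubst A) =
      (aeval fun i => A x i : MvPolynomial (Fin n) ℝ →ₐ[ℝ] ℝ) := by
    ext i
    simp [isomSubst, hx]
  exact DFunLike.congr_fun h p

theorem isHomogeneous_isomSubst {m : ℕ} {p : MvPolynomial (Fin n) ℝ} (hp : p.IsHomogeneous m) :
    (isomSubst A p).IsHomogeneous m := by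
  rw [← one_mul m]
  exact hp.aeval _ fun i => IsHomogeneous.sum _ _ _ fun j _ => isHomogeneous_C_mul_X _ _

theorem pderiv_isomSubst (i : Fin n) (p : MvPolynomial (Fin n) ℝ) :
    pderiv i (isomSubst A p) =
      ∑ j, C (A (EuclideanSpace.basisFun (Fin n) ℝ i) j) * isomSubst A (pderiv j p) := by
  induction p using MvPolynomial.induction_on with
  | C a => simp [isomSubst]
  | add p q hp hq => simp only [map_add, hp, hq, mul_add, Finset.sum_add_distrib]
  | mul_X p l hp =>
    have hX : pderiv i (isomSubst A (X l)) = C (A (EuclideanSpace.basisFun (Fin n) ℝ i) l) := by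
      simp [isomSubst, pderiv_X, Pi.single_apply]
    have hj : ∀ j, C (A (EuclideanSpace.basisFun (Fin n) ℝ i) j) *
        isomSubst A (pderiv j (p * X l)) =
        C (A (EuclideanSpace.basisFun (Fin n) ℝ i) j) * isomSubst A (pderiv j p) *
          isomSubst A (X l) +
        if j = l then isomSubst A p * C (A (EuclideanSpace.basisFun (Fin n) ℝ i) l) else 0 := by
      intro j
      rw [pderiv_mul, map_add, map_mul, map_mul]
      split_ifs with h
      · subst h
        rw [pderiv_X_self, map_one]
        ring
      · rw [pderiv_X_of_ne (Ne.symm h), map_zero]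
        ring
    rw [map_mul, pderiv_mul, hp, hX, Finset.sum_congr rfl fun j _ => hj j,
      Finset.sum_add_distrib, ← Finset.sum_mul, Finset.sum_ite_eq' Finset.univ l,
      if_pos (Finset.mem_univ l)]

theorem sum_apply_basisFun_mul (j l : Fin n) :
    ∑ i, A (EuclideanSpace.basisFun (Fin n) ℝ i) j * A (EuclideanSpace.basisFun (Fin n) ℝ i) l
      = if j = l then 1 else 0 := by
  have h := ((EuclideanSpace.basisFun (Fin n) ℝ).map A).sum_inner_mul_inner
    (EuclideanSpace.single j (1 : ℝ)) (EuclideanSpace.single l (1 : ℝ))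
  simpa [EuclideanSpace.inner_single_left, EuclideanSpace.inner_single_right, eq_comm] using h

theorem mpLap_isomSubst (p : MvPolynomial (Fin n) ℝ) :
    mpLap (isomSubst A p) = isomSubst A (mpLap p) := by
  simp only [mpLap, pderiv_isomSubst, map_sum, pderiv_C_mul, Finset.mul_sum, ← mul_assoc, ← C_mul]
  rw [Finset.sum_comm]
  refine Finset.sum_congr rfl fun j _ => ?_
  rw [Finset.sum_comm]
  simp only [← Finset.sum_mul, ← map_sum, sum_apply_basisFun_mul]
  simp

end Rotation

section OrthonormalFamily

variable {V : Type*} [AddCommGroup V] [Module ℝ V]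

theorem exists_orthonormal_family_of_posDef [FiniteDimensional ℝ V] (B : V →ₗ[ℝ] V →ₗ[ℝ] ℝ)
    (hsymm : ∀ u v, B u v = B v u) (hpos : ∀ v, v ≠ 0 → 0 < B v v) :
    ∃ b : Fin (Module.finrank ℝ V) → V, (∀ i j, B (b i) (b j) = if i = j then 1 else 0) ∧
      ∀ v, ∑ i, B (b i) v • b i = v := by
  let core : InnerProductSpace.Core ℝ V :=
    { inner := fun u v => B u v
      conj_inner_symm := fun u v => hsymm v u
      re_inner_nonneg := fun v => by
        by_cases hv : v = 0
        · simp [hv]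
        · exact (hpos v hv).le
      add_left := fun u v w => by simp
      smul_left := fun u v r => by simp
      definite := fun v hv => by
        by_contra h
        exact (hpos v h).ne' hv }
  let _ : NormedAddCommGroup V := core.toNormedAddCommGroup
  let _ : InnerProductSpace ℝ V := InnerProductSpace.ofCore core.toCore
  let b := stdOrthonormalBasis ℝ V
  exact ⟨b, fun i j => orthonormal_iff_ite.mp b.orthonormal i j, fun v => b.sum_repr' v⟩

variable {ι : Type*} [Fintype ι] {B : V →ₗ[ℝ] V →ₗ[ℝ] ℝ} {b : ι → V}

theorem sum_sq_eq_of_orthonormal_family (hb : ∀ v, ∑ i, B (b i) v • b i = v) (v : V) :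
    ∑ i, B (b i) v ^ 2 = B v v := by
  conv_rhs => enter [1]; rw [← hb v]
  simp [pow_two]

theorem sq_le_sum_sq_mul_of_orthonormal_family (hb : ∀ v, ∑ i, B (b i) v • b i = v)
    (L : V →ₗ[ℝ] ℝ) (v : V) : L v ^ 2 ≤ (∑ i, L (b i) ^ 2) * B v v := by
  have h : L v = ∑ i, L (b i) * B (b i) v := by
    conv_lhs => rw [← hb v, map_sum]
    simp [mul_comm]
  rw [h, ← sum_sq_eq_of_orthonormal_family hb v]
  exact Finset.sum_mul_sq_le_sq_mul_sq _ _ _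

theorem sum_sq_comp_isometry_le [DecidableEq ι]
    (ho : ∀ i j, B (b i) (b j) = if i = j then 1 else 0)
    (hb : ∀ v, ∑ i, B (b i) v • b i = v) (L : V →ₗ[ℝ] ℝ) (T : V →ₗ[ℝ] V)
    (hT : ∀ v, B (T v) (T v) = B v v) :
    ∑ i, L (T (b i)) ^ 2 ≤ ∑ i, L (b i) ^ 2 := by
  set c := ∑ i, L (T (b i)) ^ 2 with hc
  set v := ∑ i, L (T (b i)) • b i with hv
  have h1 : L (T v) = c := by simp [hv, hc, pow_two]
  have h2 : B v v = c := by
    simp [hv, hc, ho, pow_two]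
  have h3 := sq_le_sum_sq_mul_of_orthonormal_family hb L (T v)
  rw [h1, hT, h2, pow_two] at h3
  have hc0 : 0 ≤ c := Finset.sum_nonneg fun i _ => sq_nonneg _
  rcases hc0.eq_or_lt with h | h
  · rw [← h]; positivity
  · exact le_of_mul_le_mul_right h3 h

end OrthonormalFamily

section Harmonics

/-- Harmonic polynomials on `ℝⁿ` that are homogeneous of degree `m`. -/
noncomputable def harmonicSubmodule (n m : ℕ) : Submodule ℝ (MvPolynomial (Fin n) ℝ) :=
  homogeneousSubmodule (Fin n) ℝ m ⊓ LinearMap.ker (mpLapLinear n)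

theorem mem_harmonicSubmodule {n m : ℕ} {p : MvPolynomial (Fin n) ℝ} :
    p ∈ harmonicSubmodule n m ↔ p.IsHomogeneous m ∧ mpLap p = 0 := Iff.rfl

theorem coeff_pderiv_pderiv {n : ℕ} (i : Fin n) (p : MvPolynomial (Fin n) ℝ) (a : Fin n →₀ ℕ) :
    coeff a (pderiv i (pderiv i p)) =
      coeff (a + Finsupp.single i 2) p * ((a i + 2) * (a i + 1)) := by
  rw [coeff_pderiv, coeff_pderiv, add_assoc, ← Finsupp.single_add]
  simp
  ring

/-- A harmonic polynomial vanishes as soon as its coefficients of degree at most one in the first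
variable do. -/
theorem eq_zero_of_mpLap_eq_zero {n : ℕ} {p : MvPolynomial (Fin (n + 1)) ℝ} (hp : mpLap p = 0)
    (h : ∀ a : Fin (n + 1) →₀ ℕ, a 0 ≤ 1 → coeff a p = 0) : p = 0 := by
  have key : ∀ d (a : Fin (n + 1) →₀ ℕ), a 0 = d → coeff a p = 0 := by
    intro d
    induction d using Nat.strong_induction_on with
    | _ d ih =>
      intro a ha
      by_cases h1 : a 0 ≤ 1
      · exact h a h1
      · obtain ⟨a', rfl⟩ : ∃ a', a = a' + Finsupp.single 0 2 := by
          refine ⟨a - Finsupp.single 0 2, (tsub_add_cancel_of_le ?_).symm⟩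
          rw [Finsupp.single_le_iff]
          omega
        have hc : coeff a' (mpLap p) = 0 := by rw [hp, coeff_zero]
        simp only [mpLap, coeff_sum, coeff_pderiv_pderiv] at hc
        rw [Fin.sum_univ_succ, Finset.sum_eq_zero, add_zero] at hc
        · rcases mul_eq_zero.mp hc with h' | h'
          · exact h'
          · exact absurd h' (by positivity)
        · intro i _
          rw [ih (a' 0) (by simp at ha; omega) _ (by simp), zero_mul]
  ext a
  rw [key _ a rfl, coeff_zero]

theorem finiteDimensional_and_finrank_harmonicSubmodule_le (N m : ℕ) :
    FiniteDimensional ℝ (harmonicSubmodule (N + 2) m) ∧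
      Module.finrank ℝ (harmonicSubmodule (N + 2) m) ≤ 2 * (m + 1) ^ N := by
  let S := {a : Fin (N + 2) →₀ ℕ // a.degree = m ∧ a 0 ≤ 1}
  let f : S → Fin 2 × (Fin N → Fin (m + 1)) := fun a =>
    (⟨a.1 0, by have := a.2.2; omega⟩, fun i => ⟨a.1 i.succ.succ, by
      have := Finsupp.le_degree i.succ.succ a.1
      have := a.2.1
      omega⟩)
  have hf : Function.Injective f := by
    rintro ⟨a, ha, ha'⟩ ⟨b, hb, hb'⟩ hab
    simp only [f, Prod.mk.injEq, Fin.mk.injEq, funext_iff] at hab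
    obtain ⟨h0, h2⟩ := hab
    rw [Finsupp.degree_eq_sum, Fin.sum_univ_succ, Fin.sum_univ_succ] at ha hb
    simp only [h0, h2] at ha
    ext i
    refine Fin.cases h0 (fun i => Fin.cases ?_ h2 i) i
    change a (Fin.succ 0) = b (Fin.succ 0)
    omega
  have : Finite S := Finite.of_injective f hf
  let _ : Fintype S := Fintype.ofFinite S
  let ev : harmonicSubmodule (N + 2) m →ₗ[ℝ] (S → ℝ) :=
    LinearMap.pi fun a => (lcoeff ℝ a.1).comp (harmonicSubmodule (N + 2) m).subtype
  have hev : Function.Injective ev := by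
    rw [← LinearMap.ker_eq_bot, LinearMap.ker_eq_bot']
    rintro ⟨p, hp⟩ h
    rw [mem_harmonicSubmodule] at hp
    ext1
    refine eq_zero_of_mpLap_eq_zero hp.2 fun a ha => ?_
    by_cases hd : a.degree = m
    · exact congrFun h ⟨a, hd, ha⟩
    · exact hp.1.coeff_eq_zero hd
  refine ⟨FiniteDimensional.of_injective ev hev, ?_⟩
  refine (LinearMap.finrank_le_finrank_of_injective hev).trans ?_
  rw [Module.finrank_fintype_fun_eq_card]
  simpa using Fintype.card_le_of_injective f hf

end Harmonics

section SphereIntegral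

variable {n : ℕ}

instance isProbabilityMeasure_sphMeasure [NeZero n] : IsProbabilityMeasure (sphMeasure n) := by
  have : NeZero (volume : Measure (EuclideanSpace ℝ (Fin n))).toSphere :=
    ⟨Measure.toSphere_ne_zero _⟩
  exact isProbabilityMeasureSMul

instance isOpenPosMeasure_sphMeasure : (sphMeasure n).IsOpenPosMeasure :=
  Measure.isOpenPosMeasure_smul _ (ENNReal.inv_ne_zero.mpr (measure_ne_top _ _))

/-- The restriction of a linear isometry to the unit sphere. -/
noncomputable def sphereIsometry (A : EuclideanSpace ℝ (Fin n) ≃ₗᵢ[ℝ] EuclideanSpace ℝ (Fin n))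
    (η : Metric.sphere (0 : EuclideanSpace ℝ (Fin n)) 1) :
    Metric.sphere (0 : EuclideanSpace ℝ (Fin n)) 1 :=
  ⟨A η, by simp⟩

theorem continuous_sphereIsometry
    (A : EuclideanSpace ℝ (Fin n) ≃ₗᵢ[ℝ] EuclideanSpace ℝ (Fin n)) :
    Continuous (sphereIsometry A) :=
  (A.continuous.comp continuous_subtype_val).subtype_mk _

theorem measurePreserving_sphereIsometry
    (A : EuclideanSpace ℝ (Fin n) ≃ₗᵢ[ℝ] EuclideanSpace ℝ (Fin n)) :
    MeasurePreserving (sphereIsometry A) (sphMeasure n) (sphMeasure n) := by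
  suffices h : MeasurePreserving (sphereIsometry A)
      (volume : Measure (EuclideanSpace ℝ (Fin n))).toSphere
      (volume : Measure (EuclideanSpace ℝ (Fin n))).toSphere from h.smul_measure _
  have hm := (continuous_sphereIsometry A).measurable
  refine ⟨hm, ?_⟩
  ext s hs
  rw [Measure.map_apply hm hs, Measure.toSphere_apply' _ hs, Measure.toSphere_apply' _ (hm hs)]
  congr 1
  conv_rhs =>
    rw [← A.measurePreserving.measure_preimage_emb A.toHomeomorph.measurableEmbedding]
  congr 1
  ext x
  simp only [Set.mem_smul, Set.mem_image, Set.mem_preimage]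
  constructor
  · rintro ⟨r, hr, _, ⟨y, hy, rfl⟩, rfl⟩
    exact ⟨r, hr, _, ⟨_, hy, rfl⟩, by simp [sphereIsometry]⟩
  · rintro ⟨r, hr, _, ⟨y, hy, rfl⟩, h⟩
    refine ⟨r, hr, _, ⟨sphereIsometry A.symm y, ?_, rfl⟩, ?_⟩
    · convert hy
      ext1
      simp [sphereIsometry]
    · apply A.injective
      simp [sphereIsometry, h]

theorem continuous_evP (p : MvPolynomial (Fin n) ℝ) : Continuous (evP p) :=
  (MvPolynomial.continuous_eval p).comp (by fun_prop)

theorem integrable_of_continuous_sphere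
    {f : Metric.sphere (0 : EuclideanSpace ℝ (Fin n)) 1 → ℝ} (hf : Continuous f) [NeZero n] :
    Integrable f (sphMeasure n) :=
  hf.integrable_of_hasCompactSupport (HasCompactSupport.of_compactSpace _)

theorem integrable_evP_mul_evP [NeZero n] (p q : MvPolynomial (Fin n) ℝ) :
    Integrable (fun η : Metric.sphere (0 : EuclideanSpace ℝ (Fin n)) 1 => evP p η * evP q η)
      (sphMeasure n) :=
  integrable_of_continuous_sphere
    (((continuous_evP p).mul (continuous_evP q)).comp continuous_subtype_val)

/-- The `L²(𝕊)` pairing of polynomials. -/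
noncomputable def sphForm (n : ℕ) [NeZero n] :
    MvPolynomial (Fin n) ℝ →ₗ[ℝ] MvPolynomial (Fin n) ℝ →ₗ[ℝ] ℝ :=
  LinearMap.mk₂ ℝ
    (fun p q => ∫ η : Metric.sphere (0 : EuclideanSpace ℝ (Fin n)) 1, evP p η * evP q η
      ∂(sphMeasure n))
    (fun p p' q => by
      rw [← integral_add (integrable_evP_mul_evP p q) (integrable_evP_mul_evP p' q)]
      simp [evP, add_mul])
    (fun c p q => by
      rw [smul_eq_mul, ← integral_const_mul]
      simp [evP, mul_assoc])
    (fun p q q' => by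
      rw [← integral_add (integrable_evP_mul_evP p q) (integrable_evP_mul_evP p q')]
      simp [evP, mul_add])
    (fun c p q => by
      rw [smul_eq_mul, ← integral_const_mul]
      simp [evP, mul_left_comm])

theorem sphForm_apply [NeZero n] (p q : MvPolynomial (Fin n) ℝ) :
    sphForm n p q = ∫ η : Metric.sphere (0 : EuclideanSpace ℝ (Fin n)) 1, evP p η * evP q η
      ∂(sphMeasure n) := rfl

theorem sphForm_comm [NeZero n] (p q : MvPolynomial (Fin n) ℝ) :
    sphForm n p q = sphForm n q p := by
  simp only [sphForm_apply, mul_comm]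

theorem sphForm_isomSubst [NeZero n]
    (A : EuclideanSpace ℝ (Fin n) ≃ₗᵢ[ℝ] EuclideanSpace ℝ (Fin n))
    (p q : MvPolynomial (Fin n) ℝ) :
    sphForm n (isomSubst A p) (isomSubst A q) = sphForm n p q := by
  simp only [sphForm_apply, evP_isomSubst]
  conv_rhs => rw [← (measurePreserving_sphereIsometry A).map_eq]
  have hc : Continuous fun η : Metric.sphere (0 : EuclideanSpace ℝ (Fin n)) 1 =>
      evP p η * evP q η :=
    ((continuous_evP p).mul (continuous_evP q)).comp continuous_subtype_val
  rw [integral_map (continuous_sphereIsometry A).measurable.aemeasurable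
    hc.aestronglyMeasurable]
  rfl

theorem MvPolynomial.IsHomogeneous.evP_smul {m : ℕ} {p : MvPolynomial (Fin n) ℝ}
    (hp : p.IsHomogeneous m) (c : ℝ) (x : EuclideanSpace ℝ (Fin n)) :
    evP p (c • x) = c ^ m * evP p x := by
  simp only [evP, eval_eq', Finset.mul_sum]
  refine Finset.sum_congr rfl fun d hd => ?_
  rw [hp.degree_eq_sum_deg_support hd, ← Finsupp.degree_apply, Finsupp.degree_eq_sum,
    ← Finset.prod_pow_eq_pow_sum]
  simp only [PiLp.smul_apply, smul_eq_mul, mul_pow, Finset.prod_mul_distrib]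
  ring

theorem MvPolynomial.IsHomogeneous.eq_of_evP_sphere_eq {m : ℕ} (hm : m ≠ 0)
    {p q : MvPolynomial (Fin n) ℝ} (hp : p.IsHomogeneous m) (hq : q.IsHomogeneous m)
    (h : ∀ η : Metric.sphere (0 : EuclideanSpace ℝ (Fin n)) 1, evP p η = evP q η) : p = q := by
  refine MvPolynomial.funext fun y => ?_
  change evP p (WithLp.toLp 2 y) = evP q (WithLp.toLp 2 y)
  generalize (WithLp.toLp 2 y : EuclideanSpace ℝ (Fin n)) = x
  by_cases hx : x = 0
  · have h0 := hp.evP_smul 0 x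
    have h0' := hq.evP_smul 0 x
    rw [zero_smul, zero_pow hm, zero_mul] at h0 h0'
    rw [hx, h0, h0']
  · have h1 : x = ‖x‖ • (‖x‖⁻¹ • x) := by
      rw [smul_smul, mul_inv_cancel₀ (norm_ne_zero_iff.mpr hx), one_smul]
    have h2 : ‖‖x‖⁻¹ • x‖ = 1 := norm_smul_inv_norm (𝕜 := ℝ) hx
    rw [h1, hp.evP_smul, hq.evP_smul, h ⟨‖x‖⁻¹ • x, by simpa using h2⟩]

theorem MvPolynomial.IsHomogeneous.sphForm_self_pos [NeZero n] {m : ℕ} (hm : m ≠ 0)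
    {p : MvPolynomial (Fin n) ℝ} (hp : p.IsHomogeneous m) (h0 : p ≠ 0) : 0 < sphForm n p p := by
  have hc : Continuous fun η : Metric.sphere (0 : EuclideanSpace ℝ (Fin n)) 1 =>
      evP p η * evP p η :=
    ((continuous_evP p).mul (continuous_evP p)).comp continuous_subtype_val
  obtain ⟨η, hη⟩ : ∃ η : Metric.sphere (0 : EuclideanSpace ℝ (Fin n)) 1, evP p η ≠ 0 := by
    by_contra! h
    exact h0 (hp.eq_of_evP_sphere_eq hm (isHomogeneous_zero _ _ _) fun η => by
      rw [h]; simp [evP])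
  exact hc.integral_pos_of_hasCompactSupport_nonneg_nonzero
    (HasCompactSupport.of_compactSpace _) (fun η => mul_self_nonneg _)
    (mul_self_ne_zero.mpr hη)

theorem exists_isometry_apply_eq (ζ η : Metric.sphere (0 : EuclideanSpace ℝ (Fin n)) 1) :
    ∃ A : EuclideanSpace ℝ (Fin n) ≃ₗᵢ[ℝ] EuclideanSpace ℝ (Fin n), A ζ = η :=
  ⟨_, Submodule.reflection_sub (by simp)⟩

end SphereIntegral

section Kernel

variable {n m : ℕ}

/-- Linear substitution by an isometry, acting on homogeneous harmonic polynomials. -/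
noncomputable def harmonicIsomSubst (m : ℕ)
    (A : EuclideanSpace ℝ (Fin n) ≃ₗᵢ[ℝ] EuclideanSpace ℝ (Fin n)) :
    harmonicSubmodule n m →ₗ[ℝ] harmonicSubmodule n m :=
  (isomSubst A).toLinearMap.restrict fun p hp =>
    mem_harmonicSubmodule.mpr ⟨isHomogeneous_isomSubst A hp.1, by
      rw [AlgHom.toLinearMap_apply, mpLap_isomSubst, (mem_harmonicSubmodule.mp hp).2, map_zero]⟩

/-- The `L²(𝕊)` inner product on homogeneous harmonic polynomials. -/
noncomputable def harmonicForm (n m : ℕ) [NeZero n] :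
    harmonicSubmodule n m →ₗ[ℝ] harmonicSubmodule n m →ₗ[ℝ] ℝ :=
  (sphForm n).compl₁₂ (harmonicSubmodule n m).subtype (harmonicSubmodule n m).subtype

theorem harmonicForm_apply [NeZero n] (u v : harmonicSubmodule n m) :
    harmonicForm n m u v = sphForm n u v := rfl

/-- Evaluation at a point, as a linear functional. -/
noncomputable def harmonicEval (m : ℕ) (x : Fin n → ℝ) : harmonicSubmodule n m →ₗ[ℝ] ℝ :=
  (aeval x).toLinearMap ∘ₗ (harmonicSubmodule n m).subtype

theorem harmonicEval_apply (x : EuclideanSpace ℝ (Fin n)) (u : harmonicSubmodule n m) :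
    harmonicEval m (fun i => x i) u = evP u x := by
  simp [harmonicEval, evP, aeval_eq_eval]

theorem sum_sq_orthonormal_family_eq [NeZero n] (hm : m ≠ 0) {ι : Type*} [Fintype ι]
    [DecidableEq ι] {b : ι → harmonicSubmodule n m}
    (ho : ∀ i j, harmonicForm n m (b i) (b j) = if i = j then 1 else 0)
    (hb : ∀ v, ∑ i, harmonicForm n m (b i) v • b i = v) :
    ∑ i, (b i : MvPolynomial (Fin n) ℝ) ^ 2 = (Fintype.card ι : ℝ) • normSqPoly n ^ m := by
  set F := ∑ i, (b i : MvPolynomial (Fin n) ℝ) ^ 2 with hF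
  have hFe : ∀ x, evP F x = ∑ i, evP (b i : MvPolynomial (Fin n) ℝ) x ^ 2 := by
    intro x; simp [evP, hF]
  have hle : ∀ ζ η : Metric.sphere (0 : EuclideanSpace ℝ (Fin n)) 1, evP F η ≤ evP F ζ := by
    intro ζ η
    obtain ⟨A, hA⟩ := exists_isometry_apply_eq ζ η
    have h := sum_sq_comp_isometry_le ho hb (harmonicEval m fun i => (ζ : EuclideanSpace ℝ _) i)
      (harmonicIsomSubst m A) fun v => sphForm_isomSubst A v v
    simp only [harmonicEval_apply] at h
    rw [hFe, hFe, ← hA]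
    simp only [← evP_isomSubst]
    exact h
  have hint : ∫ η : Metric.sphere (0 : EuclideanSpace ℝ (Fin n)) 1, evP F η ∂(sphMeasure n) =
      Fintype.card ι := by
    simp only [hFe, pow_two]
    rw [integral_finsetSum _ fun i _ => integrable_evP_mul_evP _ _]
    simp only [← sphForm_apply, ← harmonicForm_apply, ho]
    simp
  have hconst : ∀ ζ : Metric.sphere (0 : EuclideanSpace ℝ (Fin n)) 1,
      evP F ζ = Fintype.card ι := by
    intro ζ
    rw [← hint, integral_congr_ae (g := fun _ => evP F ζ)
      (Filter.Eventually.of_forall fun η => le_antisymm (hle ζ η) (hle η ζ))]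
    simp
  refine IsHomogeneous.eq_of_evP_sphere_eq (m := m * 2) (by omega) ?_ ?_ fun η => ?_
  · exact IsHomogeneous.sum _ _ _ fun i _ => (b i).2.1.pow 2
  · rw [smul_eq_C_mul, mul_comm m]
    exact ((IsHomogeneous.sum _ _ _ fun i _ => isHomogeneous_X_pow i 2).pow m).C_mul _
  · have hη : ∑ i, (η : EuclideanSpace ℝ (Fin n)) i ^ 2 = 1 := by
      rw [← EuclideanSpace.real_norm_sq_eq]; simp
    rw [hconst]
    simp [evP, normSqPoly, hη]

/-- The squared derivative bound with explicit constants. -/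
theorem sq_evP_mpDeriv_le [NeZero n] (hm : m ≠ 0)
    [FiniteDimensional ℝ (harmonicSubmodule n m)] {p : MvPolynomial (Fin n) ℝ}
    (hp : p ∈ harmonicSubmodule n m) {κ : Fin n → ℕ} (hκ : ∑ i, κ i ≤ m)
    (ζ : Metric.sphere (0 : EuclideanSpace ℝ (Fin n)) 1) :
    evP (mpDeriv κ p) ζ ^ 2 ≤ Module.finrank ℝ (harmonicSubmodule n m) *
      (m * (2 * m + n)) ^ (∑ i, κ i) * sphForm n p p := by
  obtain ⟨l, hl, hlp⟩ := exists_list_mpDeriv κ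
  obtain ⟨b, ho, hb⟩ := exists_orthonormal_family_of_posDef (harmonicForm n m)
    (fun u v => sphForm_comm _ _)
    fun v hv => v.2.1.sphForm_self_pos hm (by simpa using hv)
  have hζ : ∑ i, (ζ : EuclideanSpace ℝ (Fin n)) i ^ 2 = 1 := by
    rw [← EuclideanSpace.real_norm_sq_eq]; simp
  obtain ⟨D, hD⟩ : ∃ D : MvPolynomial (Fin n) ℝ →ₗ[ℝ] MvPolynomial (Fin n) ℝ,
      ∀ q, D q = l.foldl (fun q i => pderiv i q) q := by
    clear hl hlp
    induction l with
    | nil => exact ⟨LinearMap.id, fun q => rfl⟩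
    | cons i l ih =>
      obtain ⟨D, hD⟩ := ih
      exact ⟨D ∘ₗ (pderiv i).toLinearMap, fun q => hD _⟩
  let x : Fin n → ℝ := fun i => (ζ : EuclideanSpace ℝ (Fin n)) i
  let L : harmonicSubmodule n m →ₗ[ℝ] ℝ :=
    (aeval x).toLinearMap ∘ₗ D ∘ₗ (harmonicSubmodule n m).subtype
  have hL : ∀ u, L u = eval x (l.foldl (fun q i => pderiv i q) u) := by
    intro u
    simp [L, hD, aeval_eq_eval]
  have h1 := sq_le_sum_sq_mul_of_orthonormal_family hb L ⟨p, hp⟩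
  have h2 : 2 ^ l.length * ∑ i, L (b i) ^ 2 ≤
      Module.finrank ℝ (harmonicSubmodule n m) * (2 * m * (2 * m + n)) ^ l.length := by
    calc 2 ^ l.length * ∑ i, L (b i) ^ 2
        ≤ ∑ i, eval x ((mpLapLinear n ^ l.length) ((b i : MvPolynomial (Fin n) ℝ) ^ 2)) := by
          rw [Finset.mul_sum]
          refine Finset.sum_le_sum fun i _ => ?_
          rw [hL]
          exact two_pow_mul_sq_eval_foldl_pderiv_le x l (mem_harmonicSubmodule.mp (b i).2).2
      _ = Module.finrank ℝ (harmonicSubmodule n m) *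
            eval x ((mpLapLinear n ^ l.length) (normSqPoly n ^ m)) := by
          rw [← map_sum, ← map_sum, sum_sq_orthonormal_family_eq hm ho hb, map_smul, smul_eval,
            Fintype.card_fin]
      _ ≤ _ := by
          gcongr
          exact eval_iterate_mpLapLinear_normSqPoly_pow_le hζ (hl ▸ hκ)
  have h3 : ∑ i, L (b i) ^ 2 ≤
      Module.finrank ℝ (harmonicSubmodule n m) * (m * (2 * m + n)) ^ l.length := by
    rw [mul_assoc 2, mul_pow, mul_left_comm] at h2
    exact le_of_mul_le_mul_left h2 (by positivity)
  have h4 : 0 ≤ sphForm n p p := integral_nonneg fun η => mul_self_nonneg _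
  rw [← hl, hlp]
  calc _ = L ⟨p, hp⟩ ^ 2 := by rw [hL]; rfl
    _ ≤ _ := h1
    _ ≤ _ := mul_le_mul_of_nonneg_right h3 h4

end Kernel

theorem stmt_9 {n : ℕ} (hn : 2 ≤ n) (k : ℕ) (hk : 1 ≤ k) :
    ∃ C > 0, ∀ (m : ℕ), k ≤ m → ∀ p : MvPolynomial (Fin n) ℝ,
      mpLap p = 0 → p.IsHomogeneous m →
      ∀ κ : Fin n → ℕ, (∑ i, κ i) = k →
      ∀ ζ : Metric.sphere (0 : EuclideanSpace ℝ (Fin n)) 1,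
        |evP (mpDeriv κ p) ζ|
          ≤ C * (m : ℝ) ^ ((n : ℝ) / 2 - 1 + k) *
            Real.sqrt (∫ η : Metric.sphere (0 : EuclideanSpace ℝ (Fin n)) 1,
              (evP p η) ^ 2 ∂(sphMeasure n)) := by
  obtain ⟨N, rfl⟩ : ∃ N, n = N + 2 := ⟨n - 2, by omega⟩
  refine ⟨√(2 * 2 ^ N * (N + 4) ^ k), by positivity, fun m hkm p hp hpm κ hκ ζ => ?_⟩
  have hm1 : 1 ≤ m := hk.trans hkm
  have hm1' : (1 : ℝ) ≤ m := by exact_mod_cast hm1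
  obtain ⟨hfin, hrank⟩ := finiteDimensional_and_finrank_harmonicSubmodule_le N m
  have h := sq_evP_mpDeriv_le (by omega) (mem_harmonicSubmodule.mpr ⟨hpm, hp⟩)
    (hκ.trans_le hkm) ζ
  have hI : sphForm (N + 2) p p = ∫ η : Metric.sphere (0 : EuclideanSpace ℝ (Fin (N + 2))) 1,
      evP p η ^ 2 ∂(sphMeasure (N + 2)) := by
    simp only [sphForm_apply, pow_two]
  rw [hκ, hI] at h
  set I := ∫ η : Metric.sphere (0 : EuclideanSpace ℝ (Fin (N + 2))) 1,
      evP p η ^ 2 ∂(sphMeasure (N + 2))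
  have hI0 : 0 ≤ I := integral_nonneg fun η => sq_nonneg _
  have hr : (Module.finrank ℝ (harmonicSubmodule (N + 2) m) : ℝ) ≤ 2 * (2 ^ N * m ^ N) := by
    refine (Nat.cast_le.mpr hrank).trans ?_
    push_cast
    rw [← mul_pow]
    gcongr
    linarith
  have hd : (m * (2 * m + (N + 2 : ℕ)) : ℝ) ≤ (N + 4) * m ^ 2 := by
    push_cast
    nlinarith [mul_le_mul_of_nonneg_left hm1' (by positivity : (0 : ℝ) ≤ (N + 2) * m)]
  have hpow : ((m : ℝ) ^ (((N + 2 : ℕ) : ℝ) / 2 - 1 + k)) ^ 2 = m ^ N * (m ^ 2) ^ k := by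
    rw [← Real.rpow_natCast, ← Real.rpow_mul (by positivity), ← pow_mul, ← pow_add,
      ← Real.rpow_natCast]
    congr 1
    push_cast
    ring
  rw [← Real.sqrt_sq (by positivity : 0 ≤ (m : ℝ) ^ (((N + 2 : ℕ) : ℝ) / 2 - 1 + k)),
    ← Real.sqrt_mul (by positivity), ← Real.sqrt_mul (by positivity), hpow]
  refine Real.abs_le_sqrt (h.trans ?_)
  refine mul_le_mul_of_nonneg_right ?_ hI0
  calc _ ≤ 2 * (2 ^ N * (m : ℝ) ^ N) * ((N + 4) * m ^ 2) ^ k := by gcongr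
    _ = _ := by rw [mul_pow]; ring
end

section
/- Let α > -1. Define c_m(α) by 1/c_m(α) = (n/V_α) ∫₀¹ r^{2m+n-1}(1-r²)^α S_m(r)² dr, where S_m(r) = ₂F₁(m, 1-n/2; m+n/2; r²)/₂F₁(m, 1-n/2; m+n/2; 1) and V_α = Γ(n/2+1)Γ(α+1)/Γ(n/2+α+1). Then there exist constants 0 < c ≤ C such that c·m^{α+1} ≤ c_m(α) ≤ C·m^{α+1} for all m ≥ 1. -/
open MeasureTheory

/-- The Gauss hypergeometric function `₂F₁(a,b;c;z)` (as a series). -/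
noncomputable def hyp2F1 (a b c z : ℝ) : ℝ :=
  ∑' k : ℕ, (Polynomial.eval a (ascPochhammer ℝ k) * Polynomial.eval b (ascPochhammer ℝ k))
    / (Polynomial.eval c (ascPochhammer ℝ k) * (Nat.factorial k : ℝ)) * z ^ k

/-- `S_m(r) = ₂F₁(m,1-n/2;m+n/2;r²) / ₂F₁(m,1-n/2;m+n/2;1)`. -/
noncomputable def Smf (n m : ℕ) (r : ℝ) : ℝ :=
  hyp2F1 m (1 - n / 2) (m + n / 2) (r ^ 2) / hyp2F1 m (1 - n / 2) (m + n / 2) 1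

open Set Filter Topology ProbabilityTheory

lemma hasSum_one_sub_rpow (p : ℝ) {y : ℝ} (hy : |y| < 1) :
    HasSum (fun k : ℕ => (ascPochhammer ℝ k).eval (-p) / (Nat.factorial k : ℝ) * y ^ k)
      ((1 - y) ^ p) := by
  have h := (Real.one_add_rpow_hasFPowerSeriesOnBall_zero (a := p)).hasSum (y := -y)
    (by simpa [enorm_eq_nnnorm, ← NNReal.coe_lt_one] using hy)
  rw [zero_add, ← sub_eq_add_neg] at h
  simp only [binomialSeries_apply, List.prod_ofFn, Finset.prod_const, Finset.card_univ,
    Fintype.card_fin, smul_eq_mul] at h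
  have hcoeff (k : ℕ) : (ascPochhammer ℝ k).eval (-p) / (Nat.factorial k : ℝ) * y ^ k
      = Ring.choose p k * (-y) ^ k := by
    simp only [Ring.choose_eq_smul, Polynomial.descPochhammer_smeval_eq_ascPochhammer,
      Polynomial.ascPochhammer_smeval_cast, Polynomial.ascPochhammer_smeval_eq_eval,
      ascPochhammer_eval_neg_eq_descPochhammer, descPochhammer_eval_eq_ascPochhammer]
    rw [neg_pow y k, smul_eq_mul]
    ring
  simpa only [hcoeff] using h

lemma summable_abs_ascPochhammer_neg_div_factorial {p : ℝ} (hp : 0 ≤ p) :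
    Summable fun k : ℕ => |(ascPochhammer ℝ k).eval (-p) / (Nat.factorial k : ℝ)| := by
  rcases hp.eq_or_lt with rfl | hp
  · refine summable_of_ne_finset_zero (s := {0}) fun k hk => ?_
    have : k ≠ 0 := by simpa using hk
    simp [this]
  set u : ℕ → ℝ := fun k => |(ascPochhammer ℝ k).eval (-p) / (Nat.factorial k : ℝ)| with hu
  have hrec (k : ℕ) (hk : p ≤ k) : p * u k = k * u k - (k + 1 : ℕ) * u (k + 1) := by
    have : u (k + 1) = u k * ((k - p) / (k + 1)) := by
      simp only [hu]
      rw [← abs_of_nonneg (a := ((k - p) / (k + 1) : ℝ))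
        (div_nonneg (by linarith) (by positivity)), ← abs_mul, ascPochhammer_succ_eval,
        Nat.factorial_succ]
      push_cast
      congr 1
      field_simp
      ring
    rw [this]
    push_cast
    field_simp
    ring
  obtain ⟨N, hN⟩ := exists_nat_ge p
  rw [← summable_nat_add_iff N]
  refine summable_of_sum_range_le (c := N * u N / p) (fun k => abs_nonneg _) fun M => ?_
  have hsum : ∀ M : ℕ, p * ∑ i ∈ Finset.range M, u (i + N) = N * u N - (M + N : ℕ) * u (M + N) := by
    intro M
    induction M with
    | zero => simp
    | succ M ih =>
      rw [Finset.sum_range_succ, mul_add, ih, hrec (M + N) (by push_cast; linarith [M.cast_nonneg (α := ℝ)])]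
      rw [show M + 1 + N = M + N + 1 by ring]
      ring
  rw [le_div_iff₀ hp, mul_comm, hsum]
  have : 0 ≤ ((M + N : ℕ) : ℝ) * u (M + N) := mul_nonneg (Nat.cast_nonneg _) (abs_nonneg _)
  linarith

lemma integrableOn_rpow_mul_one_sub_rpow {a b : ℝ} (ha : 0 < a) (hb : 0 < b) :
    IntegrableOn (fun t : ℝ => t ^ (a - 1) * (1 - t) ^ (b - 1)) (Ioo 0 1) := by
  have h := Complex.betaIntegral_convergent (u := a) (v := b) (by simpa) (by simpa)
  rw [intervalIntegrable_iff_integrableOn_Ioo_of_le zero_le_one] at h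
  refine IntegrableOn.congr_fun h.re (fun x hx => ?_) measurableSet_Ioo
  have h1 : (0 : ℝ) ≤ x := hx.1.le
  have h2 : (0 : ℝ) ≤ 1 - x := by linarith [hx.2]
  simp only [RCLike.re_to_complex]
  norm_cast
  rw [← Complex.ofReal_cpow h1, ← Complex.ofReal_cpow h2]
  norm_cast

lemma integral_rpow_mul_one_sub_rpow {a b : ℝ} (ha : 0 < a) (hb : 0 < b) :
    ∫ t in Ioo (0 : ℝ) 1, t ^ (a - 1) * (1 - t) ^ (b - 1) = beta a b := by
  have h := Complex.betaIntegral_convergent (u := a) (v := b) (by simpa) (by simpa)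
  rw [intervalIntegrable_iff_integrableOn_Ioo_of_le zero_le_one] at h
  rw [beta_eq_betaIntegralReal a b ha hb, Complex.betaIntegral,
    intervalIntegral.integral_of_le zero_le_one, integral_Ioc_eq_integral_Ioo,
    ← RCLike.re_to_complex, ← integral_re h]
  refine setIntegral_congr_fun measurableSet_Ioo fun x hx => ?_
  have h1 : (0 : ℝ) ≤ x := hx.1.le
  have h2 : (0 : ℝ) ≤ 1 - x := by linarith [hx.2]
  simp only [RCLike.re_to_complex]
  norm_cast
  rw [← Complex.ofReal_cpow h1, ← Complex.ofReal_cpow h2]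
  norm_cast

lemma Gamma_add_natCast {a : ℝ} (ha : 0 < a) (k : ℕ) :
    Real.Gamma (a + k) = (ascPochhammer ℝ k).eval a * Real.Gamma a := by
  induction k with
  | zero => simp
  | succ k ih =>
    rw [ascPochhammer_succ_eval, Nat.cast_succ, ← add_assoc, Real.Gamma_add_one (by positivity), ih]
    ring

lemma beta_add_natCast {a b : ℝ} (ha : 0 < a) (hb : 0 < b) (k : ℕ) :
    beta (a + k) b
      = (ascPochhammer ℝ k).eval a / (ascPochhammer ℝ k).eval (a + b) * beta a b := by
  rw [beta, beta, add_right_comm, Gamma_add_natCast ha, Gamma_add_natCast (by positivity)]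
  have := ascPochhammer_pos k (a + b) (by positivity)
  have := (Real.Gamma_pos_of_pos (add_pos ha hb)).ne'
  field_simp

/-- The integral in Euler's representation of `₂F₁(a, -p; a + p + 1; x)`. -/
noncomputable def eulerIntegral (a p x : ℝ) : ℝ :=
  ∫ t in Ioo (0 : ℝ) 1, t ^ (a - 1) * (1 - t) ^ p * (1 - x * t) ^ p

lemma hyp2F1_mul_beta {a p x : ℝ} (ha : 0 < a) (hp : 0 ≤ p) (hx : x ∈ Icc (0 : ℝ) 1) :
    hyp2F1 a (-p) (a + (p + 1)) x * beta a (p + 1) = eulerIntegral a p x := by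
  set u : ℕ → ℝ := fun k => (ascPochhammer ℝ k).eval (-p) / (Nat.factorial k : ℝ) with hu
  set F : ℕ → ℝ → ℝ := fun k t => u k * x ^ k * (t ^ (a + k - 1) * (1 - t) ^ (p + 1 - 1)) with hF
  have hk (k : ℕ) : 0 < a + k := by positivity
  have hFi (k : ℕ) : IntegrableOn (F k) (Ioo 0 1) :=
    (integrableOn_rpow_mul_one_sub_rpow (hk k) (by positivity : 0 < p + 1)).const_mul _
  have hFv (k : ℕ) : ∫ t in Ioo (0 : ℝ) 1, F k t = u k * x ^ k * beta (a + k) (p + 1) := by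
    rw [integral_const_mul, integral_rpow_mul_one_sub_rpow (hk k) (by positivity)]
  have hFn (k : ℕ) : ∫ t in Ioo (0 : ℝ) 1, ‖F k t‖ = |u k| * x ^ k * beta (a + k) (p + 1) := by
    rw [← integral_rpow_mul_one_sub_rpow (hk k) (by positivity), ← integral_const_mul]
    refine setIntegral_congr_fun measurableSet_Ioo fun t ht => ?_
    have h1 : 0 ≤ t ^ (a + k - 1) := Real.rpow_nonneg ht.1.le _
    have h2 : 0 ≤ (1 - t) ^ (p + 1 - 1) := Real.rpow_nonneg (by linarith [ht.2]) _
    simp only [hF, norm_mul, Real.norm_eq_abs, abs_of_nonneg h1, abs_of_nonneg h2, abs_pow,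
      abs_of_nonneg hx.1]
  have hanti (k : ℕ) : beta (a + k) (p + 1) ≤ beta a (p + 1) := by
    rw [← integral_rpow_mul_one_sub_rpow (hk k) (by positivity),
      ← integral_rpow_mul_one_sub_rpow ha (by positivity)]
    refine setIntegral_mono_on (integrableOn_rpow_mul_one_sub_rpow (hk k) (by positivity))
      (integrableOn_rpow_mul_one_sub_rpow ha (by positivity)) measurableSet_Ioo fun t ht => ?_
    refine mul_le_mul_of_nonneg_right ?_ (Real.rpow_nonneg (by linarith [ht.2]) _)
    exact Real.rpow_le_rpow_of_exponent_ge ht.1 ht.2.le (by linarith [k.cast_nonneg (α := ℝ)])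
  have hsum : Summable fun k => ∫ t in Ioo (0 : ℝ) 1, ‖F k t‖ := by
    simp only [hFn]
    refine Summable.of_nonneg_of_le (fun k => ?_) (fun k => ?_)
      ((summable_abs_ascPochhammer_neg_div_factorial hp).mul_right (beta a (p + 1)))
    · have := (beta_pos (hk k) (by positivity : 0 < p + 1)).le
      have := hx.1
      positivity
    · refine mul_le_mul ?_ (hanti k) (beta_pos (hk k) (by positivity)).le (abs_nonneg _)
      exact mul_le_of_le_one_right (abs_nonneg _) (pow_le_one₀ hx.1 hx.2)
  have key := (hasSum_integral_of_summable_integral_norm hFi hsum).tsum_eq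
  have hR : ∫ t in Ioo (0 : ℝ) 1, ∑' k, F k t = eulerIntegral a p x := by
    refine setIntegral_congr_fun measurableSet_Ioo fun t ht => ?_
    have hxt : |x * t| < 1 := by
      rw [abs_of_nonneg (mul_nonneg hx.1 ht.1.le)]
      nlinarith [hx.1, hx.2, ht.1, ht.2]
    refine (((hasSum_one_sub_rpow p hxt).mul_left (t ^ (a - 1) * (1 - t) ^ p)).congr_fun fun k => ?_).tsum_eq
    have h1 : t ^ (a + k - 1) = t ^ (a - 1) * t ^ k := by
      rw [← Real.rpow_natCast, ← Real.rpow_add ht.1]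
      ring_nf
    simp only [hF, hu, h1, add_sub_cancel_right, mul_pow]
    ring
  rw [← hR, ← key, hyp2F1, ← tsum_mul_right]
  refine tsum_congr fun k => ?_
  rw [hFv, beta_add_natCast ha (by positivity)]
  simp only [hu]
  field_simp

lemma integrableOn_eulerIntegral {a p x : ℝ} (ha : 0 < a) (hp : 0 ≤ p) (hx : x ∈ Icc (0 : ℝ) 1) :
    IntegrableOn (fun t : ℝ => t ^ (a - 1) * (1 - t) ^ p * (1 - x * t) ^ p) (Ioo 0 1) := by
  have h := integrableOn_rpow_mul_one_sub_rpow ha (by positivity : 0 < p + 1)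
  simp only [add_sub_cancel_right] at h
  refine h.mono' (by fun_prop) ?_
  refine ae_restrict_of_forall_mem measurableSet_Ioo fun t ht => ?_
  have h1 : 0 ≤ t ^ (a - 1) := Real.rpow_nonneg ht.1.le _
  have h2 : 0 ≤ (1 - t) ^ p := Real.rpow_nonneg (by linarith [ht.2]) _
  have hxt : x * t ≤ 1 := by nlinarith [hx.1, hx.2, ht.1, ht.2]
  have hxt' : 0 ≤ x * t := mul_nonneg hx.1 ht.1.le
  have h3 : 0 ≤ (1 - x * t) ^ p := Real.rpow_nonneg (by linarith) _
  rw [Real.norm_of_nonneg (by positivity)]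
  exact mul_le_of_le_one_right (by positivity) (Real.rpow_le_one (by linarith) (by linarith) hp)

lemma eulerIntegral_antitoneOn {a p : ℝ} (ha : 0 < a) (hp : 0 ≤ p) :
    AntitoneOn (eulerIntegral a p) (Icc 0 1) := by
  intro x hx y hy hxy
  refine setIntegral_mono_on (integrableOn_eulerIntegral ha hp hy)
    (integrableOn_eulerIntegral ha hp hx) measurableSet_Ioo fun t ht => ?_
  refine mul_le_mul_of_nonneg_left (Real.rpow_le_rpow ?_ ?_ hp) (mul_nonneg
    (Real.rpow_nonneg ht.1.le _) (Real.rpow_nonneg (by linarith [ht.2]) _))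
  · nlinarith [hy.1, hy.2, ht.1, ht.2]
  · nlinarith [ht.1]

lemma eulerIntegral_one {a p : ℝ} (ha : 0 < a) (hp : 0 ≤ p) :
    eulerIntegral a p 1 = beta a (2 * p + 1) := by
  rw [← integral_rpow_mul_one_sub_rpow ha (by positivity)]
  refine setIntegral_congr_fun measurableSet_Ioo fun t ht => ?_
  simp only [one_mul]
  rw [mul_assoc, ← Real.rpow_add (by linarith [ht.2])]
  ring_nf

lemma eulerIntegral_le {a p x : ℝ} (ha : 0 < a) (hp : 0 ≤ p) (hx : x ∈ Icc (0 : ℝ) 1) :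
    eulerIntegral a p x ≤ 2 ^ p * (beta a (2 * p + 1) + (1 - x) ^ p * beta a (p + 1)) := by
  have hi := integrableOn_rpow_mul_one_sub_rpow ha (by positivity : 0 < p + 1)
  have h1 := integrableOn_eulerIntegral ha hp (x := 1) (by simp)
  rw [← eulerIntegral_one ha hp, ← integral_rpow_mul_one_sub_rpow ha (by positivity : 0 < p + 1),
    ← integral_const_mul, eulerIntegral, eulerIntegral, ← integral_add h1 (hi.const_mul _), ← integral_const_mul]
  refine setIntegral_mono_on (integrableOn_eulerIntegral ha hp hx)
    ((h1.add (hi.const_mul _)).const_mul _) measurableSet_Ioo fun t ht => ?_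
  have ht0 : 0 ≤ 1 - t := by linarith [ht.2]
  have hx0 : 0 ≤ 1 - x := by linarith [hx.2]
  have h2 : 0 ≤ t ^ (a - 1) * (1 - t) ^ p :=
    mul_nonneg (Real.rpow_nonneg ht.1.le _) (Real.rpow_nonneg ht0 _)
  have h3 : (1 - x * t) ^ p ≤ 2 ^ p * ((1 - t) ^ p + (1 - x) ^ p) := by
    have hle : 1 - x * t ≤ 2 * max (1 - t) (1 - x) := by
      have := le_max_left (1 - t) (1 - x)
      have := le_max_right (1 - t) (1 - x)
      nlinarith [hx.1, hx.2, ht.1, ht.2]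
    refine (Real.rpow_le_rpow (by nlinarith [hx.1, hx.2, ht.1, ht.2]) hle hp).trans ?_
    rw [Real.mul_rpow zero_le_two (ht0.trans (le_max_left _ _))]
    refine mul_le_mul_of_nonneg_left ?_ (by positivity)
    have h4 := Real.rpow_nonneg ht0 p
    have h5 := Real.rpow_nonneg hx0 p
    rcases max_choice (1 - t) (1 - x) with h | h <;> rw [h] <;> linarith
  have := mul_le_mul_of_nonneg_left h3 h2
  simp only [add_sub_cancel_right, one_mul]
  linarith

lemma exists_pos_bounds_of_tendsto {f : ℕ → ℝ} {L : ℝ} (hf : ∀ m : ℕ, 1 ≤ m → 0 < f m)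
    (hL : 0 < L) (h : Tendsto f atTop (𝓝 L)) :
    ∃ c C : ℝ, 0 < c ∧ 0 < C ∧ ∀ m : ℕ, 1 ≤ m → c ≤ f m ∧ f m ≤ C := by
  obtain ⟨C, hC⟩ := h.bddAbove_range
  obtain ⟨D, hD⟩ := (h.inv₀ hL.ne').bddAbove_range
  have hC' (m : ℕ) : f m ≤ C := hC ⟨m, rfl⟩
  have hD' (m : ℕ) : (f m)⁻¹ ≤ D := hD ⟨m, rfl⟩
  have hD0 : 0 < D := (inv_pos.2 (hf 1 le_rfl)).trans_le (hD' 1)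
  exact ⟨D⁻¹, C, inv_pos.2 hD0, (hf 1 le_rfl).trans_le (hC' 1), fun m hm =>
    ⟨inv_le_of_inv_le₀ (hf m hm) (hD' m), hC' m⟩⟩

lemma tendsto_Gamma_natCast_add_div {s : ℝ} (hs : 0 ≤ s) :
    Tendsto (fun m : ℕ => Real.Gamma (m + s) / (Real.Gamma m * (m : ℝ) ^ s)) atTop (𝓝 1) := by
  rcases hs.eq_or_lt with rfl | hs
  · refine tendsto_const_nhds.congr' ?_
    filter_upwards [eventually_ge_atTop 1] with m hm
    have : Real.Gamma m ≠ 0 := (Real.Gamma_pos_of_pos (by exact_mod_cast hm)).ne'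
    simp [this]
  have hΓ := Real.Gamma_pos_of_pos hs
  have hprod (m : ℕ) : Real.Gamma (s + m) = (∏ j ∈ Finset.range m, (s + j)) * Real.Gamma s := by
    induction m with
    | zero => simp
    | succ m ih =>
      rw [Nat.cast_succ, ← add_assoc, Real.Gamma_add_one (by positivity), ih,
        Finset.prod_range_succ]
      ring
  have h1 : Tendsto (fun m : ℕ => Real.Gamma s / Real.GammaSeq s m * ((m : ℝ) / (m + s)))
      atTop (𝓝 (Real.Gamma s / Real.Gamma s * 1)) :=
    (tendsto_const_nhds.div (Real.GammaSeq_tendsto_Gamma s) hΓ.ne').mul (tendsto_natCast_div_add_atTop s)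
  rw [div_self hΓ.ne', one_mul] at h1
  refine h1.congr' ?_
  filter_upwards [eventually_ge_atTop 1] with m hm
  have hm' : (0 : ℝ) < m := by exact_mod_cast hm
  have hP : 0 < ∏ j ∈ Finset.range m, (s + j) := Finset.prod_pos fun j _ => by positivity
  have hfac : (m.factorial : ℝ) = m * Real.Gamma m := by
    rw [← Real.Gamma_nat_eq_factorial, Real.Gamma_add_one hm'.ne']
  have hΓm := Real.Gamma_pos_of_pos hm'
  rw [add_comm (m : ℝ) s, hprod, Real.GammaSeq, Finset.prod_range_succ, hfac]
  have hms := Real.rpow_pos_of_pos hm' s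
  field_simp

lemma exists_pos_bounds_beta_natCast_add {s q : ℝ} (hs : 0 ≤ s) (hq : 0 < q) :
    ∃ c C : ℝ, 0 < c ∧ 0 < C ∧ ∀ m : ℕ, 1 ≤ m →
      c ≤ beta (m + s) q * (m : ℝ) ^ q ∧ beta (m + s) q * (m : ℝ) ^ q ≤ C := by
  refine exists_pos_bounds_of_tendsto (fun m hm => ?_) (Real.Gamma_pos_of_pos hq) ?_
  · have hm' : (0 : ℝ) < m := by exact_mod_cast hm
    exact mul_pos (beta_pos (by positivity) hq) (by positivity)
  have h := ((tendsto_Gamma_natCast_add_div hs).div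
    (tendsto_Gamma_natCast_add_div (add_nonneg hs hq.le)) one_ne_zero).const_mul (Real.Gamma q)
  rw [div_one, mul_one] at h
  refine h.congr' ?_
  filter_upwards [eventually_ge_atTop 1] with m hm
  have hm' : (0 : ℝ) < m := by exact_mod_cast hm
  have h1 := Real.Gamma_pos_of_pos hm'
  have h2 := Real.Gamma_pos_of_pos (by positivity : 0 < (m : ℝ) + (s + q))
  have h3 := Real.rpow_pos_of_pos hm' s
  have h4 := Real.rpow_pos_of_pos hm' q
  simp only [Pi.div_apply]
  rw [beta, add_assoc, Real.rpow_add hm']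
  field_simp

lemma image_sq_Ioo : (fun r : ℝ => r ^ 2) '' Ioo 0 1 = Ioo 0 1 := by
  ext x
  constructor
  · rintro ⟨r, ⟨h0, h1⟩, rfl⟩
    exact ⟨by positivity, by simp only; nlinarith⟩
  · rintro ⟨h0, h1⟩
    exact ⟨√x, ⟨Real.sqrt_pos.2 h0, by rwa [Real.sqrt_lt' one_pos, one_pow]⟩, Real.sq_sqrt h0.le⟩

lemma injOn_sq_Ioo : InjOn (fun r : ℝ => r ^ 2) (Ioo 0 1) := fun _ hx _ hy h =>
  (pow_left_inj₀ hx.1.le hy.1.le two_ne_zero).1 h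

lemma radial_jacobian (N : ℕ) (b : ℝ) {r : ℝ} (hr : r ∈ Ioo (0 : ℝ) 1) :
    |2 * r| • ((r ^ 2) ^ (((N : ℝ) + 1) / 2 - 1) * (1 - r ^ 2) ^ b)
      = 2 * (r ^ N * (1 - r ^ 2) ^ b) := by
  have : (r ^ 2) ^ (((N : ℝ) + 1) / 2 - 1) * r = r ^ N := by
    rw [← Real.rpow_natCast r 2, ← Real.rpow_mul hr.1.le, ← Real.rpow_natCast r N]
    nth_rw 2 [← Real.rpow_one r]
    rw [← Real.rpow_add hr.1]
    congr 1
    push_cast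
    ring
  rw [abs_of_pos (by linarith [hr.1]), smul_eq_mul, ← this]
  ring

lemma integrableOn_pow_mul_one_sub_sq_rpow {N : ℕ} {b : ℝ} (hb : -1 < b) :
    IntegrableOn (fun r : ℝ => r ^ N * (1 - r ^ 2) ^ b) (Ioo 0 1) := by
  have h := integrableOn_rpow_mul_one_sub_rpow (a := ((N : ℝ) + 1) / 2) (b := b + 1)
    (by positivity) (by linarith)
  rw [← image_sq_Ioo, integrableOn_image_iff_integrableOn_abs_deriv_smul measurableSet_Ioo
    (f' := fun r => 2 * r) (fun x _ => by simpa using (hasDerivAt_pow 2 x).hasDerivWithinAt)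
    injOn_sq_Ioo] at h
  refine IntegrableOn.congr_fun (h.const_mul 2⁻¹) (fun r hr => ?_) measurableSet_Ioo
  simp only [add_sub_cancel_right]
  rw [radial_jacobian N b hr]
  ring

lemma integral_pow_mul_one_sub_sq_rpow {N : ℕ} {b : ℝ} (hb : -1 < b) :
    ∫ r in Ioo (0 : ℝ) 1, r ^ N * (1 - r ^ 2) ^ b = beta (((N : ℝ) + 1) / 2) (b + 1) / 2 := by
  rw [← integral_rpow_mul_one_sub_rpow (by positivity) (by linarith)]
  conv_rhs => rw [← image_sq_Ioo]
  rw [integral_image_eq_integral_abs_deriv_smul measurableSet_Ioo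
    (f' := fun r => 2 * r) (fun x _ => by simpa using (hasDerivAt_pow 2 x).hasDerivWithinAt)
    injOn_sq_Ioo, div_eq_inv_mul, ← integral_const_mul]
  refine setIntegral_congr_fun measurableSet_Ioo fun r hr => ?_
  simp only [add_sub_cancel_right]
  rw [radial_jacobian N b hr]
  ring

lemma Smf_eq_eulerIntegral_div {n m : ℕ} (hn : 2 ≤ n) (hm : 1 ≤ m) {r : ℝ}
    (hr : r ∈ Ioo (0 : ℝ) 1) :
    Smf n m r = eulerIntegral m ((n : ℝ) / 2 - 1) (r ^ 2) /
      eulerIntegral m ((n : ℝ) / 2 - 1) 1 := by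
  have hn' : (2 : ℝ) ≤ n := by exact_mod_cast hn
  have hm' : (0 : ℝ) < m := by exact_mod_cast hm
  have hp : 0 ≤ (n : ℝ) / 2 - 1 := by linarith
  rw [← hyp2F1_mul_beta hm' hp ⟨by positivity, by nlinarith [hr.1, hr.2]⟩,
    ← hyp2F1_mul_beta hm' hp ⟨zero_le_one, le_rfl⟩,
    mul_div_mul_right _ _ (beta_pos hm' (by linarith)).ne', Smf]
  simp only [neg_sub, sub_add_cancel]

lemma aemeasurable_Smf {n m : ℕ} (hn : 2 ≤ n) (hm : 1 ≤ m) :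
    AEMeasurable (Smf n m) (volume.restrict (Ioo 0 1)) := by
  have hn' : (2 : ℝ) ≤ n := by exact_mod_cast hn
  have hm' : (0 : ℝ) < m := by exact_mod_cast hm
  have hp : 0 ≤ (n : ℝ) / 2 - 1 := by linarith
  refine aemeasurable_restrict_of_antitoneOn measurableSet_Ioo fun x hx y hy hxy => ?_
  rw [Smf_eq_eulerIntegral_div hn hm hx, Smf_eq_eulerIntegral_div hn hm hy]
  refine div_le_div_of_nonneg_right (eulerIntegral_antitoneOn hm' hp
    ⟨by positivity, by nlinarith [hx.1, hx.2]⟩ ⟨by positivity, by nlinarith [hy.1, hy.2]⟩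
    (pow_le_pow_left₀ hx.1.le hxy 2)) ?_
  rw [eulerIntegral_one hm' hp]
  exact (beta_pos hm' (by linarith)).le

lemma one_le_Smf {n m : ℕ} (hn : 2 ≤ n) (hm : 1 ≤ m) {r : ℝ} (hr : r ∈ Ioo (0 : ℝ) 1) :
    1 ≤ Smf n m r := by
  have hn' : (2 : ℝ) ≤ n := by exact_mod_cast hn
  have hm' : (0 : ℝ) < m := by exact_mod_cast hm
  have hp : 0 ≤ (n : ℝ) / 2 - 1 := by linarith
  have hr2 : r ^ 2 ∈ Icc (0 : ℝ) 1 := ⟨by positivity, by nlinarith [hr.1, hr.2]⟩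
  rw [Smf_eq_eulerIntegral_div hn hm hr, one_le_div]
  · exact eulerIntegral_antitoneOn hm' hp hr2 (by simp) hr2.2
  · rw [eulerIntegral_one hm' hp]
    exact beta_pos hm' (by linarith)

lemma exists_Smf_le {n : ℕ} (hn : 2 ≤ n) :
    ∃ K : ℝ, 0 < K ∧ ∀ m : ℕ, 1 ≤ m → ∀ r ∈ Ioo (0 : ℝ) 1,
      Smf n m r ≤ K * (1 + (m : ℝ) ^ ((n : ℝ) / 2 - 1) * (1 - r ^ 2) ^ ((n : ℝ) / 2 - 1)) := by
  have hn' : (2 : ℝ) ≤ n := by exact_mod_cast hn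
  set p := (n : ℝ) / 2 - 1 with hpdef
  have hp : 0 ≤ p := by linarith
  obtain ⟨c₁, C₁, hc₁, hC₁, h₁⟩ := exists_pos_bounds_beta_natCast_add le_rfl
    (by linarith : 0 < p + 1)
  obtain ⟨c₂, C₂, hc₂, hC₂, h₂⟩ := exists_pos_bounds_beta_natCast_add le_rfl
    (by linarith : 0 < 2 * p + 1)
  refine ⟨2 ^ p * (1 + C₁ / c₂), by positivity, fun m hm r hr => ?_⟩
  have hm' : (0 : ℝ) < m := by exact_mod_cast hm
  have hr2 : r ^ 2 ∈ Icc (0 : ℝ) 1 := ⟨by positivity, by nlinarith [hr.1, hr.2]⟩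
  have hB := beta_pos hm' (by linarith : 0 < 2 * p + 1)
  have h1 := (h₁ m hm).2
  have h2 := (h₂ m hm).1
  rw [add_zero] at h1 h2
  have hratio : beta m (p + 1) ≤ C₁ / c₂ * (m : ℝ) ^ p * beta m (2 * p + 1) := by
    have e : (m : ℝ) ^ (2 * p + 1) = (m : ℝ) ^ p * (m : ℝ) ^ (p + 1) := by
      rw [← Real.rpow_add hm']
      ring_nf
    have hmp := Real.rpow_pos_of_pos hm' (p + 1)
    refine le_of_mul_le_mul_right (h1.trans ?_) hmp
    calc C₁ = C₁ / c₂ * c₂ := by field_simp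
      _ ≤ C₁ / c₂ * (beta m (2 * p + 1) * (m : ℝ) ^ (2 * p + 1)) := by gcongr
      _ = _ := by rw [e]; ring
  have hx : 0 ≤ (1 - r ^ 2) ^ p := Real.rpow_nonneg (by linarith [hr2.2]) _
  have hmp := Real.rpow_pos_of_pos hm' p
  rw [Smf_eq_eulerIntegral_div hn hm hr, eulerIntegral_one hm' hp, div_le_iff₀ hB]
  refine (eulerIntegral_le hm' hp hr2).trans ?_
  rw [mul_assoc (2 ^ p), mul_assoc (2 ^ p)]
  refine mul_le_mul_of_nonneg_left ?_ (by positivity)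
  have h3 := mul_le_mul_of_nonneg_left hratio hx
  have h4 : 0 ≤ (m : ℝ) ^ p * (1 - r ^ 2) ^ p * beta m (2 * p + 1) := by positivity
  have h5 : 0 ≤ C₁ / c₂ * beta m (2 * p + 1) := by positivity
  linear_combination h3 + h4 + h5

lemma exists_radialIntegral_bounds {n : ℕ} (hn : 2 ≤ n) {α : ℝ} (hα : -1 < α) :
    ∃ c C : ℝ, 0 < c ∧ 0 < C ∧ ∀ m : ℕ, 1 ≤ m →
      c ≤ (∫ r in (0 : ℝ)..1, r ^ (2 * m + n - 1) * (1 - r ^ 2) ^ α * Smf n m r ^ 2)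
        * (m : ℝ) ^ (α + 1) ∧
      (∫ r in (0 : ℝ)..1, r ^ (2 * m + n - 1) * (1 - r ^ 2) ^ α * Smf n m r ^ 2)
        * (m : ℝ) ^ (α + 1) ≤ C := by
  have hn' : (2 : ℝ) ≤ n := by exact_mod_cast hn
  obtain ⟨K, hK, hSK⟩ := exists_Smf_le hn
  set p := (n : ℝ) / 2 - 1 with hpdef
  have hp : 0 ≤ p := by linarith
  obtain ⟨c₁, C₁, hc₁, hC₁, h₁⟩ := exists_pos_bounds_beta_natCast_add
    (by positivity : 0 ≤ (n : ℝ) / 2) (by linarith : 0 < α + 1)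
  obtain ⟨c₂, C₂, hc₂, hC₂, h₂⟩ := exists_pos_bounds_beta_natCast_add
    (by positivity : 0 ≤ (n : ℝ) / 2) (by linarith : 0 < α + 2 * p + 1)
  refine ⟨c₁ / 2, K ^ 2 * (C₁ + C₂), by positivity, by positivity, fun m hm => ?_⟩
  have hm' : (0 : ℝ) < m := by exact_mod_cast hm
  rw [intervalIntegral.integral_of_le zero_le_one, integral_Ioc_eq_integral_Ioo]
  set N := 2 * m + n - 1 with hN
  have hN' : ((N : ℝ) + 1) / 2 = m + (n : ℝ) / 2 := by
    have : N + 1 = 2 * m + n := by omega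
    have : (N : ℝ) + 1 = 2 * m + n := by exact_mod_cast this
    rw [this]
    ring
  have hi₁ := integrableOn_pow_mul_one_sub_sq_rpow (N := N) hα
  have hi₂ := integrableOn_pow_mul_one_sub_sq_rpow (N := N) (b := α + 2 * p) (by linarith)
  have hv₁ := integral_pow_mul_one_sub_sq_rpow (N := N) hα
  have hv₂ := integral_pow_mul_one_sub_sq_rpow (N := N) (b := α + 2 * p) (by linarith)
  rw [hN'] at hv₁ hv₂
  set D : ℝ → ℝ := fun r => 2 * K ^ 2 * (r ^ N * (1 - r ^ 2) ^ α)
    + 2 * K ^ 2 * (m : ℝ) ^ (2 * p) * (r ^ N * (1 - r ^ 2) ^ (α + 2 * p)) with hD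
  have hDi : IntegrableOn D (Ioo 0 1) := (hi₁.const_mul _).add (hi₂.const_mul _)
  have hDv : ∫ r in Ioo (0 : ℝ) 1, D r = K ^ 2 * (beta (m + (n : ℝ) / 2) (α + 1)
      + (m : ℝ) ^ (2 * p) * beta (m + (n : ℝ) / 2) (α + 2 * p + 1)) := by
    rw [integral_add (hi₁.const_mul _) (hi₂.const_mul _), integral_const_mul, integral_const_mul,
      hv₁, hv₂]
    ring
  have hw {r : ℝ} (hr : r ∈ Ioo (0 : ℝ) 1) : 0 ≤ r ^ N * (1 - r ^ 2) ^ α :=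
    mul_nonneg (pow_nonneg hr.1.le _) (Real.rpow_nonneg (by nlinarith [hr.1, hr.2]) _)
  have hle : ∀ r ∈ Ioo (0 : ℝ) 1, r ^ N * (1 - r ^ 2) ^ α * Smf n m r ^ 2 ≤ D r := by
    intro r hr
    have h1 := one_le_Smf hn hm hr
    have hpos : 0 < 1 - r ^ 2 := by nlinarith [hr.1, hr.2]
    have h2 : Smf n m r ^ 2 ≤ 2 * K ^ 2 * (1 + (m : ℝ) ^ (2 * p) * (1 - r ^ 2) ^ (2 * p)) := by
      have e : (m : ℝ) ^ (2 * p) * (1 - r ^ 2) ^ (2 * p)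
          = ((m : ℝ) ^ p * (1 - r ^ 2) ^ p) ^ 2 := by
        rw [mul_comm 2 p, Real.rpow_mul hm'.le, Real.rpow_mul hpos.le, mul_pow]
        norm_cast
      rw [e]
      refine (pow_le_pow_left₀ (by linarith) (hSK m hm r hr) 2).trans ?_
      nlinarith [mul_nonneg (sq_nonneg K) (sq_nonneg (1 - (m : ℝ) ^ p * (1 - r ^ 2) ^ p))]
    refine (mul_le_mul_of_nonneg_left h2 (hw hr)).trans_eq ?_
    simp only [hD, Real.rpow_add hpos]
    ring
  have hI : IntegrableOn (fun r => r ^ N * (1 - r ^ 2) ^ α * Smf n m r ^ 2) (Ioo 0 1) := by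
    refine hDi.mono' ((AEMeasurable.mul (by fun_prop)
      ((aemeasurable_Smf hn hm).pow_const 2)).aestronglyMeasurable) ?_
    refine ae_restrict_of_forall_mem measurableSet_Ioo fun r hr => ?_
    rw [Real.norm_of_nonneg (mul_nonneg (hw hr) (sq_nonneg _))]
    exact hle r hr
  have hlow := setIntegral_mono_on hi₁ hI measurableSet_Ioo fun r hr =>
    le_mul_of_one_le_right (hw hr) (one_le_pow₀ (one_le_Smf hn hm hr))
  have hup := setIntegral_mono_on hI hDi measurableSet_Ioo hle
  rw [hv₁] at hlow
  rw [hDv] at hup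
  have hmα := Real.rpow_pos_of_pos hm' (α + 1)
  constructor
  · refine le_trans ?_ (mul_le_mul_of_nonneg_right hlow hmα.le)
    linarith [(h₁ m hm).1]
  · refine (mul_le_mul_of_nonneg_right hup hmα.le).trans ?_
    have e : (m : ℝ) ^ (α + 2 * p + 1) = (m : ℝ) ^ (2 * p) * (m : ℝ) ^ (α + 1) := by
      rw [← Real.rpow_add hm']
      ring_nf
    have h3 := (h₁ m hm).2
    have h4 := (h₂ m hm).2
    rw [e] at h4
    have h5 := mul_le_mul_of_nonneg_left (add_le_add h3 h4) (sq_nonneg K)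
    linarith

theorem stmt_14 {n : ℕ} (hn : 2 ≤ n) (α : ℝ) (hα : -1 < α) :
    ∃ c C : ℝ, 0 < c ∧ c ≤ C ∧ ∀ m : ℕ, 1 ≤ m →
      c * (m : ℝ) ^ (α + 1)
        ≤ (Real.Gamma (n / 2 + 1) * Real.Gamma (α + 1) / Real.Gamma (n / 2 + α + 1))
            / ((n : ℝ) * ∫ r in (0:ℝ)..1,
                r ^ (2 * m + n - 1) * (1 - r ^ 2) ^ α * (Smf n m r) ^ 2) ∧
      (Real.Gamma (n / 2 + 1) * Real.Gamma (α + 1) / Real.Gamma (n / 2 + α + 1))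
          / ((n : ℝ) * ∫ r in (0:ℝ)..1,
              r ^ (2 * m + n - 1) * (1 - r ^ 2) ^ α * (Smf n m r) ^ 2)
        ≤ C * (m : ℝ) ^ (α + 1) := by
  have hn' : (2 : ℝ) ≤ n := by exact_mod_cast hn
  obtain ⟨c, C, hc, hC, h⟩ := exists_radialIntegral_bounds hn hα
  have hV : 0 < Real.Gamma (n / 2 + 1) * Real.Gamma (α + 1) / Real.Gamma (n / 2 + α + 1) :=
    div_pos (mul_pos (Real.Gamma_pos_of_pos (by linarith)) (Real.Gamma_pos_of_pos (by linarith)))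
      (Real.Gamma_pos_of_pos (by linarith))
  set V := Real.Gamma (n / 2 + 1) * Real.Gamma (α + 1) / Real.Gamma (n / 2 + α + 1)
  have hcC : c ≤ C := (h 1 le_rfl).1.trans (h 1 le_rfl).2
  refine ⟨V / (n * C), V / (n * c), by positivity, by gcongr, fun m hm => ?_⟩
  obtain ⟨h1, h2⟩ := h m hm
  have hm' : (0 : ℝ) < m := by exact_mod_cast hm
  have hmα := Real.rpow_pos_of_pos hm' (α + 1)
  set I := ∫ r in (0:ℝ)..1, r ^ (2 * m + n - 1) * (1 - r ^ 2) ^ α * (Smf n m r) ^ 2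
  have hI : 0 < I := pos_of_mul_pos_left (hc.trans_le h1) hmα.le
  constructor
  · rw [div_mul_eq_mul_div, div_le_div_iff₀ (by positivity) (by positivity)]
    have := mul_le_mul_of_nonneg_left h2 (by positivity : 0 ≤ V * n)
    linarith
  · rw [div_mul_eq_mul_div, div_le_div_iff₀ (by positivity) (by positivity)]
    have := mul_le_mul_of_nonneg_left h1 (by positivity : 0 ≤ V * n)
    linarith
end
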